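/- There exists a universal constant c such that every (Q_o,m₁,m₂)-set 𝒬̃ ⊆ ℂ[x₁,…,xₙ] with rank_s(Q_o) ≥ 100 satisfies dim span_ℂ 𝒬̃ ≤ c. (The paper assumes rank_s(Q_o) ≥ rkq for an arbitrary sufficiently large absolute constant rkq; rkq = 100 suffices.) -/

import Mathlib

open MvPolynomial

/-- `rankS Q` is the minimal `r` such that `Q = ∑_{i=1}^r a_i · b_i` for linear forms
`a_i, b_i`. -/
noncomputable def rankS {σ : Type*} (Q : MvPolynomial σ ℂ) : ℕ :=
  sInf {r : ℕ | ∃ a b : Fin r → MvPolynomial σ ℂ,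
    (∀ i, (a i).IsHomogeneous 1) ∧ (∀ i, (b i).IsHomogeneous 1) ∧ Q = ∑ i, a i * b i}

/-- The family of all polynomials of a `(Q_o,m₁,m₂)`-set: `Q_o`, the `Q_j`'s, the `P_i`'s
and the squares `ℓ_t²`. -/
noncomputable def QoFam {n m₁ m₂ r : ℕ} (Qo : MvPolynomial (Fin n) ℂ)
    (Qs : Fin m₁ → MvPolynomial (Fin n) ℂ) (Ps : Fin m₂ → MvPolynomial (Fin n) ℂ)
    (ls : Fin r → MvPolynomial (Fin n) ℂ) :
    Unit ⊕ Fin m₁ ⊕ Fin m₂ ⊕ Fin r → MvPolynomial (Fin n) ℂ :=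
  Sum.elim (fun _ => Qo) (Sum.elim Qs (Sum.elim Ps fun t => ls t ^ 2))

/-- `𝒬̃ = {Q_o} ∪ {Q_j} ∪ {P_i} ∪ {ℓ_t²}` is a `(Q_o,m₁,m₂)`-set (Definition 4.4 of the
paper). -/
def IsQoSet {n : ℕ} (m₁ m₂ r : ℕ) (Qo : MvPolynomial (Fin n) ℂ)
    (Qs : Fin m₁ → MvPolynomial (Fin n) ℂ) (Ps : Fin m₂ → MvPolynomial (Fin n) ℂ)
    (ls : Fin r → MvPolynomial (Fin n) ℂ) : Prop :=
  -- the members of 𝒬₁ and 𝒬₂ are irreducible homogeneous quadratics, the ℓ_t are linear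
  (Qo.IsHomogeneous 2 ∧ Irreducible Qo) ∧
  (∀ j, (Qs j).IsHomogeneous 2 ∧ Irreducible (Qs j)) ∧
  (∀ i, (Ps i).IsHomogeneous 2 ∧ Irreducible (Ps i)) ∧
  (∀ t, (ls t).IsHomogeneous 1) ∧
  -- (1) pairwise linear independence and the vanishing (radical-membership) condition
  (∀ i j, i ≠ j →
    LinearIndependent ℂ ![QoFam Qo Qs Ps ls i, QoFam Qo Qs Ps ls j]) ∧
  (∀ i j, i ≠ j →
    (∏ k ∈ (Finset.univ.erase i).erase j, QoFam Qo Qs Ps ls k) ∈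
      (Ideal.span {QoFam Qo Qs Ps ls i, QoFam Qo Qs Ps ls j}).radical) ∧
  -- (2)
  (5 * m₂ + 2 < m₁) ∧
  -- (3)
  (∀ j, ∃ a b : MvPolynomial (Fin n) ℂ,
    a.IsHomogeneous 1 ∧ b.IsHomogeneous 1 ∧ Qs j = Qo + a * b) ∧
  -- (4)
  (∀ i, ∀ α β : ℂ, ¬(α = 0 ∧ β = 0) → 2 ≤ rankS (α • Ps i + β • Qo)) ∧
  -- (5)
  Set.ncard {i : Unit ⊕ Fin m₁ ⊕ Fin m₂ |
    ∃ c d : MvPolynomial (Fin n) ℂ, c.IsHomogeneous 1 ∧ d.IsHomogeneous 1 ∧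
      Sum.elim (fun _ => Qo) (Sum.elim Qs Ps) i ∈ Ideal.span {c, d} ∧
      Qo ∈ Ideal.span {c, d}} ≤ m₂

open Finset in
theorem two_mul_card_mem_lt {E ι : Type*} [AddCommGroup E] [Module ℂ E] [Fintype ι]
    {v : ι → E} (hpair : ∀ i j, i ≠ j → v i ∉ Submodule.span ℂ {v j})
    (hSG : ∀ i j, i ≠ j → ∃ k, k ≠ i ∧ k ≠ j ∧ v k ∈ Submodule.span ℂ {v i, v j})
    (W : Submodule ℂ E) [DecidablePred fun i => v i ∈ W] {p : ι} (hp : v p ∉ W) :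
    2 * #{i | v i ∈ W} < Fintype.card ι := by
  classical
  have hne : ∀ q, v q ∈ W → p ≠ q := by rintro q hq rfl; exact hp hq
  have key : ∀ q, v q ∈ W → ∃ k, k ≠ p ∧ ∃ a b : ℂ, a ≠ 0 ∧ b ≠ 0 ∧ v k = a • v p + b • v q := by
    intro q hq
    obtain ⟨k, hkp, hkq, hk⟩ := hSG p q (hne q hq)
    obtain ⟨a, b, hab⟩ := Submodule.mem_span_pair.1 hk
    refine ⟨k, hkp, a, b, ?_, ?_, hab.symm⟩
    · rintro rfl
      exact hpair k q hkq (Submodule.mem_span_singleton.2 ⟨b, by simpa using hab⟩)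
    · rintro rfl
      exact hpair k p hkp (Submodule.mem_span_singleton.2 ⟨a, by simpa using hab⟩)
  choose! k hkp a b ha hb hk using key
  have hcard : #{i | v i ∈ W} ≤ #(({i | v i ∉ W} : Finset ι).erase p) := by
    refine card_le_card_of_injOn k ?_ ?_
    · intro q hq
      have hq : v q ∈ W := by simpa using hq
      refine mem_coe.2 (mem_erase.2 ⟨hkp q hq, ?_⟩)
      simp only [mem_filter, mem_univ, true_and]
      intro hkW
      rw [hk q hq] at hkW
      exact hp ((Submodule.smul_mem_iff _ (ha q hq)).1
        ((Submodule.add_mem_iff_left _ (W.smul_mem _ hq)).1 hkW))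
    · intro q hq q' hq' hqq'
      have hq : v q ∈ W := by simpa using hq
      have hq' : v q' ∈ W := by simpa using hq'
      by_contra hne'
      have h1 : a q • v p + b q • v q = a q' • v p + b q' • v q' := by
        rw [← hk q hq, ← hk q' hq', hqq']
      have h2 : (a q - a q') • v p = b q' • v q' - b q • v q := by
        rw [sub_smul, sub_eq_sub_iff_add_eq_add, h1, add_comm]
      have h3 : a q = a q' := by
        by_contra h
        apply hp
        refine (Submodule.smul_mem_iff _ (sub_ne_zero.2 h)).1 ?_
        rw [h2]
        exact W.sub_mem (W.smul_mem _ hq') (W.smul_mem _ hq)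
      rw [h3, sub_self, zero_smul] at h2
      refine hpair q q' hne' (Submodule.mem_span_singleton.2 ⟨(b q)⁻¹ * b q', ?_⟩)
      rw [mul_smul, sub_eq_zero.1 h2.symm, smul_smul, inv_mul_cancel₀ (hb q hq), one_smul]
  rw [card_erase_of_mem (by simpa using hp)] at hcard
  have h1 := card_filter_add_card_filter_not (s := (univ : Finset ι)) (fun i => v i ∈ W)
  have h2 : 0 < #({i | v i ∉ W} : Finset ι) := card_pos.2 ⟨p, by simpa using hp⟩
  rw [card_univ] at h1
  omega

open Finset in
theorem exists_linearIndependent_sum_le {E ι : Type*} [AddCommGroup E] [Module ℂ E] [Fintype ι]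
    (hE : Module.finrank ℂ E = 4)
    {v : ι → E} (hpair : ∀ i j, i ≠ j → v i ∉ Submodule.span ℂ {v j})
    (hSG : ∀ i j, i ≠ j → ∃ k, k ≠ i ∧ k ≠ j ∧ v k ∈ Submodule.span ℂ {v i, v j})
    (hspan : Submodule.span ℂ (Set.range v) = ⊤) (y : ι → ℝ) :
    ∃ I : Fin 4 → ι, LinearIndependent ℂ (v ∘ I) ∧
      Fintype.card ι * ∑ k, y (I k) ≤ 4 * ∑ i, y i := by
  classical
  have hcard : 4 ≤ Fintype.card ι := by
    rw [← hE, ← finrank_top, ← hspan]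
    exact finrank_range_le_card v
  have hout : ∀ s : Finset E, #s < 4 → ∃ i, v i ∉ Submodule.span ℂ (s : Set E) := by
    intro s hs
    by_contra! h
    have h1 : Submodule.span ℂ (s : Set E) = ⊤ := by
      rw [← top_le_iff, ← hspan, Submodule.span_le]
      rintro _ ⟨i, rfl⟩
      exact h i
    have h2 := finrank_span_finset_le_card (R := ℂ) s
    rw [Set.finrank, h1, finrank_top, hE] at h2
    omega
  have hmin : ∀ s : Finset E, #s < 4 → ∃ i, v i ∉ Submodule.span ℂ (s : Set E) ∧
      ∀ j, v j ∉ Submodule.span ℂ (s : Set E) → y i ≤ y j := by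
    intro s hs
    obtain ⟨i, hi⟩ := hout s hs
    obtain ⟨m, hm, hm'⟩ := exists_min_image
      ({i | v i ∉ Submodule.span ℂ (s : Set E)} : Finset ι) y ⟨i, by simpa using hi⟩
    exact ⟨m, by simpa using hm, fun j hj => hm' j (by simpa using hj)⟩
  have hc1 : ∀ x1 : E, #{x1} < 4 := fun _ => by simp
  have hc2 : ∀ x1 x2 : E, #{x1, x2} < 4 := fun x1 x2 => card_le_two.trans_lt (by norm_num)
  have hc3 : ∀ x1 x2 x3 : E, #{x1, x2, x3} < 4 := fun _ _ _ => card_le_three.trans_lt (by norm_num)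
  obtain ⟨i1, h1, m1⟩ := hmin ∅ (by simp)
  obtain ⟨i2, h2, m2⟩ := hmin {v i1} (hc1 _)
  obtain ⟨i3, h3, m3⟩ := hmin {v i2, v i1} (hc2 _ _)
  obtain ⟨i4, h4, m4⟩ := hmin {v i3, v i2, v i1} (hc3 _ _ _)
  simp only [coe_empty, Submodule.span_empty, Submodule.mem_bot, coe_singleton, coe_insert]
    at h1 m1 h2 m2 h3 m3 h4 m4
  have l12 : Submodule.span ℂ {v i1} ≤ Submodule.span ℂ {v i2, v i1} :=
    Submodule.span_mono (by simp)
  have l23 : Submodule.span ℂ {v i2, v i1} ≤ Submodule.span ℂ {v i3, v i2, v i1} :=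
    Submodule.span_mono (by simp)
  have hN : 4 ≤ (Fintype.card ι : ℝ) := by exact_mod_cast hcard
  have hne : ∀ i, v i ≠ 0 := by
    intro i hi
    have : Nontrivial ι := Fintype.one_lt_card_iff_nontrivial.1 (by omega)
    obtain ⟨j, hj⟩ := exists_ne i
    exact hpair i j hj.symm (by rw [hi]; exact Submodule.zero_mem _)
  set W1 := Submodule.span ℂ {v i1} with hW1
  set W2 := Submodule.span ℂ {v i2, v i1} with hW2
  set W3 := Submodule.span ℂ {v i3, v i2, v i1} with hW3
  refine ⟨![i4, i3, i2, i1], ?_, ?_⟩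
  · have : v ∘ ![i4, i3, i2, i1] = ![v i4, v i3, v i2, v i1] := by
      ext k; fin_cases k <;> rfl
    rw [this]
    refine linearIndependent_finCons.2 ⟨linearIndependent_finCons.2 ⟨linearIndependent_finCons.2
      ⟨linearIndependent_finCons.2 ⟨linearIndependent_empty_type, ?_⟩, ?_⟩, ?_⟩, ?_⟩
    · simpa using hne i1
    · simpa using h2
    · simpa [Set.pair_comm (v i1) (v i2)] using h3
    · have : ({v i1, v i2, v i3} : Set E) = {v i3, v i2, v i1} := by ext; simp; tauto
      simpa [this] using h4
  · have e12 : y i1 ≤ y i2 := m1 _ (hne _)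
    have e23 : y i2 ≤ y i3 := m2 _ fun h => h3 (l12 h)
    have e34 : y i3 ≤ y i4 := m3 _ fun h => h4 (l23 h)
    have hpt : ∀ i, y i1 + (if v i ∉ W1 then y i2 - y i1 else 0)
        + (if v i ∉ W2 then y i3 - y i2 else 0) + (if v i ∉ W3 then y i4 - y i3 else 0) ≤ y i := by
      intro i
      by_cases a3 : v i ∉ W3
      · have a2 : v i ∉ W2 := fun h => a3 (l23 h)
        have a1 : v i ∉ W1 := fun h => a2 (l12 h)
        rw [if_pos a1, if_pos a2, if_pos a3]
        linarith [m4 i a3]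
      · by_cases a2 : v i ∉ W2
        · have a1 : v i ∉ W1 := fun h => a2 (l12 h)
          rw [if_pos a1, if_pos a2, if_neg a3]
          linarith [m3 i a2]
        · by_cases a1 : v i ∉ W1
          · rw [if_pos a1, if_neg a2, if_neg a3]
            linarith [m2 i a1]
          · rw [if_neg a1, if_neg a2, if_neg a3]
            linarith [m1 i (hne i)]
    have hsum := sum_le_sum fun i (_ : i ∈ (univ : Finset ι)) => hpt i
    simp only [sum_add_distrib, sum_const, ← sum_filter, card_univ, nsmul_eq_mul] at hsum
    have hsplit : ∀ W : Submodule ℂ E,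
        (#{i | v i ∈ W} : ℝ) + (#{i | v i ∉ W} : ℝ) = Fintype.card ι := by
      intro W
      have := card_filter_add_card_filter_not (s := (univ : Finset ι)) (fun i => v i ∈ W)
      rw [card_univ] at this
      exact_mod_cast this
    have c1 : (#{i | v i ∈ W1} : ℝ) ≤ 1 := by
      have : #{i | v i ∈ W1} ≤ 1 := by
        refine card_le_one.2 fun i hi j hj => ?_
        have hi : v i ∈ W1 := by simpa using hi
        have hj : v j ∈ W1 := by simpa using hj
        have hi' : i = i1 := by by_contra h; exact hpair _ _ h hi
        have hj' : j = i1 := by by_contra h; exact hpair _ _ h hj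
        rw [hi', hj']
      exact_mod_cast this
    have c2 : 2 * (#{i | v i ∈ W2} : ℝ) ≤ Fintype.card ι := by
      exact_mod_cast (two_mul_card_mem_lt hpair hSG W2 h3).le
    have c3 : 2 * (#{i | v i ∈ W3} : ℝ) ≤ Fintype.card ι := by
      exact_mod_cast (two_mul_card_mem_lt hpair hSG W3 h4).le
    have s1 := hsplit W1
    have s2 := hsplit W2
    have s3 := hsplit W3
    simp only [Fin.sum_univ_four, Matrix.cons_val]
    have p1 := mul_nonneg (sub_nonneg.2 e12)
      (by linarith : 0 ≤ 4 * (#{i | v i ∉ W1} : ℝ) - 3 * Fintype.card ι)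
    have p2 := mul_nonneg (sub_nonneg.2 e23)
      (by linarith : 0 ≤ 4 * (#{i | v i ∉ W2} : ℝ) - 2 * Fintype.card ι)
    have p3 := mul_nonneg (sub_nonneg.2 e34)
      (by linarith : 0 ≤ 4 * (#{i | v i ∉ W3} : ℝ) - Fintype.card ι)
    linarith

theorem norm_det_mul_norm_det_le (e : Module.Basis (Fin 4) ℂ (EuclideanSpace ℂ (Fin 4)))
    (he : e = (EuclideanSpace.basisFun (Fin 4) ℂ).toBasis)
    (M : EuclideanSpace ℂ (Fin 4) →ₗ[ℂ] EuclideanSpace ℂ (Fin 4))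
    (w : Fin 4 → EuclideanSpace ℂ (Fin 4)) :
    ‖LinearMap.det M‖ * ‖e.det w‖ ≤ 24 * ∏ k, ‖M (w k)‖ := by
  rw [← norm_mul, ← Module.Basis.det_comp, Module.Basis.det_apply, Matrix.det_apply]
  refine (norm_sum_le _ _).trans ?_
  have : ∀ σ ∈ (Finset.univ : Finset (Equiv.Perm (Fin 4))),
      ‖Equiv.Perm.sign σ • ∏ i, e.toMatrix (⇑M ∘ w) (σ i) i‖ ≤ ∏ k, ‖M (w k)‖ := by
    intro σ _
    rw [Units.smul_def, ← Int.cast_smul_eq_zsmul ℂ, norm_smul]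
    have h1 : ‖((Equiv.Perm.sign σ : ℤ) : ℂ)‖ = 1 := by
      rcases Int.units_eq_one_or (Equiv.Perm.sign σ) with h | h <;> simp [h]
    rw [h1, one_mul, norm_prod]
    refine Finset.prod_le_prod (fun _ _ => norm_nonneg _) fun i _ => ?_
    rw [Module.Basis.toMatrix_apply, he]
    simpa using PiLp.norm_apply_le (M (w i)) (σ i)
  refine (Finset.sum_le_sum this).trans ?_
  rw [Finset.sum_const, Finset.card_univ, Fintype.card_perm, Fintype.card_fin, nsmul_eq_mul]
  norm_num [Nat.factorial]

theorem sq_card_div_two_le_sum_norm_inner_sq {E ι : Type*} [NormedAddCommGroup E]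
    [InnerProductSpace ℂ E] (F : Submodule ℂ E) (hF : Module.finrank ℂ F = 2)
    (s : Finset ι) (w : ι → E) (hw : ∀ i ∈ s, w i ∈ F) (h1 : ∀ i ∈ s, ‖w i‖ = 1) :
    (s.card : ℝ) ^ 2 / 2 ≤ ∑ i ∈ s, ∑ j ∈ s, ‖inner ℂ (w i) (w j)‖ ^ 2 := by
  classical
  have : FiniteDimensional ℂ F := Module.finite_of_finrank_pos (by omega)
  let b : OrthonormalBasis (Fin 2) ℂ F := (stdOrthonormalBasis ℂ F).reindex (finCongr hF)
  let f : ι → F := fun i => if h : w i ∈ F then ⟨w i, h⟩ else 0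
  have hf : ∀ i ∈ s, (f i : E) = w i := fun i hi => by simp [f, hw i hi]
  let a : ι → ℂ := fun i => inner ℂ (b 0) (f i)
  let c : ι → ℂ := fun i => inner ℂ (b 1) (f i)
  let n1 : ι → ℝ := fun i => 2 * ((a i).re * (c i).re + (a i).im * (c i).im)
  let n2 : ι → ℝ := fun i => 2 * ((a i).im * (c i).re - (a i).re * (c i).im)
  let n3 : ι → ℝ := fun i => (a i).re ^ 2 + (a i).im ^ 2 - ((c i).re ^ 2 + (c i).im ^ 2)
  have hinner : ∀ i ∈ s, ∀ j ∈ s, inner ℂ (w i) (w j)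
      = (starRingEnd ℂ) (a i) * a j + (starRingEnd ℂ) (c i) * c j := by
    intro i hi j hj
    rw [← hf i hi, ← hf j hj, ← Submodule.coe_inner, ← b.sum_inner_mul_inner, Fin.sum_univ_two]
    simp [a, c, inner_conj_symm]
  have hunit : ∀ i ∈ s, (a i).re ^ 2 + (a i).im ^ 2 + ((c i).re ^ 2 + (c i).im ^ 2) = 1 := by
    intro i hi
    have h := hinner i hi i hi
    rw [inner_self_eq_norm_sq_to_K, h1 i hi] at h
    have := congrArg Complex.re h
    simp at this
    linarith
  have hterm : ∀ i ∈ s, ∀ j ∈ s, ‖inner ℂ (w i) (w j)‖ ^ 2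
      = 1 / 2 + (n1 i * n1 j + n2 i * n2 j + n3 i * n3 j) / 2 := by
    intro i hi j hj
    have ha := hunit i hi
    have hb := hunit j hj
    have hab : (1 : ℝ) = ((a i).re ^ 2 + (a i).im ^ 2 + ((c i).re ^ 2 + (c i).im ^ 2)) *
        ((a j).re ^ 2 + (a j).im ^ 2 + ((c j).re ^ 2 + (c j).im ^ 2)) := by rw [ha, hb, one_mul]
    rw [hinner i hi j hj, ← Complex.normSq_eq_norm_sq, Complex.normSq_apply]
    nth_rewrite 1 [hab]
    simp [n1, n2, n3]
    ring
  have hsum : ∑ i ∈ s, ∑ j ∈ s, ‖inner ℂ (w i) (w j)‖ ^ 2 = (s.card : ℝ) ^ 2 / 2 +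
      ((∑ i ∈ s, n1 i) ^ 2 + (∑ i ∈ s, n2 i) ^ 2 + (∑ i ∈ s, n3 i) ^ 2) / 2 := by
    rw [Finset.sum_congr rfl fun i hi => Finset.sum_congr rfl fun j hj => hterm i hi j hj]
    simp only [pow_two (∑ i ∈ s, _), Finset.sum_mul_sum, Finset.sum_add_distrib,
      ← Finset.sum_div, Finset.sum_const, nsmul_eq_mul]
    ring
  rw [hsum]
  have := sq_nonneg (∑ i ∈ s, n1 i)
  have := sq_nonneg (∑ i ∈ s, n2 i)
  have := sq_nonneg (∑ i ∈ s, n3 i)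
  linarith

theorem exists_linearMap_sum_norm_inner_sq_le {ι : Type*} [Fintype ι]
    {v : ι → EuclideanSpace ℂ (Fin 4)} (hpair : ∀ i j, i ≠ j → v i ∉ Submodule.span ℂ {v j})
    (hSG : ∀ i j, i ≠ j → ∃ k, k ≠ i ∧ k ≠ j ∧ v k ∈ Submodule.span ℂ {v i, v j})
    (hspan : Submodule.span ℂ (Set.range v) = ⊤) :
    ∃ (M : EuclideanSpace ℂ (Fin 4) →ₗ[ℂ] EuclideanSpace ℂ (Fin 4)),
      LinearMap.det M ≠ 0 ∧ (∀ i, M (v i) ≠ 0) ∧ ∀ j, ∑ i, ‖inner ℂ ((‖M (v j)‖ : ℂ)⁻¹ • M (v j))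
        ((‖M (v i)‖ : ℂ)⁻¹ • M (v i))‖ ^ 2 ≤ ((Fintype.card ι : ℝ) + 1) / 4 := by
  classical
  have hE : Module.finrank ℂ (EuclideanSpace ℂ (Fin 4)) = 4 := by simp
  have hcard : 4 ≤ Fintype.card ι := by
    rw [← hE, ← finrank_top, ← hspan]
    exact finrank_range_le_card v
  have hv : ∀ i, v i ≠ 0 := by
    intro i hi
    have : Nontrivial ι := Fintype.one_lt_card_iff_nontrivial.1 (by omega)
    obtain ⟨j, hj⟩ := exists_ne i
    exact hpair i j hj.symm (by rw [hi]; exact Submodule.zero_mem _)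
  have hMv : ∀ M : EuclideanSpace ℂ (Fin 4) →ₗ[ℂ] EuclideanSpace ℂ (Fin 4),
      LinearMap.det M ≠ 0 → ∀ i, M (v i) ≠ 0 := by
    intro M hM i h
    have : Function.Injective M := by
      have := (LinearMap.isUnit_iff_isUnit_det M).2 (isUnit_iff_ne_zero.2 hM)
      exact ((Module.End.isUnit_iff M).1 this).1
    exact hv i (this (by simpa using h))
  set N : ℝ := (Fintype.card ι : ℝ) with hN
  have hN0 : 0 ≤ N := Nat.cast_nonneg _
  let e := (EuclideanSpace.basisFun (Fin 4) ℂ).toBasis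
  let g : (EuclideanSpace ℂ (Fin 4) →ₗ[ℂ] EuclideanSpace ℂ (Fin 4)) → ℝ := fun M =>
    N * Real.log ‖LinearMap.det M‖ - 4 * ∑ i, Real.log ‖M (v i)‖
  let S := g '' {M | LinearMap.det M ≠ 0}
  have hbdd : BddAbove S := by
    refine ⟨∑ I : Fin 4 → ι, |N * (Real.log 24 - Real.log ‖e.det (v ∘ I)‖)|, ?_⟩
    rintro _ ⟨M, hM, rfl⟩
    obtain ⟨I, hI, hle⟩ := exists_linearIndependent_sum_le hE hpair hSG hspan
      (fun i => Real.log ‖M (v i)‖)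
    have hdet : ‖e.det (v ∘ I)‖ ≠ 0 := by
      rw [norm_ne_zero_iff]
      exact ((Module.Basis.isUnit_det e
        (basisOfLinearIndependentOfCardEqFinrank hI (by simp))).ne_zero) ∘ (by simp)
    have h1 := norm_det_mul_norm_det_le e rfl M (v ∘ I)
    have h2 := Real.log_le_log (by positivity [norm_ne_zero_iff.2 hM]) h1
    have h3 : ∀ k ∈ (Finset.univ : Finset (Fin 4)), ‖M ((v ∘ I) k)‖ ≠ 0 :=
      fun k _ => norm_ne_zero_iff.2 (hMv M hM _)
    rw [Real.log_mul (norm_ne_zero_iff.2 hM) hdet, Real.log_mul (by norm_num)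
      (Finset.prod_ne_zero_iff.2 h3), Real.log_prod h3] at h2
    have h4 : N * (Real.log 24 - Real.log ‖e.det (v ∘ I)‖) ≤ _ :=
      (le_abs_self _).trans (Finset.single_le_sum
        (f := fun I : Fin 4 → ι => |N * (Real.log 24 - Real.log ‖e.det (v ∘ I)‖)|)
        (fun _ _ => abs_nonneg _) (Finset.mem_univ I))
    refine le_trans ?_ h4
    have h5 := mul_le_mul_of_nonneg_left h2 hN0
    simp only [Function.comp_apply] at h5
    simp only [g]
    linarith
  set s : ℝ := 1 / (3 * (N + 1)) with hs
  have hs0 : 0 < s := by positivity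
  have hsN : s * N + s = 1 / 3 := by rw [hs]; field_simp
  have hs1 : s ≤ 1 / 3 := by nlinarith
  have hne : S.Nonempty := ⟨_, LinearMap.id, by simp, rfl⟩
  obtain ⟨_, ⟨M, hM, rfl⟩, hlt⟩ := exists_lt_of_lt_csSup hne (sub_lt_self (sSup S) (pow_pos hs0 2))
  refine ⟨M, hM, hMv M hM, fun j => ?_⟩
  have hpos : ∀ i, 0 < ‖M (v i)‖ := fun i => norm_pos_iff.2 (hMv M hM i)
  set w : ι → EuclideanSpace ℂ (Fin 4) := fun i => (‖M (v i)‖ : ℂ)⁻¹ • M (v i) with hw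
  have hw1 : ∀ i, ‖w i‖ = 1 := fun i => by
    simp [hw, norm_smul, (hpos i).ne']
  have hMw : ∀ i, M (v i) = (‖M (v i)‖ : ℂ) • w i := fun i => by
    have : (‖M (v i)‖ : ℂ) ≠ 0 := by exact_mod_cast (hpos i).ne'
    simp [hw, smul_smul, this]
  let τ : EuclideanSpace ℂ (Fin 4) →ₗ[ℂ] EuclideanSpace ℂ (Fin 4) :=
    LinearMap.transvection (-(s : ℂ) • (innerₛₗ ℂ (w j))) (w j)
  have hτ : ∀ x, τ x = x - (s * inner ℂ (w j) x) • w j := by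
    intro x
    simp [τ, LinearMap.transvection.apply, sub_eq_add_neg]
  have hdetτ : LinearMap.det τ = ((1 - s : ℝ) : ℂ) := by
    simp [τ, LinearMap.transvection.det, inner_self_eq_norm_sq_to_K, hw1, sub_eq_add_neg]
  have hτM : LinearMap.det (τ ∘ₗ M) ≠ 0 := by
    rw [LinearMap.det_comp, hdetτ]
    refine mul_ne_zero ?_ hM
    exact_mod_cast (by linarith : 1 - s ≠ 0)
  have hle : g (τ ∘ₗ M) ≤ sSup S := le_csSup hbdd ⟨_, hτM, rfl⟩
  have ht1 : ∀ i, ‖inner ℂ (w j) (w i)‖ ^ 2 ≤ 1 := fun i => by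
    have := norm_inner_le_norm (𝕜 := ℂ) (w j) (w i)
    rw [hw1, hw1, one_mul] at this
    exact pow_le_one₀ (norm_nonneg _) this
  have hnorm : ∀ i, ‖τ (w i)‖ ^ 2 = 1 - (2 * s - s ^ 2) * ‖inner ℂ (w j) (w i)‖ ^ 2 := by
    intro i
    rw [hτ, @norm_sub_sq ℂ, hw1, norm_smul, hw1, inner_smul_right, ← inner_conj_symm (w i) (w j)]
    have : RCLike.re (s * inner ℂ (w j) (w i) * (starRingEnd ℂ) (inner ℂ (w j) (w i)))
        = s * ‖inner ℂ (w j) (w i)‖ ^ 2 := by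
      rw [mul_assoc, Complex.mul_conj, Complex.normSq_eq_norm_sq, ← Complex.ofReal_mul]
      exact Complex.ofReal_re _
    rw [this, norm_mul, Complex.norm_real, Real.norm_of_nonneg hs0.le]
    ring
  have hlog : ∀ i, Real.log ‖(τ ∘ₗ M) (v i)‖ ≤
      Real.log ‖M (v i)‖ - (2 * s - s ^ 2) * ‖inner ℂ (w j) (w i)‖ ^ 2 / 2 := by
    intro i
    have hτpos : 0 < ‖τ (w i)‖ ^ 2 := by rw [hnorm]; nlinarith [ht1 i]
    have hτpos' : 0 < ‖τ (w i)‖ := by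
      rcases (norm_nonneg (τ (w i))).eq_or_lt with h | h
      · rw [← h] at hτpos; norm_num at hτpos
      · exact h
    have h1 : ‖(τ ∘ₗ M) (v i)‖ = ‖M (v i)‖ * ‖τ (w i)‖ := by
      rw [LinearMap.comp_apply, hMw i, map_smul, norm_smul, norm_smul, hw1]
      simp
    rw [h1, Real.log_mul (hpos i).ne' hτpos'.ne']
    have h2 := Real.log_le_sub_one_of_pos hτpos
    rw [Real.log_pow, hnorm] at h2
    push_cast at h2
    linarith
  have hlogdet : -s - 2 * s ^ 2 ≤ Real.log (1 - s) := by
    have h := Real.one_sub_inv_le_log_of_pos (by linarith : 0 < 1 - s)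
    refine le_trans ?_ h
    have : (1 - s)⁻¹ ≤ 1 + s + 2 * s ^ 2 := by
      rw [inv_le_iff_one_le_mul₀ (by linarith)]
      nlinarith [pow_pos hs0 2]
    linarith
  have hsum := Finset.sum_le_sum fun i (_ : i ∈ (Finset.univ : Finset ι)) => hlog i
  rw [Finset.sum_sub_distrib, ← Finset.sum_div, ← Finset.mul_sum] at hsum
  have hgM : g (τ ∘ₗ M) < g M + s ^ 2 := by linarith
  simp only [g] at hgM
  have hd : ‖LinearMap.det (τ ∘ₗ M)‖ = (1 - s) * ‖LinearMap.det M‖ := by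
    rw [LinearMap.det_comp, hdetτ, norm_mul, Complex.norm_real, Real.norm_of_nonneg (by linarith)]
  rw [hd, Real.log_mul (by linarith) (norm_ne_zero_iff.2 hM)] at hgM
  set T := ∑ i, ‖inner ℂ (w j) (w i)‖ ^ 2 with hT
  have h1 : (4 * s - 2 * s ^ 2) * T ≤ s ^ 2 + N * (s + 2 * s ^ 2) := by
    have := mul_le_mul_of_nonneg_left hlogdet hN0
    linarith
  have h2 : (4 - 2 * s) * T ≤ s + N * (1 + 2 * s) := by
    refine le_of_mul_le_mul_left ?_ hs0
    linarith
  rw [le_div_iff₀ (by norm_num)]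
  nlinarith

open Finset in
theorem sylvesterGallai_euclideanSpace_four {ι : Type*} [Fintype ι]
    {v : ι → EuclideanSpace ℂ (Fin 4)} (hpair : ∀ i j, i ≠ j → v i ∉ Submodule.span ℂ {v j})
    (hSG : ∀ i j, i ≠ j → ∃ k, k ≠ i ∧ k ≠ j ∧ v k ∈ Submodule.span ℂ {v i, v j}) :
    Submodule.span ℂ (Set.range v) ≠ ⊤ := by
  classical
  intro hspan
  obtain ⟨M, hM, hMv, hT⟩ := exists_linearMap_sum_norm_inner_sq_le hpair hSG hspan
  set w : ι → EuclideanSpace ℂ (Fin 4) := fun i => (‖M (v i)‖ : ℂ)⁻¹ • M (v i) with hw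
  have hw1 : ∀ i, ‖w i‖ = 1 := fun i => by simp [hw, norm_smul, hMv i]
  have hinj : Function.Injective M :=
    ((Module.End.isUnit_iff M).1 ((LinearMap.isUnit_iff_isUnit_det M).2
      (isUnit_iff_ne_zero.2 hM))).1
  set N : ℝ := (Fintype.card ι : ℝ) with hN
  have hcard : 4 ≤ Fintype.card ι := by
    have hE : Module.finrank ℂ (EuclideanSpace ℂ (Fin 4)) = 4 := by simp
    rw [← hE, ← finrank_top, ← hspan]
    exact finrank_range_le_card v
  have hv : ∀ i, v i ≠ 0 := fun i hi => hMv i (by rw [hi, map_zero])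
  let L : ι → ι → Submodule ℂ (EuclideanSpace ℂ (Fin 4)) := fun i j => Submodule.span ℂ {v i, v j}
  have hLI : ∀ i j, i ≠ j → LinearIndependent ℂ ![v i, v j] := fun i j hij =>
    LinearIndependent.pair_iff.2 fun a b hab => by
      have ha : a = 0 := by
        by_contra ha
        refine hpair i j hij (Submodule.mem_span_singleton.2 ⟨-(a⁻¹ * b), ?_⟩)
        have : a⁻¹ • (a • v i + b • v j) = 0 := by rw [hab, smul_zero]
        rw [smul_add, smul_smul, inv_mul_cancel₀ ha, one_smul, smul_smul] at this
        rw [neg_smul, eq_neg_of_add_eq_zero_left this]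
      subst ha
      simpa [hv j] using hab
  have hrank : ∀ i j, i ≠ j → Module.finrank ℂ (L i j) = 2 := by
    intro i j hij
    have := finrank_span_eq_card (hLI i j hij)
    rwa [Matrix.range_cons_cons_empty, Fintype.card_fin] at this
  have hLeq : ∀ i j k l, i ≠ j → k ≠ l → v k ∈ L i j → v l ∈ L i j → L k l = L i j := by
    intro i j k l hij hkl hk hl
    refine Submodule.eq_of_le_of_finrank_eq ?_ (by rw [hrank _ _ hij, hrank _ _ hkl])
    refine Submodule.span_le.2 ?_
    rintro x (rfl | rfl)
    · exact hk
    · exact hl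
  let t : Submodule ℂ (EuclideanSpace ℂ (Fin 4)) → Finset ι := fun F => {k | v k ∈ F}
  have ht : ∀ F k, k ∈ t F ↔ v k ∈ F := fun F k => by simp [t]
  let Ls : Finset (Submodule ℂ (EuclideanSpace ℂ (Fin 4))) :=
    (univ : Finset ι).offDiag.image fun p => L p.1 p.2
  have hmaps : ∀ p ∈ (univ : Finset ι).offDiag, L p.1 p.2 ∈ Ls := fun p hp =>
    mem_image_of_mem _ hp
  have hfiber : ∀ F ∈ Ls, ((univ : Finset ι).offDiag.filter fun p => L p.1 p.2 = F)
      = (t F).offDiag := by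
    intro F hF
    obtain ⟨⟨i, j⟩, hij, rfl⟩ := mem_image.1 hF
    have hij : i ≠ j := by simpa using hij
    ext ⟨k, l⟩
    simp only [mem_filter, mem_offDiag, mem_univ, true_and, ht]
    constructor
    · rintro ⟨hkl, h⟩
      refine ⟨?_, ?_, hkl⟩
      · rw [← h]; exact Submodule.subset_span (by simp)
      · rw [← h]; exact Submodule.subset_span (by simp)
    · rintro ⟨hk, hl, hkl⟩
      exact ⟨hkl, hLeq i j k l hij hkl hk hl⟩
  have hline : ∀ F ∈ Ls, ((t F).offDiag.card : ℝ) / 4 ≤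
      ∑ p ∈ (t F).offDiag, ‖inner ℂ (w p.1) (w p.2)‖ ^ 2 := by
    intro F hF
    obtain ⟨⟨i, j⟩, hij, rfl⟩ := mem_image.1 hF
    have hij : i ≠ j := by simpa using hij
    have h3 : 3 ≤ #(t (L i j)) := by
      obtain ⟨k, hki, hkj, hk⟩ := hSG i j hij
      rw [← card_eq_three.2 ⟨i, j, k, hij, hki.symm, hkj.symm, rfl⟩]
      refine card_le_card fun x hx => ?_
      simp only [mem_insert, mem_singleton] at hx
      rw [ht]
      rcases hx with rfl | rfl | rfl
      · exact Submodule.subset_span (by simp)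
      · exact Submodule.subset_span (by simp)
      · exact hk
    have h1 := sq_card_div_two_le_sum_norm_inner_sq ((L i j).map M)
      (by rw [← (Submodule.equivMapOfInjective M hinj (L i j)).finrank_eq, hrank i j hij]) (t (L i j)) w
      (fun k hk => Submodule.smul_mem _ _ (Submodule.mem_map_of_mem ((ht _ _).1 hk)))
      fun k _ => hw1 k
    rw [← sum_product', ← diag_union_offDiag, sum_union (disjoint_diag_offDiag _), sum_diag] at h1
    have h2 : ∑ k ∈ t (L i j), ‖inner ℂ (w k) (w k)‖ ^ 2 = #(t (L i j)) := by
      rw [sum_congr rfl fun k _ => (by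
        rw [inner_self_eq_norm_sq_to_K, hw1]; simp : ‖inner ℂ (w k) (w k)‖ ^ 2 = (1 : ℝ))]
      simp
    rw [h2] at h1
    have hoff : ((t (L i j)).offDiag.card : ℝ) = (#(t (L i j)) : ℝ) ^ 2 - #(t (L i j)) := by
      rw [offDiag_card, Nat.cast_sub (Nat.le_mul_self _)]
      push_cast; ring
    rw [hoff]
    have h3' : (3 : ℝ) ≤ #(t (L i j)) := by exact_mod_cast h3
    nlinarith
  have hoffsum : N * (N - 1) / 4 ≤
      ∑ p ∈ (univ : Finset ι).offDiag, ‖inner ℂ (w p.1) (w p.2)‖ ^ 2 := by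
    rw [← sum_fiberwise_of_maps_to hmaps]
    have h1 : (#(univ : Finset ι).offDiag : ℝ) = ∑ F ∈ Ls, (#(t F).offDiag : ℝ) := by
      rw [card_eq_sum_card_fiberwise hmaps]
      push_cast
      exact sum_congr rfl fun F hF => by rw [hfiber F hF]
    have h2 : (#(univ : Finset ι).offDiag : ℝ) = N * (N - 1) := by
      rw [offDiag_card, Nat.cast_sub (Nat.le_mul_self _), card_univ]
      push_cast; ring
    rw [← h2, h1, sum_div]
    exact sum_le_sum fun F hF => by rw [hfiber F hF]; exact hline F hF
  have htotal : ∑ j, ∑ i, ‖inner ℂ (w j) (w i)‖ ^ 2 ≤ N * ((N + 1) / 4) := by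
    refine (sum_le_sum fun j _ => hT j).trans ?_
    rw [sum_const, card_univ, nsmul_eq_mul]
  have hsplit : ∑ j, ∑ i, ‖inner ℂ (w j) (w i)‖ ^ 2 =
      N + ∑ p ∈ (univ : Finset ι).offDiag, ‖inner ℂ (w p.1) (w p.2)‖ ^ 2 := by
    rw [← sum_product', ← diag_union_offDiag, sum_union (disjoint_diag_offDiag _), sum_diag]
    congr 1
    rw [sum_congr rfl fun k _ => (by
        rw [inner_self_eq_norm_sq_to_K, hw1]; simp : ‖inner ℂ (w k) (w k)‖ ^ 2 = (1 : ℝ))]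
    simp [hN]
  have hN4 : (4 : ℝ) ≤ N := by rw [hN]; exact_mod_cast hcard
  nlinarith

theorem finrank_span_range_le_three {E ι : Type*} [AddCommGroup E] [Module ℂ E] [Finite ι]
    (v : ι → E) (hSG : ∀ i j, LinearIndependent ℂ ![v i, v j] → ∃ k,
      v k ∈ Submodule.span ℂ {v i, v j} ∧ v k ∉ Submodule.span ℂ {v i} ∧
      v k ∉ Submodule.span ℂ {v j}) :
    Module.finrank ℂ (Submodule.span ℂ (Set.range v)) ≤ 3 := by
  classical
  by_contra! hlt
  obtain ⟨b, hb, hbspan, hbLI⟩ := exists_linearIndependent ℂ (Set.range v)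
  have hbfin : b.Finite := (Set.finite_range v).subset hb
  have := hbfin.fintype
  have hbcard : 4 ≤ b.toFinset.card := by
    rw [← finrank_span_set_eq_card hbLI, hbspan]
    omega
  obtain ⟨c, hcb, hc⟩ := Finset.exists_subset_card_eq hbcard
  have hcb' : (c : Set E) ⊆ b := fun x hx => by simpa using hcb hx
  have hcLI : LinearIndepOn ℂ id (c : Set E) := LinearIndepOn.mono (linearIndependent_subtype_iff.1 hbLI) hcb'
  let U := Submodule.span ℂ (c : Set E)
  have hU : Module.finrank ℂ U = 4 := by
    have := finrank_span_set_eq_card hcLI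
    rw [Finset.toFinset_coe, hc] at this
    exact this
  have : FiniteDimensional ℂ U := Module.finite_of_finrank_pos (by omega)
  let φ : U ≃ₗ[ℂ] EuclideanSpace ℂ (Fin 4) := LinearEquiv.ofFinrankEq _ _ (by simp [hU])
  let κ := {L : Submodule ℂ E // ∃ i, v i ≠ 0 ∧ v i ∈ U ∧ Submodule.span ℂ {v i} = L}
  have : Finite κ := by
    refine Set.Finite.to_subtype ((Set.finite_range fun i => Submodule.span ℂ {v i}).subset ?_)
    rintro L ⟨i, -, -, rfl⟩
    exact ⟨i, rfl⟩
  have := Fintype.ofFinite κ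
  let r : κ → ι := fun x => x.2.choose
  have hr0 : ∀ x, v (r x) ≠ 0 := fun x => x.2.choose_spec.1
  have hrU : ∀ x, v (r x) ∈ U := fun x => x.2.choose_spec.2.1
  have hrL : ∀ x : κ, Submodule.span ℂ {v (r x)} = x.1 := fun x => x.2.choose_spec.2.2
  have hpair : ∀ x y : κ, x ≠ y → v (r x) ∉ Submodule.span ℂ {v (r y)} := by
    intro x y hxy h
    obtain ⟨a, ha⟩ := Submodule.mem_span_singleton.1 h
    have ha0 : a ≠ 0 := by rintro rfl; exact hr0 x (by simpa using ha.symm)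
    apply hxy
    ext1
    rw [← hrL x, ← hrL y, ← ha, Submodule.span_singleton_smul_eq (isUnit_iff_ne_zero.2 ha0)]
  let w : κ → EuclideanSpace ℂ (Fin 4) := fun x => φ ⟨v (r x), hrU x⟩
  have hmem : ∀ (x : κ) (s : Set κ), w x ∈ Submodule.span ℂ (w '' s) ↔
      v (r x) ∈ Submodule.span ℂ ((fun y => v (r y)) '' s) := by
    intro x s
    have h1 : w '' s = (φ : U →ₗ[ℂ] EuclideanSpace ℂ (Fin 4)) ''
        ((fun y => (⟨v (r y), hrU y⟩ : U)) '' s) := by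
      rw [Set.image_image]; rfl
    have h2 : (fun y => v (r y)) '' s = U.subtype '' ((fun y => (⟨v (r y), hrU y⟩ : U)) '' s) := by
      rw [Set.image_image]; rfl
    rw [h1, h2, Submodule.span_image, Submodule.span_image]
    constructor
    · intro h
      obtain ⟨u, hu, hux⟩ := Submodule.mem_map.1 h
      have : u = ⟨v (r x), hrU x⟩ := φ.injective hux
      exact ⟨u, hu, by rw [this]; rfl⟩
    · intro h
      obtain ⟨u, hu, hux⟩ := Submodule.mem_map.1 h
      have : u = ⟨v (r x), hrU x⟩ := Subtype.ext hux
      exact ⟨u, hu, by rw [this]; rfl⟩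
  refine sylvesterGallai_euclideanSpace_four (v := w) ?_ ?_ ?_
  · intro x y hxy h
    have := (hmem x {y}).1 (by simpa using h)
    exact hpair x y hxy (by simpa using this)
  · intro x y hxy
    have hLI : LinearIndependent ℂ ![v (r x), v (r y)] := by
      refine (LinearIndependent.pair_iff' (hr0 x)).2 fun a ha => ?_
      exact hpair y x hxy.symm (Submodule.mem_span_singleton.2 ⟨a, ha⟩)
    obtain ⟨k, hk, hkx, hky⟩ := hSG _ _ hLI
    have hk0 : v k ≠ 0 := fun h => hkx (by rw [h]; exact Submodule.zero_mem _)
    have hkU : v k ∈ U := by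
      refine Submodule.span_le.2 ?_ hk
      rintro _ (rfl | rfl)
      · exact hrU x
      · exact hrU y
    let z : κ := ⟨_, k, hk0, hkU, rfl⟩
    have hzk : v k ∈ Submodule.span ℂ {v (r z)} := by
      rw [hrL z]; exact Submodule.mem_span_singleton_self _
    refine ⟨z, ?_, ?_, ?_⟩
    · rintro h; rw [h] at hzk; exact hkx hzk
    · rintro h; rw [h] at hzk; exact hky hzk
    · have : w z ∈ Submodule.span ℂ (w '' {x, y}) := by
        rw [hmem, Set.image_pair]
        have h1 : v (r z) ∈ Submodule.span ℂ {v k} := by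
          change v (r z) ∈ z.1
          rw [← hrL z]; exact Submodule.mem_span_singleton_self _
        exact (Submodule.span_le.2 (by simpa using hk)) h1
      rwa [Set.image_pair] at this
  · rw [eq_top_iff]
    have h1 : U ≤ Submodule.span ℂ ((fun y => v (r y)) '' Set.univ) := by
      refine Submodule.span_le.2 fun x hx => ?_
      obtain ⟨i, rfl⟩ := hb (hcb' hx)
      have hi0 : v i ≠ 0 := hcLI.ne_zero hx
      let z : κ := ⟨_, i, hi0, Submodule.subset_span hx, rfl⟩
      have : v i ∈ Submodule.span ℂ {v (r z)} := by
        rw [hrL z]; exact Submodule.mem_span_singleton_self _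
      refine Submodule.span_mono ?_ this
      rintro _ rfl
      exact ⟨z, trivial, rfl⟩
    intro e _
    have h2 : (φ.symm e : E) ∈ Submodule.span ℂ (U.subtype ''
        Set.range (fun y => (⟨v (r y), hrU y⟩ : U))) := by
      have := h1 (φ.symm e).2
      rwa [Set.image_univ, show (Set.range fun y => v (r y)) = U.subtype ''
        Set.range (fun y => (⟨v (r y), hrU y⟩ : U)) by rw [← Set.range_comp]; rfl] at this
    rw [Submodule.span_image] at h2
    obtain ⟨u, hu, hux⟩ := Submodule.mem_map.1 h2
    have hu' : u = φ.symm e := Subtype.ext hux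
    have h3 := Submodule.mem_map_of_mem (f := (φ : U →ₗ[ℂ] EuclideanSpace ℂ (Fin 4))) hu
    rw [← Submodule.span_image, ← Set.range_comp, hu'] at h3
    rw [LinearEquiv.coe_coe, LinearEquiv.apply_symm_apply] at h3
    exact h3

/-- The space of linear forms in `n` variables. -/
noncomputable abbrev linForms (n : ℕ) : Submodule ℂ (MvPolynomial (Fin n) ℂ) :=
  homogeneousSubmodule (Fin n) ℂ 1

/-- `LowRank k Q` says that `Q` is a sum of `k` products of two linear forms. -/
def LowRank {n : ℕ} (k : ℕ) (Q : MvPolynomial (Fin n) ℂ) : Prop :=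
  ∃ a b : Fin k → MvPolynomial (Fin n) ℂ,
    (∀ i, a i ∈ linForms n) ∧ (∀ i, b i ∈ linForms n) ∧ Q = ∑ i, a i * b i

theorem rankS_le_of_lowRank {n k : ℕ} {Q : MvPolynomial (Fin n) ℂ} (h : LowRank k Q) :
    rankS Q ≤ k := by
  obtain ⟨a, b, ha, hb, hQ⟩ := h
  exact Nat.sInf_le ⟨a, b, ha, hb, hQ⟩

namespace LowRank

variable {n k l : ℕ} {Q Q' : MvPolynomial (Fin n) ℂ}

theorem zero (n k : ℕ) : LowRank k (0 : MvPolynomial (Fin n) ℂ) :=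
  ⟨0, 0, fun _ => zero_mem _, fun _ => zero_mem _, by simp⟩

theorem add (h : LowRank k Q) (h' : LowRank l Q') : LowRank (k + l) (Q + Q') := by
  obtain ⟨a, b, ha, hb, rfl⟩ := h
  obtain ⟨a', b', ha', hb', rfl⟩ := h'
  refine ⟨Fin.append a a', Fin.append b b', ?_, ?_, ?_⟩
  · intro i
    refine Fin.addCases (fun i => ?_) (fun i => ?_) i
    · rw [Fin.append_left]; exact ha i
    · rw [Fin.append_right]; exact ha' i
  · intro i
    refine Fin.addCases (fun i => ?_) (fun i => ?_) i
    · rw [Fin.append_left]; exact hb i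
    · rw [Fin.append_right]; exact hb' i
  · simp [Fin.sum_univ_add]

theorem smul (c : ℂ) (h : LowRank k Q) : LowRank k (c • Q) := by
  obtain ⟨a, b, ha, hb, rfl⟩ := h
  exact ⟨fun i => c • a i, b, fun i => Submodule.smul_mem _ _ (ha i), hb, by simp [Finset.smul_sum]⟩

theorem of_smul {c : ℂ} (hc : c ≠ 0) (h : LowRank k (c • Q)) : LowRank k Q := by
  simpa [smul_smul, hc] using h.smul c⁻¹

theorem mono (hkl : k ≤ l) (h : LowRank k Q) : LowRank l Q := by
  obtain ⟨m, rfl⟩ := Nat.exists_eq_add_of_le hkl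
  simpa using h.add (zero n m)

theorem neg (h : LowRank k Q) : LowRank k (-Q) := by
  simpa using h.smul (-1)

theorem sub (h : LowRank k Q) (h' : LowRank l Q') : LowRank (k + l) (Q - Q') := by
  simpa [sub_eq_add_neg] using h.add h'.neg

theorem mul {c d : MvPolynomial (Fin n) ℂ} (hc : c ∈ linForms n) (hd : d ∈ linForms n) :
    LowRank 1 (c * d) :=
  ⟨fun _ => c, fun _ => d, fun _ => hc, fun _ => hd, by simp⟩

theorem exists_eq_mul (h : LowRank 1 Q) : ∃ c ∈ linForms n, ∃ d ∈ linForms n, Q = c * d := by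
  obtain ⟨a, b, ha, hb, rfl⟩ := h
  exact ⟨a 0, ha 0, b 0, hb 0, by simp⟩

theorem not_of_rankS (h : k < rankS Q) : ¬ LowRank k Q :=
  fun h' => (rankS_le_of_lowRank h').not_gt h

end LowRank

section Basic

variable {n : ℕ}

theorem mem_linForms_mul_linForms {F : MvPolynomial (Fin n) ℂ} (hF : F.IsHomogeneous 2) :
    F ∈ linForms n * linForms n := by
  rw [← pow_two, homogeneousSubmodule_one_pow]
  exact hF

theorem isHomogeneous_two_of_mem {F : MvPolynomial (Fin n) ℂ} (hF : F ∈ linForms n * linForms n) :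
    F.IsHomogeneous 2 := by
  rw [← pow_two, homogeneousSubmodule_one_pow] at hF
  exact hF

theorem linForms_induction {p : MvPolynomial (Fin n) ℂ → Prop} (hX : ∀ i, p (X i))
    (h0 : p 0) (hadd : ∀ x y, p x → p y → p (x + y)) (hsmul : ∀ (c : ℂ) x, p x → p (c • x))
    {h : MvPolynomial (Fin n) ℂ} (hh : h ∈ linForms n) : p h := by
  rw [linForms, homogeneousSubmodule_one_eq_span_X] at hh
  induction hh using Submodule.span_induction with
  | mem x hx => obtain ⟨i, rfl⟩ := hx; exact hX i
  | zero => exact h0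
  | add x y _ _ hx hy => exact hadd x y hx hy
  | smul c x _ hx => exact hsmul c x hx

instance finiteDimensional_linForms (n : ℕ) : FiniteDimensional ℂ (linForms n) := by
  rw [linForms, homogeneousSubmodule_one_eq_span_X]
  exact FiniteDimensional.span_of_finite ℂ (Set.finite_range _)

theorem finiteDimensional_of_le_linForms {W : Submodule ℂ (MvPolynomial (Fin n) ℂ)}
    (hW : W ≤ linForms n) : FiniteDimensional ℂ W :=
  Submodule.finiteDimensional_of_le hW

theorem lowRank_of_mem_mul {W : Submodule ℂ (MvPolynomial (Fin n) ℂ)} (hW : W ≤ linForms n)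
    {k : ℕ} (hk : Module.finrank ℂ W ≤ k) {f : MvPolynomial (Fin n) ℂ}
    (hf : f ∈ W * linForms n) : LowRank k f := by
  have := finiteDimensional_of_le_linForms hW
  refine LowRank.mono hk ?_
  let b := Module.finBasis ℂ W
  suffices h : ∃ d : Fin (Module.finrank ℂ W) → MvPolynomial (Fin n) ℂ, (∀ i, d i ∈ linForms n) ∧
      f = ∑ i, (b i : MvPolynomial (Fin n) ℂ) * d i by
    obtain ⟨d, hd, h⟩ := h
    exact ⟨_, d, fun i => hW (b i).2, hd, h⟩
  induction hf using Submodule.mul_induction_on' with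
  | mem_mul_mem w hw h hh =>
    refine ⟨fun i => b.repr ⟨w, hw⟩ i • h, fun i => Submodule.smul_mem _ _ hh, ?_⟩
    have := congrArg (Subtype.val) (b.sum_repr ⟨w, hw⟩)
    rw [Submodule.coe_sum] at this
    refine (congrArg (· * h) this).symm.trans ?_
    simp [Finset.sum_mul]
  | add x _ y _ hx hy =>
    obtain ⟨d, hd, rfl⟩ := hx
    obtain ⟨d', hd', rfl⟩ := hy
    exact ⟨d + d', fun i => add_mem (hd i) (hd' i), by simp [mul_add, Finset.sum_add_distrib]⟩

theorem exists_eval_eq_one {V : Submodule ℂ (MvPolynomial (Fin n) ℂ)} (hV : V ≤ linForms n)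
    {c : MvPolynomial (Fin n) ℂ} (hc : c ∈ linForms n) (hcV : c ∉ V) :
    ∃ p : Fin n → ℂ, (∀ v ∈ V, eval p v = 0) ∧ eval p c = 1 := by
  obtain ⟨f, hf, hVf⟩ := Submodule.exists_le_ker_of_notMem hcV
  have key : ∀ h ∈ linForms n, eval (fun i => (f c)⁻¹ * f (X i)) h = (f c)⁻¹ * f h := by
    intro h hh
    refine linForms_induction (p := fun h => eval _ h = (f c)⁻¹ * f h) ?_ ?_ ?_ ?_ hh
    · simp
    · simp
    · intro x y hx hy; simp [hx, hy, mul_add]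
    · intro a x hx; simp [hx, smul_eval]; ring
  refine ⟨fun i => (f c)⁻¹ * f (X i), fun v hv => ?_, ?_⟩
  · rw [key v (hV hv), LinearMap.mem_ker.1 (hVf hv), mul_zero]
  · rw [key c hc, inv_mul_cancel₀ hf]

/-- The derivation in direction `p`. -/
noncomputable def dirDeriv (p : Fin n → ℂ) :
    Derivation ℂ (MvPolynomial (Fin n) ℂ) (MvPolynomial (Fin n) ℂ) :=
  mkDerivation ℂ fun i => C (p i)

theorem dirDeriv_linForm (p : Fin n → ℂ) {h : MvPolynomial (Fin n) ℂ} (hh : h ∈ linForms n) :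
    dirDeriv p h = C (eval p h) := by
  refine linForms_induction (p := fun h => dirDeriv p h = C (eval p h)) ?_ ?_ ?_ ?_ hh
  · simp [dirDeriv, mkDerivation_X]
  · simp
  · intro x y hx hy; simp [hx, hy]
  · intro a x hx; simp [hx, smul_eq_C_mul]

theorem dirDeriv_mul (p : Fin n → ℂ) {c d : MvPolynomial (Fin n) ℂ} (hc : c ∈ linForms n)
    (hd : d ∈ linForms n) : dirDeriv p (c * d) = eval p d • c + eval p c • d := by
  rw [Derivation.leibniz, dirDeriv_linForm p hc, dirDeriv_linForm p hd, smul_eq_mul, smul_eq_mul,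
    smul_eq_C_mul, smul_eq_C_mul]
  ring

theorem dirDeriv_mem {A : Submodule ℂ (MvPolynomial (Fin n) ℂ)} (hA : A ≤ linForms n)
    (p : Fin n → ℂ) {f : MvPolynomial (Fin n) ℂ} (hf : f ∈ A * A) : dirDeriv p f ∈ A := by
  induction hf using Submodule.mul_induction_on' with
  | mem_mul_mem w hw h hh =>
    rw [dirDeriv_mul p (hA hw) (hA hh)]
    exact add_mem (A.smul_mem _ hw) (A.smul_mem _ hh)
  | add x _ y _ hx hy => rw [map_add]; exact add_mem hx hy

theorem dirDeriv_eq_zero {A : Submodule ℂ (MvPolynomial (Fin n) ℂ)} (hA : A ≤ linForms n)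
    {p : Fin n → ℂ} (hp : ∀ a ∈ A, eval p a = 0) {f : MvPolynomial (Fin n) ℂ} (hf : f ∈ A * A) :
    dirDeriv p f = 0 := by
  induction hf using Submodule.mul_induction_on' with
  | mem_mul_mem w hw h hh =>
    rw [dirDeriv_mul p (hA hw) (hA hh), hp w hw, hp h hh]; simp
  | add x _ y _ hx hy => rw [map_add, hx, hy, add_zero]

theorem aeval_mul_add_mul {S : Type*} [CommRing S] [Algebra ℂ S] (g : Fin n → S) (p : Fin n → ℂ)
    (s t : S) {F : MvPolynomial (Fin n) ℂ} (hF : F ∈ linForms n * linForms n) :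
    aeval (fun i => s * g i + t * algebraMap ℂ S (p i)) F = s ^ 2 * aeval g F +
      s * t * aeval g (dirDeriv p F) + t ^ 2 * algebraMap ℂ S (eval p F) := by
  have hlin : ∀ h ∈ linForms n, aeval (fun i => s * g i + t * algebraMap ℂ S (p i)) h
      = s * aeval g h + t * algebraMap ℂ S (eval p h) := by
    intro h hh
    refine linForms_induction (p := fun h => aeval (fun i => s * g i + t * algebraMap ℂ S (p i)) h
      = s * aeval g h + t * algebraMap ℂ S (eval p h)) ?_ ?_ ?_ ?_ hh
    · intro i; simp
    · simp
    · intro x y hx hy; simp only [map_add, hx, hy]; ring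
    · intro a x hx; rw [map_smul, hx, smul_eval, map_mul, Algebra.smul_def, map_smul, Algebra.smul_def]; ring
  induction hF using Submodule.mul_induction_on' with
  | mem_mul_mem c hc d hd =>
    rw [dirDeriv_mul p hc hd, map_mul, hlin c hc, hlin d hd]
    rw [map_add, map_smul, map_smul, Algebra.smul_def, Algebra.smul_def, map_mul, map_mul, map_mul]
    ring
  | add x _ y _ hx hy => simp only [map_add, hx, hy]; ring

theorem eval_smul_add_smul (x p : Fin n → ℂ) (s t : ℂ) {F : MvPolynomial (Fin n) ℂ}
    (hF : F ∈ linForms n * linForms n) :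
    eval (s • x + t • p) F = s ^ 2 * eval x F + s * t * eval x (dirDeriv p F) + t ^ 2 * eval p F :=
  aeval_mul_add_mul x p s t hF

theorem eval_smul_add_smul_linForm (x p : Fin n → ℂ) (s t : ℂ) {h : MvPolynomial (Fin n) ℂ}
    (hh : h ∈ linForms n) : eval (s • x + t • p) h = s * eval x h + t * eval p h := by
  refine linForms_induction (p := fun h => eval (s • x + t • p) h = s * eval x h + t * eval p h)
    ?_ ?_ ?_ ?_ hh
  · simp
  · simp
  · intro x y hx hy; simp only [map_add, hx, hy]; ring
  · intro a x hx; simp only [hx, smul_eval]; ring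

theorem dirDeriv_smul_add_smul (x p : Fin n → ℂ) (s t : ℂ) {F : MvPolynomial (Fin n) ℂ}
    (hF : F ∈ linForms n * linForms n) :
    dirDeriv (s • x + t • p) F = s • dirDeriv x F + t • dirDeriv p F := by
  induction hF using Submodule.mul_induction_on' with
  | mem_mul_mem c hc d hd =>
    simp only [dirDeriv_mul _ hc hd, eval_smul_add_smul_linForm x p s t hc,
      eval_smul_add_smul_linForm x p s t hd]
    module
  | add x _ y _ hx hy => simp only [map_add, hx, hy]; module

theorem eval_dirDeriv_comm (x p : Fin n → ℂ) {F : MvPolynomial (Fin n) ℂ}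
    (hF : F ∈ linForms n * linForms n) : eval x (dirDeriv p F) = eval p (dirDeriv x F) := by
  induction hF using Submodule.mul_induction_on' with
  | mem_mul_mem c hc d hd =>
    simp only [dirDeriv_mul _ hc hd, map_add, smul_eval]
    ring
  | add x _ y _ hx hy => simp only [map_add, hx, hy]

theorem eval_dirDeriv_self (x : Fin n → ℂ) {F : MvPolynomial (Fin n) ℂ}
    (hF : F ∈ linForms n * linForms n) : eval x (dirDeriv x F) = 2 * eval x F := by
  induction hF using Submodule.mul_induction_on' with
  | mem_mul_mem c hc d hd =>
    simp only [dirDeriv_mul _ hc hd, map_add, smul_eval, map_mul]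
    ring
  | add x _ y _ hx hy => simp only [map_add, hx, hy]; ring

theorem dirDeriv_mem_linForms (p : Fin n → ℂ) {F : MvPolynomial (Fin n) ℂ}
    (hF : F ∈ linForms n * linForms n) : dirDeriv p F ∈ linForms n :=
  dirDeriv_mem le_rfl p hF

end Basic

section Homogeneous

variable {n : ℕ}

theorem aeval_C_mul_X_of_isHomogeneous {f : MvPolynomial (Fin n) ℂ} {d : ℕ}
    (hf : f.IsHomogeneous d) :
    aeval (fun i => Polynomial.C (X i : MvPolynomial (Fin n) ℂ) * Polynomial.X) f
      = Polynomial.C f * Polynomial.X ^ d := by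
  rw [aeval_def, eval₂_eq]
  have h1 : ∀ m ∈ f.support, algebraMap ℂ (Polynomial (MvPolynomial (Fin n) ℂ)) (coeff m f) *
      ∏ i ∈ m.support, (Polynomial.C (X i : MvPolynomial (Fin n) ℂ) * Polynomial.X) ^ m i
      = Polynomial.C (monomial m (coeff m f)) * Polynomial.X ^ d := by
    intro m hm
    have hdeg : ∑ i ∈ m.support, m i = d := by
      have := hf.degree_eq_sum_deg_support hm
      simpa [Finsupp.degree] using this.symm
    simp only [mul_pow, Finset.prod_mul_distrib, Finset.prod_pow_eq_pow_sum, hdeg]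
    rw [monomial_eq, map_mul, ← mul_assoc, Finsupp.prod, map_prod]
    simp only [map_pow]
    rfl
  rw [Finset.sum_congr rfl h1, ← Finset.sum_mul, ← map_sum, ← as_sum]

theorem isHomogeneous_of_mul {D E : MvPolynomial (Fin n) ℂ} {d : ℕ}
    (h : (D * E).IsHomogeneous d) (hne : D * E ≠ 0) :
    ∃ k l, k + l = d ∧ D.IsHomogeneous k ∧ E.IsHomogeneous l := by
  set φ : MvPolynomial (Fin n) ℂ →ₐ[ℂ] Polynomial (MvPolynomial (Fin n) ℂ) :=
    aeval (fun i => Polynomial.C (X i : MvPolynomial (Fin n) ℂ) * Polynomial.X) with hφ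
  have hcoeff : ∀ (f : MvPolynomial (Fin n) ℂ) k,
      (φ f).coeff k = homogeneousComponent k f := by
    intro f k
    conv_lhs => rw [← sum_homogeneousComponent f]
    rw [map_sum, Polynomial.finsetSum_coeff, Finset.sum_congr rfl fun i _ => by
      rw [hφ, aeval_C_mul_X_of_isHomogeneous (homogeneousComponent_isHomogeneous i f),
        Polynomial.coeff_C_mul_X_pow]]
    rw [Finset.sum_ite_eq]
    split_ifs with hk
    · rfl
    · rw [homogeneousComponent_eq_zero]
      simpa using hk
  have hone : ∀ f, (φ f).eval 1 = f := by
    intro f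
    have : ((Polynomial.evalRingHom (1 : MvPolynomial (Fin n) ℂ)).comp φ.toRingHom)
        = RingHom.id _ := by
      refine MvPolynomial.ringHom_ext (fun r => ?_) (fun i => ?_)
      · simp [hφ, Polynomial.algebraMap_apply, algebraMap_eq]
      · simp [hφ]
    exact RingHom.congr_fun this f
  have hprod : φ D * φ E = Polynomial.C (D * E) * Polynomial.X ^ d := by
    rw [← map_mul, hφ, aeval_C_mul_X_of_isHomogeneous h]
  have hD : φ D ≠ 0 := fun h0 => hne (by rw [← hone D, h0]; simp)
  have hE : φ E ≠ 0 := fun h0 => hne (by rw [← hone E, h0]; simp)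
  have hdeg : (φ D).natDegree + (φ E).natDegree = d := by
    rw [← Polynomial.natDegree_mul hD hE, hprod, Polynomial.natDegree_C_mul_X_pow _ _ hne]
  have htdeg : (φ D).natTrailingDegree + (φ E).natTrailingDegree = d := by
    rw [← Polynomial.natTrailingDegree_mul hD hE, hprod,
      Polynomial.natTrailingDegree_mul (Polynomial.C_ne_zero.2 hne) (by simp),
      Polynomial.natTrailingDegree_C, Polynomial.natTrailingDegree_X_pow, zero_add]
  have leD := Polynomial.natTrailingDegree_le_natDegree (φ D)
  have leE := Polynomial.natTrailingDegree_le_natDegree (φ E)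
  have key : ∀ f, (φ f).natDegree = (φ f).natTrailingDegree → f.IsHomogeneous (φ f).natDegree := by
    intro f hf
    have h1 : φ f = Polynomial.C ((φ f).coeff (φ f).natDegree) * Polynomial.X ^ (φ f).natDegree := by
      ext1 k
      rw [Polynomial.coeff_C_mul_X_pow]
      split_ifs with hk
      · rw [hk]
      · rcases lt_or_gt_of_ne hk with hk | hk
        · exact Polynomial.coeff_eq_zero_of_lt_natTrailingDegree (hf ▸ hk)
        · exact Polynomial.coeff_eq_zero_of_natDegree_lt hk
    have h2 : f = (φ f).coeff (φ f).natDegree := by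
      have := hone f
      rw [h1] at this
      simpa using this.symm
    rw [hcoeff] at h2
    have h3 := homogeneousComponent_isHomogeneous (φ f).natDegree f
    rwa [← h2] at h3
  exact ⟨_, _, hdeg, key D (by omega), key E (by omega)⟩

theorem isUnit_of_isHomogeneous_zero {D : MvPolynomial (Fin n) ℂ} (h : D.IsHomogeneous 0)
    (hD : D ≠ 0) : IsUnit D := by
  rw [← totalDegree_zero_iff_isHomogeneous, totalDegree_eq_zero_iff_eq_C] at h
  rw [h] at hD ⊢
  exact (isUnit_iff_ne_zero.2 fun h0 => hD (by rw [h0, C_0])).map C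

theorem not_isUnit_of_isHomogeneous {D : MvPolynomial (Fin n) ℂ} {k : ℕ} (hk : k ≠ 0)
    (h : D.IsHomogeneous k) : ¬ IsUnit D := by
  rintro ⟨u, rfl⟩
  have h0 : ((u⁻¹ : (MvPolynomial (Fin n) ℂ)ˣ) : MvPolynomial (Fin n) ℂ) ≠ 0 := u⁻¹.ne_zero
  have h1 := totalDegree_mul_of_isDomain u.ne_zero h0
  rw [← Units.val_mul, mul_inv_cancel, Units.val_one, totalDegree_one,
    h.totalDegree u.ne_zero] at h1
  omega

theorem irreducible_of_not_lowRank {Q : MvPolynomial (Fin n) ℂ} (hQ : Q ∈ linForms n * linForms n)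
    (h1 : ¬ LowRank 1 Q) : Irreducible Q := by
  have hQ2 := isHomogeneous_two_of_mem hQ
  have hQ0 : Q ≠ 0 := by rintro rfl; exact h1 (LowRank.zero n 1)
  refine ⟨not_isUnit_of_isHomogeneous two_ne_zero hQ2, fun D E hDE => ?_⟩
  obtain ⟨k, l, hkl, hD, hE⟩ := isHomogeneous_of_mul (hDE ▸ hQ2) (hDE ▸ hQ0)
  have hD0 : D ≠ 0 := by rintro rfl; simp [hDE] at hQ0
  have hE0 : E ≠ 0 := by rintro rfl; simp [hDE] at hQ0
  obtain rfl | rfl | rfl : k = 0 ∨ l = 0 ∨ k = 1 := by omega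
  · exact Or.inl (isUnit_of_isHomogeneous_zero hD hD0)
  · exact Or.inr (isUnit_of_isHomogeneous_zero hE hE0)
  · obtain rfl : l = 1 := by omega
    exact absurd (hDE ▸ LowRank.mul hD hE) h1

theorem prime_of_not_lowRank {Q : MvPolynomial (Fin n) ℂ} (hQ : Q ∈ linForms n * linForms n)
    (h1 : ¬ LowRank 1 Q) : Prime Q :=
  (irreducible_of_not_lowRank hQ h1).prime

theorem not_lowRank_of_irreducible {Q : MvPolynomial (Fin n) ℂ} (h : Irreducible Q) :
    ¬ LowRank 1 Q := by
  intro h1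
  obtain ⟨c, hc, d, hd, rfl⟩ := h1.exists_eq_mul
  rcases h.isUnit_or_isUnit rfl with h | h
  · exact not_isUnit_of_isHomogeneous one_ne_zero hc h
  · exact not_isUnit_of_isHomogeneous one_ne_zero hd h

theorem prime_or_exists_linForm_dvd {Q : MvPolynomial (Fin n) ℂ} (hQ : Q.IsHomogeneous 3)
    (hQ0 : Q ≠ 0) : Prime Q ∨ ∃ l ∈ linForms n, l ≠ 0 ∧ l ∣ Q := by
  by_cases h : ∃ l ∈ linForms n, l ≠ 0 ∧ l ∣ Q
  · exact Or.inr h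
  refine Or.inl (Irreducible.prime ⟨not_isUnit_of_isHomogeneous three_ne_zero hQ,
    fun D E hDE => ?_⟩)
  obtain ⟨k, l, hkl, hD, hE⟩ := isHomogeneous_of_mul (hDE ▸ hQ) (hDE ▸ hQ0)
  have hD0 : D ≠ 0 := by rintro rfl; simp [hDE] at hQ0
  have hE0 : E ≠ 0 := by rintro rfl; simp [hDE] at hQ0
  obtain rfl | rfl | rfl | rfl : k = 0 ∨ l = 0 ∨ k = 1 ∨ l = 1 := by omega
  · exact Or.inl (isUnit_of_isHomogeneous_zero hD hD0)
  · exact Or.inr (isUnit_of_isHomogeneous_zero hE hE0)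
  · exact absurd ⟨D, hD, hD0, hDE ▸ dvd_mul_right _ _⟩ h
  · exact absurd ⟨E, hE, hE0, hDE ▸ dvd_mul_left _ _⟩ h

theorem prime_of_mem_linForms {l : MvPolynomial (Fin n) ℂ} (hl : l ∈ linForms n) (h0 : l ≠ 0) :
    Prime l := by
  refine Irreducible.prime ⟨not_isUnit_of_isHomogeneous one_ne_zero hl, fun D E hDE => ?_⟩
  obtain ⟨k, m, hkm, hD, hE⟩ := isHomogeneous_of_mul (hDE ▸ hl) (hDE ▸ h0)
  have hD0 : D ≠ 0 := by rintro rfl; simp [hDE] at h0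
  have hE0 : E ≠ 0 := by rintro rfl; simp [hDE] at h0
  obtain rfl | rfl : k = 0 ∨ m = 0 := by omega
  · exact Or.inl (isUnit_of_isHomogeneous_zero hD hD0)
  · exact Or.inr (isUnit_of_isHomogeneous_zero hE hE0)

theorem isHomogeneous_right_of_mul {D E : MvPolynomial (Fin n) ℂ} {k d : ℕ}
    (hD : D.IsHomogeneous k) (hD0 : D ≠ 0) (h : (D * E).IsHomogeneous (k + d)) :
    E.IsHomogeneous d := by
  rcases eq_or_ne E 0 with rfl | hE0
  · exact isHomogeneous_zero _ _ _
  obtain ⟨k', l, hkl, hD', hE⟩ := isHomogeneous_of_mul h (mul_ne_zero hD0 hE0)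
  obtain rfl := hD.inj_right hD' hD0
  obtain rfl : l = d := by omega
  exact hE

theorem eq_smul_of_dvd_linForm {l a : MvPolynomial (Fin n) ℂ} (hl : l ∈ linForms n)
    (ha : a ∈ linForms n) (h : l ∣ a) : ∃ c : ℂ, a = c • l := by
  rcases eq_or_ne l 0 with rfl | hl0
  · exact ⟨0, by simpa using h⟩
  obtain ⟨E, rfl⟩ := h
  have hE : E.IsHomogeneous 0 := isHomogeneous_right_of_mul hl hl0 ha
  rw [← totalDegree_zero_iff_isHomogeneous, totalDegree_eq_zero_iff_eq_C] at hE
  exact ⟨coeff 0 E, by rw [hE, smul_eq_C_mul, coeff_zero_C]; ring⟩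

end Homogeneous

section Substitution

variable {n : ℕ}

theorem aeval_linForm (T : MvPolynomial (Fin n) ℂ →ₗ[ℂ] MvPolynomial (Fin n) ℂ)
    {h : MvPolynomial (Fin n) ℂ} (hh : h ∈ linForms n) : aeval (fun i => T (X i)) h = T h := by
  refine linForms_induction (p := fun h => aeval (fun i => T (X i)) h = T h) ?_ ?_ ?_ ?_ hh
  · simp
  · simp
  · intro x y hx hy; simp only [map_add, hx, hy]
  · intro a x hx; simp only [map_smul, hx]

/-- An algebra endomorphism of the polynomial ring which, on linear forms, is a projection
with kernel `U`. -/
structure IsKill (U : Submodule ℂ (MvPolynomial (Fin n) ℂ))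
    (κ : MvPolynomial (Fin n) ℂ →ₐ[ℂ] MvPolynomial (Fin n) ℂ) : Prop where
  mem : ∀ h ∈ linForms n, κ h ∈ linForms n
  eq_zero : ∀ h ∈ U, κ h = 0
  sub_mem : ∀ h ∈ linForms n, h - κ h ∈ U

theorem exists_isKill {U : Submodule ℂ (MvPolynomial (Fin n) ℂ)} (hU : U ≤ linForms n) :
    ∃ κ, IsKill U κ := by
  obtain ⟨q, hq⟩ := U.exists_isCompl
  let T := LinearMap.id - U.projection q hq
  have hT : ∀ h ∈ linForms n, aeval (fun i => T (X i)) h = T h := fun h => aeval_linForm T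
  refine ⟨aeval (fun i => T (X i)), fun h hh => ?_, fun h hh => ?_, fun h hh => ?_⟩
  · rw [hT h hh]
    exact sub_mem hh (hU (Submodule.projection_apply_mem hq h))
  · rw [hT h (hU hh)]
    simp [T, Submodule.projection_apply_of_mem_left hq hh]
  · rw [hT h hh]
    simp [T]

namespace IsKill

variable {U : Submodule ℂ (MvPolynomial (Fin n) ℂ)}
  {κ : MvPolynomial (Fin n) ℂ →ₐ[ℂ] MvPolynomial (Fin n) ℂ}

theorem mem_of_eq_zero (hκ : IsKill U κ) {h : MvPolynomial (Fin n) ℂ} (hh : h ∈ linForms n)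
    (h0 : κ h = 0) : h ∈ U := by
  simpa [h0] using hκ.sub_mem h hh

theorem mem_mul (hκ : IsKill U κ) {f : MvPolynomial (Fin n) ℂ}
    (hf : f ∈ linForms n * linForms n) : κ f ∈ linForms n * linForms n := by
  induction hf using Submodule.mul_induction_on' with
  | mem_mul_mem c hc d hd =>
    rw [map_mul]; exact Submodule.mul_mem_mul (hκ.mem c hc) (hκ.mem d hd)
  | add x _ y _ hx hy => rw [map_add]; exact add_mem hx hy

theorem sub_mem_mul (hκ : IsKill U κ) {f : MvPolynomial (Fin n) ℂ}
    (hf : f ∈ linForms n * linForms n) : f - κ f ∈ U * linForms n := by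
  induction hf using Submodule.mul_induction_on' with
  | mem_mul_mem c hc d hd =>
    have : c * d - κ (c * d) = (c - κ c) * d + (d - κ d) * κ c := by rw [map_mul]; ring
    rw [this]
    exact add_mem (Submodule.mul_mem_mul (hκ.sub_mem c hc) hd)
      (Submodule.mul_mem_mul (hκ.sub_mem d hd) (hκ.mem c hc))
  | add x _ y _ hx hy =>
    rw [map_add, add_sub_add_comm]; exact add_mem hx hy

theorem eq_zero_of_mem_mul (hκ : IsKill U κ) {f : MvPolynomial (Fin n) ℂ}
    (hf : f ∈ U * linForms n) : κ f = 0 := by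
  induction hf using Submodule.mul_induction_on' with
  | mem_mul_mem c hc d hd => rw [map_mul, hκ.eq_zero c hc, zero_mul]
  | add x _ y _ hx hy => rw [map_add, hx, hy, add_zero]

theorem lowRank (hκ : IsKill U κ) (hU : U ≤ linForms n) {f : MvPolynomial (Fin n) ℂ}
    (hf : f ∈ linForms n * linForms n) {k l : ℕ} (hk : Module.finrank ℂ U ≤ k)
    (h : LowRank l (κ f)) : LowRank (k + l) f := by
  have := (lowRank_of_mem_mul hU hk (hκ.sub_mem_mul hf)).add h
  simpa using this

end IsKill

theorem finrank_span_singleton_le (d : MvPolynomial (Fin n) ℂ) :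
    Module.finrank ℂ (Submodule.span ℂ {d}) ≤ 1 := by
  simpa using finrank_span_le_card (R := ℂ) ({d} : Set (MvPolynomial (Fin n) ℂ))

theorem finrank_span_pair_le (c d : MvPolynomial (Fin n) ℂ) :
    Module.finrank ℂ (Submodule.span ℂ {c, d}) ≤ 2 := by
  classical
  refine (finrank_span_le_card (R := ℂ) ({c, d} : Set (MvPolynomial (Fin n) ℂ))).trans ?_
  simpa using Finset.card_le_two

theorem mul_self_inf_mul_self {A B : Submodule ℂ (MvPolynomial (Fin n) ℂ)} (hA : A ≤ linForms n)
    (hB : B ≤ linForms n) {f : MvPolynomial (Fin n) ℂ} (hfA : f ∈ A * A) (hfB : f ∈ B * B) :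
    f ∈ (A ⊓ B) * (A ⊓ B) := by
  obtain ⟨A', hA', hd⟩ : ∃ A' : Submodule ℂ (MvPolynomial (Fin n) ℂ), A ≤ (A ⊓ B) ⊔ A' ∧
      Disjoint B A' := by
    obtain ⟨q, hq⟩ := (A ⊓ B).exists_isCompl
    refine ⟨A ⊓ q, fun a ha => ?_, Submodule.disjoint_def.2 fun x hxB hxA => ?_⟩
    · obtain ⟨x, hx, y, hy, rfl⟩ := Submodule.mem_sup.1
        (hq.sup_eq_top ▸ Submodule.mem_top : a ∈ (A ⊓ B) ⊔ q)
      exact Submodule.add_mem_sup hx ⟨(Submodule.add_mem_iff_right _ hx.1).1 ha, hy⟩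
    · exact Submodule.disjoint_def.1 hq.disjoint x ⟨hxA.1, hxB⟩ hxA.2
  obtain ⟨C, hC, hCB⟩ := hd.symm.exists_isCompl
  have hBC := hCB.symm
  let T := B.projection C hBC
  have hT : ∀ h ∈ linForms n, aeval (fun i => T (X i)) h = T h := fun h => aeval_linForm T
  have hfix : ∀ g ∈ B * B, aeval (fun i => T (X i)) g = g := by
    intro g hg
    induction hg using Submodule.mul_induction_on' with
    | mem_mul_mem c hc d hd =>
      rw [map_mul, hT c (hB hc), hT d (hB hd), Submodule.projection_apply_of_mem_left hBC hc,
        Submodule.projection_apply_of_mem_left hBC hd]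
    | add x _ y _ hx hy => rw [map_add, hx, hy]
  have hTA : ∀ a ∈ A, T a ∈ A ⊓ B := by
    intro a ha
    obtain ⟨x, hx, y, hy, rfl⟩ := Submodule.mem_sup.1 (hA' ha)
    rw [map_add, Submodule.projection_apply_of_mem_left hBC hx.2,
      (Submodule.projection_apply_eq_zero_iff hBC).2 (hC hy), add_zero]
    exact hx
  have hmap : ∀ g ∈ A * A, aeval (fun i => T (X i)) g ∈ (A ⊓ B) * (A ⊓ B) := by
    intro g hg
    induction hg using Submodule.mul_induction_on' with
    | mem_mul_mem c hc d hd =>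
      rw [map_mul, hT c (hA hc), hT d (hA hd)]
      exact Submodule.mul_mem_mul (hTA c hc) (hTA d hd)
    | add x _ y _ hx hy => rw [map_add]; exact add_mem hx hy
  rw [← hfix f hfB]
  exact hmap f hfA

end Substitution

section Products

variable {n : ℕ} {V : Submodule ℂ (MvPolynomial (Fin n) ℂ)} {a b c d : MvPolynomial (Fin n) ℂ}

theorem eq_zero_of_mul_mem (hV : V ≤ linForms n) (hc : c ∈ linForms n) (hd : d ∈ linForms n)
    (h : c * d ∈ V * V) (hcV : c ∉ V) : d = 0 := by
  obtain ⟨p, hp, hpc⟩ := exists_eval_eq_one hV hc hcV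
  have h1 := dirDeriv_eq_zero hV hp h
  rw [dirDeriv_mul p hc hd, hpc, one_smul] at h1
  have h2 := congrArg (eval p) h1
  rw [map_add, smul_eval, hpc, mul_one, map_zero] at h2
  have h3 : eval p d = 0 := by linear_combination h2 / 2
  simpa [h3] using h1

theorem mem_of_mul_mem (hV : V ≤ linForms n) (hc : c ∈ linForms n) (hd : d ∈ linForms n)
    (h : c * d ∈ V * V) (h0 : c * d ≠ 0) : c ∈ V ∧ d ∈ V := by
  constructor
  · by_contra hcV
    exact h0 (by rw [eq_zero_of_mul_mem hV hc hd h hcV, mul_zero])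
  · by_contra hdV
    exact h0 (by rw [eq_zero_of_mul_mem hV hd hc (mul_comm c d ▸ h) hdV, zero_mul])

theorem span_singleton_le_linForms (hd : d ∈ linForms n) : Submodule.span ℂ {d} ≤ linForms n :=
  (Submodule.span_singleton_le_iff_mem _ _).2 hd

theorem mem_sup_span_singleton_self (V : Submodule ℂ (MvPolynomial (Fin n) ℂ))
    (d : MvPolynomial (Fin n) ℂ) : d ∈ V ⊔ Submodule.span ℂ {d} :=
  Submodule.mem_sup_right (Submodule.mem_span_singleton_self d)

theorem mul_eq_mul_of_sub_mem {c' d' : MvPolynomial (Fin n) ℂ} (hV : V ≤ linForms n)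
    (hc : c ∈ linForms n) (hd : d ∈ linForms n) (hc' : c' ∈ linForms n) (hd' : d' ∈ linForms n)
    (h : c * d - c' * d' ∈ V * V) (hcd : c ∉ V ⊔ Submodule.span ℂ {d})
    (hdc : d ∉ V ⊔ Submodule.span ℂ {c}) : c * d = c' * d' := by
  obtain ⟨φ, hφ, hφc⟩ := exists_eval_eq_one
    (sup_le hV (span_singleton_le_linForms hd)) hc hcd
  obtain ⟨ψ, hψ, hψd⟩ := exists_eval_eq_one
    (sup_le hV (span_singleton_le_linForms hc)) hd hdc
  have hφd := hφ d (mem_sup_span_singleton_self V d)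
  have hψc := hψ c (mem_sup_span_singleton_self V c)
  have e1 := dirDeriv_eq_zero hV (fun v hv => hφ v (Submodule.mem_sup_left hv)) h
  have e2 := dirDeriv_eq_zero hV (fun v hv => hψ v (Submodule.mem_sup_left hv)) h
  rw [map_sub, dirDeriv_mul φ hc hd, dirDeriv_mul φ hc' hd', hφd, hφc, zero_smul, one_smul,
    zero_add, sub_eq_zero] at e1
  rw [map_sub, dirDeriv_mul ψ hc hd, dirDeriv_mul ψ hc' hd', hψd, hψc, zero_smul, one_smul,
    add_zero, sub_eq_zero] at e2
  have f1 := congrArg (eval φ) e1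
  have f2 := congrArg (eval ψ) e2
  have f3 := congrArg (eval φ) e2
  rw [map_add, smul_eval, smul_eval] at f1 f2 f3
  rw [hφd] at f1
  rw [hψc] at f2
  rw [hφc] at f3
  set p := eval φ c'
  set q := eval φ d'
  set r := eval ψ c'
  set s := eval ψ d'
  have hpq : p * q = 0 := by linear_combination -f1 / 2
  have hrs : r * s = 0 := by linear_combination -f2 / 2
  rw [e1, e2]
  simp only [smul_eq_C_mul]
  rcases mul_eq_zero.1 hpq with hp | hq
  · rw [hp, mul_zero, zero_add] at f3
    have hr : r ≠ 0 := by intro h; rw [h, zero_mul] at f3; norm_num at f3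
    have hs : s = 0 := (mul_eq_zero.1 hrs).resolve_left hr
    rw [hp, hs, C_0]
    have : (C r * C q : MvPolynomial (Fin n) ℂ) = 1 := by rw [← C_mul, ← f3, C_1]
    linear_combination (c' * d') * this
  · rw [hq, mul_zero, add_zero] at f3
    have hs : s ≠ 0 := by intro h; rw [h, zero_mul] at f3; norm_num at f3
    have hr : r = 0 := (mul_eq_zero.1 hrs).resolve_right hs
    rw [hq, hr, C_0]
    have : (C s * C p : MvPolynomial (Fin n) ℂ) = 1 := by rw [← C_mul, ← f3, C_1]
    linear_combination (c' * d') * this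

theorem mem_or_lowRank_of_mul_add_mul_mem_left (hV : V ≤ linForms n) (ha : a ∈ linForms n)
    (hb : b ∈ linForms n) (hc : c ∈ linForms n) (hd : d ∈ linForms n)
    (h : a * b + c * d ∈ V * V) : a ∈ V ∨ LowRank 1 (a * b + c * d) := by
  by_contra! hcon
  obtain ⟨haV, hrank⟩ := hcon
  obtain ⟨φ, hφ, hφa⟩ := exists_eval_eq_one hV ha haV
  have e := dirDeriv_eq_zero hV hφ h
  rw [map_add, dirDeriv_mul φ ha hb, dirDeriv_mul φ hc hd, hφa, one_smul] at e
  have f := congrArg (eval φ) e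
  simp only [map_add, smul_eval, map_zero, hφa] at f
  set p := eval φ c
  set q := eval φ d
  have hb' : eval φ b = -(p * q) := by linear_combination f / 2
  rw [hb'] at e
  apply hrank
  have : a * b + c * d = (p • a - c) * (q • a - d) := by
    simp only [smul_eq_C_mul, C_neg, C_mul] at e ⊢
    linear_combination a * e
  rw [this]
  exact LowRank.mul (sub_mem (Submodule.smul_mem _ _ ha) hc) (sub_mem (Submodule.smul_mem _ _ ha) hd)

theorem mem_or_lowRank_of_mul_add_mul_mem (hV : V ≤ linForms n) (ha : a ∈ linForms n)
    (hb : b ∈ linForms n) (hc : c ∈ linForms n) (hd : d ∈ linForms n)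
    (h : a * b + c * d ∈ V * V) :
    (a ∈ V ∧ b ∈ V ∧ c ∈ V ∧ d ∈ V) ∨ LowRank 1 (a * b + c * d) := by
  by_cases hr : LowRank 1 (a * b + c * d)
  · exact Or.inr hr
  refine Or.inl ⟨?_, ?_, ?_, ?_⟩
  · exact (mem_or_lowRank_of_mul_add_mul_mem_left hV ha hb hc hd h).resolve_right hr
  · have e : a * b + c * d = b * a + c * d := by ring
    exact (mem_or_lowRank_of_mul_add_mul_mem_left hV hb ha hc hd (e ▸ h)).resolve_right (e ▸ hr)
  · have e : a * b + c * d = c * d + a * b := by ring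
    exact (mem_or_lowRank_of_mul_add_mul_mem_left hV hc hd ha hb (e ▸ h)).resolve_right (e ▸ hr)
  · have e : a * b + c * d = d * c + a * b := by ring
    exact (mem_or_lowRank_of_mul_add_mul_mem_left hV hd hc ha hb (e ▸ h)).resolve_right (e ▸ hr)

end Products

section Isotropic

variable {n : ℕ} {Q A B : MvPolynomial (Fin n) ℂ}

theorem exists_eval_ne_zero (h : Q ≠ 0) : ∃ x, eval x Q ≠ 0 := by
  by_contra! hc
  exact h (MvPolynomial.funext fun x => by simpa using hc x)

theorem exists_quadratic_root {α : ℂ} (hα : α ≠ 0) (β γ : ℂ) :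
    ∃ t, γ + t * β + t ^ 2 * α = 0 := by
  obtain ⟨s, hs⟩ := IsAlgClosed.exists_eq_mul_self (discrim α β γ)
  obtain ⟨t, ht⟩ := exists_quadratic_eq_zero hα ⟨s, hs⟩
  exact ⟨t, by linear_combination ht⟩

theorem exists_eval_eq_zero_dirDeriv_ne_zero (hQ : Q ∈ linForms n * linForms n)
    (h1 : ¬ LowRank 1 Q) : ∃ e, eval e Q = 0 ∧ dirDeriv e Q ≠ 0 := by
  by_contra! hcon
  obtain ⟨x, hx⟩ := exists_eval_ne_zero (Q := Q) (by rintro rfl; exact h1 (LowRank.zero n 1))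
  apply h1
  set b := dirDeriv x Q with hb
  have hbl : b ∈ linForms n := dirDeriv_mem_linForms x hQ
  have key : Q = (4 * eval x Q)⁻¹ • (b * b) := by
    refine MvPolynomial.funext fun y => ?_
    obtain ⟨t, ht⟩ := exists_quadratic_root hx (eval y b) (eval y Q)
    have h2 : eval ((1 : ℂ) • y + t • x) Q = 0 := by
      rw [eval_smul_add_smul y x 1 t hQ]
      linear_combination ht
    have h3 := congrArg (eval x) (hcon _ h2)
    rw [eval_dirDeriv_comm _ _ hQ, ← hb, eval_smul_add_smul_linForm _ _ _ _ hbl, map_zero, hb,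
      eval_dirDeriv_self x hQ, ← hb] at h3
    rw [smul_eval, map_mul, eq_inv_mul_iff_mul_eq₀ (by simpa using hx)]
    linear_combination 4 * eval x Q * ht - h3 * (eval y b + 2 * t * eval x Q)
  rw [key]
  exact (LowRank.mul hbl hbl).smul _

theorem exists_eval_eq_zero_dirDeriv_ne_zero_eval_ne_zero (hQ : Q ∈ linForms n * linForms n)
    (h1 : ¬ LowRank 1 Q) {a : MvPolynomial (Fin n) ℂ} (ha : a ∈ linForms n) (ha0 : a ≠ 0) :
    ∃ e, eval e Q = 0 ∧ dirDeriv e Q ≠ 0 ∧ eval e a ≠ 0 := by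
  obtain ⟨e, he, hde⟩ := exists_eval_eq_zero_dirDeriv_ne_zero hQ h1
  by_cases hae : eval e a = 0
  swap
  · exact ⟨e, he, hde, hae⟩
  set b := dirDeriv e Q with hb
  have hbl : b ∈ linForms n := dirDeriv_mem_linForms e hQ
  obtain ⟨x, hx⟩ := exists_eval_ne_zero (mul_ne_zero ha0 hde)
  rw [map_mul] at hx
  have hax := left_ne_zero_of_mul hx
  have hbx := right_ne_zero_of_mul hx
  refine ⟨eval x b • x + (-eval x Q) • e, ?_, ?_, ?_⟩
  · rw [eval_smul_add_smul _ _ _ _ hQ, ← hb, he]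
    ring
  · intro h0
    have h2 := congrArg (eval e) h0
    rw [eval_dirDeriv_comm _ _ hQ, ← hb, eval_smul_add_smul_linForm _ _ _ _ hbl, map_zero,
      hb, eval_dirDeriv_self e hQ, he, ← hb] at h2
    simp [hbx] at h2
  · rw [eval_smul_add_smul_linForm _ _ _ _ ha, hae]
    simpa using ⟨hbx, hax⟩

theorem lowRank_one_of_dvd (hA : A ∈ linForms n * linForms n) {l : MvPolynomial (Fin n) ℂ}
    (hl : l ∈ linForms n) (h : l ∣ A) : LowRank 1 A := by
  rcases eq_or_ne l 0 with rfl | hl0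
  · rw [zero_dvd_iff.1 h]; exact LowRank.zero n 1
  obtain ⟨E, rfl⟩ := h
  exact LowRank.mul hl (isHomogeneous_right_of_mul hl hl0 (isHomogeneous_two_of_mem hA))

theorem exists_common_zero (hA : A ∈ linForms n * linForms n) (hA2 : ¬ LowRank 2 A)
    (hB : B ∈ linForms n * linForms n) :
    ∃ u, eval u A = 0 ∧ eval u B = 0 ∧ dirDeriv u A ≠ 0 := by
  obtain ⟨e, he, hde⟩ := exists_eval_eq_zero_dirDeriv_ne_zero hA
    fun h => hA2 (h.mono (by norm_num))
  set a := dirDeriv e A with ha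
  have hal : a ∈ linForms n := dirDeriv_mem_linForms e hA
  obtain ⟨κ, hκ⟩ := exists_isKill (span_singleton_le_linForms hal)
  obtain ⟨e'', he'', hde''⟩ := exists_eval_eq_zero_dirDeriv_ne_zero (hκ.mem_mul hA)
    fun h => hA2 (hκ.lowRank (span_singleton_le_linForms hal) hA (finrank_span_singleton_le a) h)
  set e' : Fin n → ℂ := fun i => eval e'' (κ (X i)) with he'
  have hev : ∀ f, eval e' f = eval e'' (κ f) := by
    intro f
    have : (aeval e' : MvPolynomial (Fin n) ℂ →ₐ[ℂ] ℂ) = (aeval e'').comp κ := by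
      refine MvPolynomial.algHom_ext fun i => ?_
      simp [he', aeval_eq_eval]
    exact DFunLike.congr_fun this f
  have hκD : ∀ f ∈ linForms n * linForms n, κ (dirDeriv e' f) = dirDeriv e'' (κ f) := by
    intro f hf
    induction hf using Submodule.mul_induction_on' with
    | mem_mul_mem c hc d hd =>
      rw [dirDeriv_mul _ hc hd, map_mul, dirDeriv_mul _ (hκ.mem c hc) (hκ.mem d hd), map_add,
        map_smul, map_smul, hev, hev]
    | add x _ y _ hx hy => simp only [map_add, hx, hy]
  have hae' : eval e' a = 0 := by
    rw [hev, hκ.eq_zero a (Submodule.mem_span_singleton_self a), map_zero]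
  have hAe' : eval e' A = 0 := by rw [hev, he'']
  have hind : ∀ s : ℂ, s • a + dirDeriv e' A ≠ 0 := by
    intro s h
    apply hde''
    have := congrArg κ h
    rwa [map_add, map_smul, hκ.eq_zero a (Submodule.mem_span_singleton_self a), smul_zero,
      zero_add, map_zero, hκD A hA] at this
  by_cases hBe : eval e B = 0
  · exact ⟨e, he, hBe, hde⟩
  obtain ⟨t, ht⟩ := exists_quadratic_root hBe (eval e (dirDeriv e' B)) (eval e' B)
  refine ⟨t • e + (1 : ℂ) • e', ?_, ?_, ?_⟩
  · rw [eval_smul_add_smul _ _ _ _ hA, he, hAe', eval_dirDeriv_comm _ _ hA, ← ha, hae']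
    ring
  · rw [eval_smul_add_smul _ _ _ _ hB]
    linear_combination ht
  · rw [dirDeriv_smul_add_smul _ _ _ _ hA, one_smul]
    exact hind t

theorem exists_smooth_common_zero (hA : A ∈ linForms n * linForms n) (hA2 : ¬ LowRank 2 A)
    (hB : B ∈ linForms n * linForms n)
    (hAB : ∀ α β : ℂ, ¬(α = 0 ∧ β = 0) → ¬ LowRank 1 (α • A + β • B)) :
    ∃ p, eval p A = 0 ∧ eval p B = 0 ∧
      LinearIndependent ℂ ![dirDeriv p A, dirDeriv p B] := by
  obtain ⟨u, huA, huB, hdu⟩ := exists_common_zero hA hA2 hB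
  by_cases hind : LinearIndependent ℂ ![dirDeriv u A, dirDeriv u B]
  · exact ⟨u, huA, huB, hind⟩
  rw [LinearIndependent.pair_iff' hdu] at hind
  push Not at hind
  obtain ⟨l, hl⟩ := hind
  set a := dirDeriv u A with ha
  have hal : a ∈ linForms n := dirDeriv_mem_linForms u hA
  set B' := B - l • A with hB'
  have hB'm : B' ∈ linForms n * linForms n := sub_mem hB (Submodule.smul_mem _ _ hA)
  have hB'1 : ¬ LowRank 1 B' := by
    have := hAB (-l) 1 (by simp)
    rwa [show -l • A + (1 : ℂ) • B = B' by rw [hB']; module] at this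
  have hduB' : dirDeriv u B' = 0 := by rw [hB', map_sub, Derivation.map_smul, ← hl, ← ha, sub_self]
  obtain ⟨w, hw, hdw, haw⟩ :=
    exists_eval_eq_zero_dirDeriv_ne_zero_eval_ne_zero hB'm hB'1 hal hdu
  set t := -(eval w A / eval w a) with ht
  set p := (1 : ℂ) • w + t • u with hp
  have hpA : eval p A = 0 := by
    rw [hp, eval_smul_add_smul _ _ _ _ hA, ← ha, huA, ht]
    field_simp
    ring
  have hpB' : eval p B' = 0 := by
    rw [hp, eval_smul_add_smul _ _ _ _ hB'm, hw, hduB', map_zero,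
      show eval u B' = 0 by rw [hB', map_sub, smul_eval, huA, huB]; ring]
    ring
  refine ⟨p, hpA, ?_, ?_⟩
  · rw [hB', map_sub, smul_eval, hpA] at hpB'
    linear_combination hpB'
  · rw [LinearIndependent.pair_iff]
    intro α β h
    have hBB' : dirDeriv p B = dirDeriv p B' + l • dirDeriv p A := by
      rw [hB', map_sub, Derivation.map_smul]; abel
    have h1 := congrArg (eval u) h
    rw [hBB', map_add, smul_eval, smul_eval, map_add, smul_eval, eval_dirDeriv_comm _ _ hB'm,
      hduB', eval_dirDeriv_comm _ _ hA, ← ha, hp, eval_smul_add_smul_linForm _ _ _ _ hal, ha,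
      eval_dirDeriv_self _ hA, huA, ← ha] at h1
    have h2 : α + β * l = 0 := by
      have : (α + β * l) * eval w a = 0 := by
        simp only [map_zero] at h1
        linear_combination h1
      exact (mul_eq_zero.1 this).resolve_right haw
    have h3 : β • dirDeriv p B' = 0 := by
      have : α • dirDeriv p A + β • dirDeriv p B
          = (α + β * l) • dirDeriv p A + β • dirDeriv p B' := by rw [hBB']; module
      rw [h, h2, zero_smul, zero_add] at this
      exact this.symm
    rw [hp, dirDeriv_smul_add_smul _ _ _ _ hB'm, hduB', smul_zero, add_zero, one_smul] at h3
    have hβ : β = 0 := (smul_eq_zero.1 h3).resolve_right hdw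
    rw [hβ] at h2
    exact ⟨by simpa using h2, hβ⟩

end Isotropic

section ThirdElement

variable {n : ℕ} {ι : Type*} {s : Finset ι} {F : ι → MvPolynomial (Fin n) ℂ}
  {A B : MvPolynomial (Fin n) ℂ}

theorem exists_map_mem_of_prod_mem_radical (φ : MvPolynomial (Fin n) ℂ →ₐ[ℂ] MvPolynomial (Fin n) ℂ)
    {I : Ideal (MvPolynomial (Fin n) ℂ)} (hI : I.IsPrime) (hA : φ A ∈ I) (hB : φ B ∈ I)
    (h : ∏ k ∈ s, F k ∈ (Ideal.span {A, B}).radical) : ∃ k ∈ s, φ (F k) ∈ I := by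
  have hle : (Ideal.span {A, B}).radical ≤ I.comap φ := by
    rw [(hI.comap φ).radical_le_iff, Ideal.span_le]
    rintro x (rfl | rfl)
    exacts [hA, hB]
  exact ((hI.comap φ).prod_mem_iff).1 (hle h)

/-- For a common zero `p` of `A` and `B` with independent gradients `a`, `b`, the cubic
`a * B - b * A` (the projection of `A = B = 0` from `p`) has no linear factor. -/
theorem not_linForm_dvd_sub (hA : A ∈ linForms n * linForms n) (hA2 : ¬ LowRank 2 A)
    (hB : B ∈ linForms n * linForms n)
    (hAB : ∀ α β : ℂ, ¬(α = 0 ∧ β = 0) → ¬ LowRank 1 (α • A + β • B))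
    {a b l : MvPolynomial (Fin n) ℂ} (ha : a ∈ linForms n) (hb : b ∈ linForms n)
    (hab : LinearIndependent ℂ ![a, b]) (hl : l ∈ linForms n) (hl0 : l ≠ 0) :
    ¬ l ∣ a * B - b * A := by
  intro hdvd
  have hlp := prime_of_mem_linForms hl hl0
  have ha0 : a ≠ 0 := hab.ne_zero 0
  have hap := prime_of_mem_linForms ha ha0
  have hA1 : ¬ LowRank 1 A := fun h => hA2 (h.mono (by norm_num))
  have hnb : ∀ c : ℂ, b ≠ c • a := by
    intro c hc
    rw [LinearIndependent.pair_iff] at hab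
    have := hab c (-1) (by rw [hc]; module)
    simp at this
  have hnla : ¬ l ∣ a := by
    intro h
    have h1 : l ∣ b * A := by
      have := (h.mul_right B).sub hdvd
      rwa [sub_sub_cancel] at this
    rcases hlp.dvd_or_dvd h1 with h2 | h2
    · obtain ⟨c, hc⟩ := eq_smul_of_dvd_linForm hl ha h
      obtain ⟨d, hd⟩ := eq_smul_of_dvd_linForm hl hb h2
      have hc0 : c ≠ 0 := by rintro rfl; exact ha0 (by rw [hc, zero_smul])
      refine hnb (d / c) ?_
      rw [hc, hd, smul_smul, div_mul_cancel₀ _ hc0]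
    · exact hA1 (lowRank_one_of_dvd hA hl h2)
  by_cases hbs : b ∈ Submodule.span ℂ {a, l}
  · obtain ⟨x, y, hxy⟩ := Submodule.mem_span_pair.1 hbs
    have h1 : l ∣ a * (-x • A + (1 : ℂ) • B) := by
      have h2 : a * (-x • A + (1 : ℂ) • B) = (a * B - b * A) + l * (y • A) := by
        rw [← hxy]
        simp only [smul_eq_C_mul, map_neg, map_one]
        ring
      rw [h2]
      exact hdvd.add (dvd_mul_right _ _)
    rcases hlp.dvd_or_dvd h1 with h2 | h2
    · exact hnla h2
    · exact hAB (-x) 1 (by simp) (lowRank_one_of_dvd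
        (add_mem (Submodule.smul_mem _ _ hA) (Submodule.smul_mem _ _ hB)) hl h2)
  · have hU : Submodule.span ℂ {a, l} ≤ linForms n := by
      rw [Submodule.span_le]
      rintro x (rfl | rfl)
      exacts [ha, hl]
    obtain ⟨κ, hκ⟩ := exists_isKill hU
    have hκb : κ b ≠ 0 := fun h => hbs (hκ.mem_of_eq_zero hb h)
    have hκa : κ a = 0 := hκ.eq_zero a (Submodule.subset_span (by simp))
    have hκl : κ l = 0 := hκ.eq_zero l (Submodule.subset_span (by simp))
    obtain ⟨E, hE⟩ := hdvd
    have h1 := congrArg κ hE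
    rw [map_sub, map_mul, map_mul, map_mul, hκa, hκl, zero_mul, zero_mul, zero_sub,
      neg_eq_zero, mul_eq_zero, or_iff_right hκb] at h1
    exact hA2 (hκ.lowRank (l := 0) hU hA (finrank_span_pair_le a l)
      (by rw [h1]; exact LowRank.zero n 0))

theorem exists_eq_smul_add_smul_of_prod_mem_radical (hA : A ∈ linForms n * linForms n)
    (hA2 : ¬ LowRank 2 A) (hB : B ∈ linForms n * linForms n)
    (hAB : ∀ α β : ℂ, ¬(α = 0 ∧ β = 0) → ¬ LowRank 1 (α • A + β • B))
    (hF : ∀ k ∈ s, F k ∈ linForms n * linForms n)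
    (h : ∏ k ∈ s, F k ∈ (Ideal.span {A, B}).radical) :
    ∃ k ∈ s, ∃ α β : ℂ, F k = α • A + β • B := by
  obtain ⟨p, hpA, hpB, hind⟩ := exists_smooth_common_zero hA hA2 hB hAB
  set a := dirDeriv p A with ha
  set b := dirDeriv p B with hb
  have hal : a ∈ linForms n := dirDeriv_mem_linForms p hA
  have hbl : b ∈ linForms n := dirDeriv_mem_linForms p hB
  have ha0 : a ≠ 0 := hind.ne_zero 0
  have hap := prime_of_mem_linForms hal ha0
  have hA1 : ¬ LowRank 1 A := fun h => hA2 (h.mono (by norm_num))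
  have hnab : ¬ a ∣ b := by
    intro hd
    obtain ⟨c, hc⟩ := eq_smul_of_dvd_linForm hal hbl hd
    rw [LinearIndependent.pair_iff] at hind
    have := hind c (-1) (by rw [hc]; module)
    simp at this
  have hnaA : ¬ a ∣ A := fun hd => hA1 (lowRank_one_of_dvd hA hal hd)
  set D := a * B - b * A with hD
  have hnot : ∀ l ∈ linForms n, l ≠ 0 → ¬ l ∣ D := fun l hl hl0 =>
    not_linForm_dvd_sub hA hA2 hB hAB hal hbl hind hl hl0
  have hD0 : D ≠ 0 := fun h0 => hnot a hal ha0 (by rw [h0]; exact dvd_zero a)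
  have hA' := isHomogeneous_two_of_mem hA
  have hB' := isHomogeneous_two_of_mem hB
  have hDh : D.IsHomogeneous 3 :=
    (show (a * B).IsHomogeneous (1 + 2) from IsHomogeneous.mul hal hB').sub
      (show (b * A).IsHomogeneous (1 + 2) from IsHomogeneous.mul hbl hA')
  have hDp : Prime D := by
    rcases prime_or_exists_linForm_dvd hDh hD0 with h1 | ⟨l, hl, hl0, hlD⟩
    · exact h1
    · exact absurd hlD (hnot l hl hl0)
  set ψ : MvPolynomial (Fin n) ℂ →ₐ[ℂ] MvPolynomial (Fin n) ℂ :=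
    aeval (fun i => a * X i + (-A) * algebraMap ℂ _ (p i)) with hψ
  have hψF : ∀ G ∈ linForms n * linForms n,
      ψ G = a ^ 2 * G + a * (-A) * dirDeriv p G + (-A) ^ 2 * algebraMap ℂ _ (eval p G) := by
    intro G hG
    rw [hψ, aeval_mul_add_mul X p a (-A) hG, aeval_X_left]
    rfl
  have hψA : ψ A = 0 := by
    rw [hψF A hA, hpA, ← ha, map_zero]; ring
  have hψB : ψ B = D * a := by
    rw [hψF B hB, hpB, ← hb, map_zero, hD]; ring
  obtain ⟨k, hk, hkD⟩ := exists_map_mem_of_prod_mem_radical ψ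
    ((Ideal.span_singleton_prime hD0).2 hDp) (by rw [hψA]; exact zero_mem _)
    (by rw [hψB]; exact Ideal.mem_span_singleton.2 (dvd_mul_right _ _)) h
  obtain ⟨l, hl⟩ := Ideal.mem_span_singleton.1 hkD
  have hFk := hF k hk
  set G := F k
  have hGd : dirDeriv p G ∈ linForms n := dirDeriv_mem_linForms p hFk
  rw [hψF G hFk] at hl
  have hll : l ∈ linForms n := by
    refine isHomogeneous_right_of_mul (d := 1) hDh hD0 ?_
    rw [← hl]
    have e1 : (a ^ 2 * G).IsHomogeneous (1 * 2 + 2) :=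
      (IsHomogeneous.pow hal 2).mul (isHomogeneous_two_of_mem hFk)
    have e2 : (a * (-A) * dirDeriv p G).IsHomogeneous (1 + 2 + 1) :=
      (IsHomogeneous.mul hal hA'.neg).mul hGd
    have e3 : ((-A) ^ 2 * algebraMap ℂ (MvPolynomial (Fin n) ℂ) (eval p G)).IsHomogeneous
        (2 * 2 + 0) := (hA'.neg.pow 2).mul (isHomogeneous_C _ _)
    exact (e1.add e2).add e3
  have hdv : a ∣ A * (b * l + A * algebraMap ℂ _ (eval p G)) := by
    refine ⟨B * l - a * G + A * dirDeriv p G, ?_⟩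
    rw [hD] at hl
    linear_combination hl
  have hdv2 := (hap.dvd_or_dvd hdv).resolve_left hnaA
  have hGp : eval p G = 0 := by
    by_contra hne
    obtain ⟨E, hE⟩ := hdv2
    have hEl : E ∈ linForms n := by
      refine isHomogeneous_right_of_mul (d := 1) hal ha0 ?_
      rw [← hE]
      exact (IsHomogeneous.mul hbl hll).add
        (show (A * algebraMap ℂ (MvPolynomial (Fin n) ℂ) (eval p G)).IsHomogeneous (2 + 0) from
          hA'.mul (isHomogeneous_C _ _))
    refine hA2 (LowRank.of_smul hne ?_)
    have : eval p G • A = a * E + -(b * l) := by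
      rw [← hE, smul_eq_C_mul, algebraMap_eq]; ring
    rw [this]
    exact (LowRank.mul hal hEl).add (LowRank.mul hbl hll).neg
  rw [hGp, map_zero, mul_zero, add_zero] at hdv2
  obtain ⟨μ, hμ⟩ := eq_smul_of_dvd_linForm hal hll ((hap.dvd_or_dvd hdv2).resolve_left hnab)
  have h3 : a * (G - μ • B) = A * (dirDeriv p G - μ • b) := by
    rw [hGp, map_zero, hμ, hD] at hl
    refine mul_left_cancel₀ ha0 ?_
    simp only [smul_eq_C_mul] at hl ⊢
    linear_combination hl
  have h4 : a ∣ dirDeriv p G - μ • b :=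
    (hap.dvd_or_dvd (h3 ▸ dvd_mul_right _ _)).resolve_left hnaA
  obtain ⟨ν, hν⟩ := eq_smul_of_dvd_linForm hal (sub_mem hGd (Submodule.smul_mem _ _ hbl)) h4
  refine ⟨k, hk, ν, μ, ?_⟩
  rw [hν] at h3
  have h5 : G - μ • B = ν • A := by
    refine mul_left_cancel₀ ha0 ?_
    rw [h3, smul_eq_C_mul, smul_eq_C_mul]; ring
  rw [← h5]; abel

theorem exists_eq_smul_add_mul_of_prod_mem_radical (hA : A ∈ linForms n * linForms n)
    (hA2 : ¬ LowRank 2 A) {d v₁ v₂ : MvPolynomial (Fin n) ℂ} (hd : d ∈ linForms n) {α₁ α₂ : ℂ}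
    (hF : ∀ k ∈ s, F k ∈ linForms n * linForms n)
    (h : ∏ k ∈ s, F k ∈ (Ideal.span {α₁ • A + d * v₁, α₂ • A + d * v₂}).radical) :
    ∃ k ∈ s, ∃ α : ℂ, ∃ v ∈ linForms n, F k = α • A + d * v := by
  have hU := span_singleton_le_linForms hd
  obtain ⟨κ, hκ⟩ := exists_isKill hU
  have hκd : κ d = 0 := hκ.eq_zero d (Submodule.mem_span_singleton_self d)
  have hκA1 : ¬ LowRank 1 (κ A) := fun h1 =>
    hA2 (hκ.lowRank hU hA (finrank_span_singleton_le d) h1)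
  have hp := prime_of_not_lowRank (hκ.mem_mul hA) hκA1
  have key : ∀ (α : ℂ) (v : MvPolynomial (Fin n) ℂ),
      κ (α • A + d * v) ∈ Ideal.span {κ A} := fun α v => by
    rw [map_add, map_mul, hκd, zero_mul, add_zero, map_smul, smul_eq_C_mul]
    exact Ideal.mul_mem_left _ _ (Ideal.mem_span_singleton_self _)
  obtain ⟨k, hk, hkA⟩ := exists_map_mem_of_prod_mem_radical κ
    ((Ideal.span_singleton_prime hp.ne_zero).2 hp) (key α₁ v₁) (key α₂ v₂) h
  obtain ⟨E, hE⟩ := Ideal.mem_span_singleton.1 hkA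
  have hE0 : E.IsHomogeneous 0 := isHomogeneous_right_of_mul
    (isHomogeneous_two_of_mem (hκ.mem_mul hA)) hp.ne_zero
    (hE ▸ isHomogeneous_two_of_mem (hκ.mem_mul (hF k hk)))
  obtain ⟨α, rfl⟩ : ∃ α : ℂ, E = C α :=
    ⟨_, totalDegree_eq_zero_iff_eq_C.1 (by simpa using hE0.totalDegree_le)⟩
  have hmem : F k - α • A ∈ linForms n * linForms n :=
    sub_mem (hF k hk) (Submodule.smul_mem _ _ hA)
  have h0 : κ (F k - α • A) = 0 := by
    rw [map_sub, map_smul, hE, smul_eq_C_mul]; ring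
  have h1 := hκ.sub_mem_mul hmem
  rw [h0, sub_zero, Submodule.mem_span_singleton_mul] at h1
  obtain ⟨v, hv, hvd⟩ := h1
  exact ⟨k, hk, α, v, hv, by rw [hvd]; abel⟩

theorem exists_mem_span_mul_of_prod_mem_radical {l₁ l₂ : MvPolynomial (Fin n) ℂ}
    (hl₁ : l₁ ∈ linForms n) (hl₂ : l₂ ∈ linForms n)
    (hF : ∀ k ∈ s, F k ∈ linForms n * linForms n)
    (h : ∏ k ∈ s, F k ∈ (Ideal.span {l₁ ^ 2, l₂ ^ 2}).radical) :
    ∃ k ∈ s, F k ∈ Submodule.span ℂ {l₁, l₂} * linForms n := by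
  have hU : Submodule.span ℂ {l₁, l₂} ≤ linForms n := by
    rw [Submodule.span_le]
    rintro x (rfl | rfl)
    exacts [hl₁, hl₂]
  obtain ⟨κ, hκ⟩ := exists_isKill hU
  have h1 : κ l₁ = 0 := hκ.eq_zero l₁ (Submodule.subset_span (by simp))
  have h2 : κ l₂ = 0 := hκ.eq_zero l₂ (Submodule.subset_span (by simp))
  obtain ⟨k, hk, hk0⟩ := exists_map_mem_of_prod_mem_radical κ Ideal.isPrime_bot
    (by simp [h1]) (by simp [h2]) h
  refine ⟨k, hk, ?_⟩
  have := hκ.sub_mem_mul (hF k hk)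
  rwa [Ideal.mem_bot.1 hk0, sub_zero] at this

end ThirdElement

section Extension

variable {n : ℕ} {V W : Submodule ℂ (MvPolynomial (Fin n) ℂ)} {u x y : MvPolynomial (Fin n) ℂ}

/-- The space of linear forms spanned by `V` and `u`. -/
noncomputable abbrev supSpan (V : Submodule ℂ (MvPolynomial (Fin n) ℂ)) (u : MvPolynomial (Fin n) ℂ) :
    Submodule ℂ (MvPolynomial (Fin n) ℂ) :=
  V ⊔ Submodule.span ℂ {u}

theorem mem_supSpan : x ∈ supSpan V u ↔ ∃ v ∈ V, ∃ c : ℂ, x = v + c • u := by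
  rw [Submodule.mem_sup]
  constructor
  · rintro ⟨v, hv, w, hw, rfl⟩
    obtain ⟨c, rfl⟩ := Submodule.mem_span_singleton.1 hw
    exact ⟨v, hv, c, rfl⟩
  · rintro ⟨v, hv, c, rfl⟩
    exact ⟨v, hv, c • u, Submodule.smul_mem _ _ (Submodule.mem_span_singleton_self u), rfl⟩

theorem supSpan_le (hV : V ≤ W) (hu : u ∈ W) : supSpan V u ≤ W :=
  sup_le hV ((Submodule.span_singleton_le_iff_mem _ _).2 hu)

theorem self_mem_supSpan : u ∈ supSpan V u := mem_sup_span_singleton_self V u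

/-- The exchange property for one-step extensions of `V`. -/
theorem mem_supSpan_exchange (hx : x ∈ supSpan V u) (hxV : x ∉ V) : u ∈ supSpan V x := by
  obtain ⟨v, hv, c, rfl⟩ := mem_supSpan.1 hx
  have hc : c ≠ 0 := by
    rintro rfl
    exact hxV (by simpa using hv)
  refine mem_supSpan.2 ⟨-(c⁻¹ • v), neg_mem (Submodule.smul_mem _ _ hv), c⁻¹, ?_⟩
  rw [smul_add, smul_smul, inv_mul_cancel₀ hc, one_smul]
  abel

theorem finrank_supSpan_le {k : ℕ} (hV : V ≤ linForms n) (hk : Module.finrank ℂ V ≤ k) :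
    Module.finrank ℂ (supSpan V u) ≤ k + 1 := by
  have := finiteDimensional_of_le_linForms hV
  exact (Submodule.finrank_add_le_finrank_add_finrank V (Submodule.span ℂ {u})).trans
    (add_le_add hk (finrank_span_singleton_le u))

theorem lowRank_of_mem_mul_self {k : ℕ} {f : MvPolynomial (Fin n) ℂ} (hW : W ≤ linForms n)
    (hk : Module.finrank ℂ W ≤ k) (hf : f ∈ W * W) : LowRank k f :=
  lowRank_of_mem_mul hW hk (mul_le_mul' le_rfl hW hf)

theorem mem_of_mul_self_mem {R : MvPolynomial (Fin n) ℂ} (hV : V ≤ linForms n)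
    (hu : u ∈ linForms n) (hW : W ≤ linForms n) (hVW : V ≤ W)
    (hR : R ∈ supSpan V u * supSpan V u) (hRV : R ∉ V * V) (hRW : R ∈ W * W) : u ∈ W := by
  by_contra huW
  apply hRV
  have hle : supSpan V u ⊓ W ≤ V := by
    rintro z ⟨hz, hzW⟩
    obtain ⟨v, hv, c, rfl⟩ := mem_supSpan.1 hz
    have h1 : c • u ∈ W := by simpa using sub_mem hzW (hVW hv)
    rcases eq_or_ne c 0 with rfl | hc
    · simpa using hv
    · exact absurd ((Submodule.smul_mem_iff _ hc).1 h1) huW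
  exact mul_le_mul' hle hle (mul_self_inf_mul_self (supSpan_le hV hu) hW hR hRW)

/-- If `R` is supported on `V + u` and on `d * v` modulo quadratics in `A`, then `u ∈ A`. -/
theorem mem_of_eq_smul_add_mul {A : Submodule ℂ (MvPolynomial (Fin n) ℂ)}
    {R R' d v : MvPolynomial (Fin n) ℂ} {α : ℂ} (hV : V ≤ linForms n)
    (hu : u ∈ linForms n) (hA : A ≤ linForms n) (hVA : V ≤ A)
    (hR : R ∈ supSpan V u * supSpan V u) (hRV : R ∉ V * V) (hR' : R' ∈ A * A) (hd : d ∈ A)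
    (hdV : d ∉ V) (hv : v ∈ linForms n) (h : R = α • R' + d * v) : u ∈ A := by
  by_cases hvA : v ∈ A
  · refine mem_of_mul_self_mem hV hu hA hVA hR hRV ?_
    rw [h]
    exact add_mem (Submodule.smul_mem _ _ hR') (Submodule.mul_mem_mul hd hvA)
  · obtain ⟨φ, hφ, hφv⟩ := exists_eval_eq_one hA hv hvA
    have h1 := dirDeriv_mem (supSpan_le hV hu) φ hR
    rw [h, map_add, Derivation.map_smul, dirDeriv_eq_zero hA hφ hR', dirDeriv_mul φ (hA hd) hv,
      hφv, hφ d hd, smul_zero, zero_add, zero_smul, add_zero, one_smul] at h1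
    exact supSpan_le hVA hd (mem_supSpan_exchange h1 hdV)

theorem eq_and_eq_of_not_lowRank {Q X Y : MvPolynomial (Fin n) ℂ} {k l : ℕ} {α β : ℂ}
    (hQ : ¬ LowRank 20 Q) (hX : LowRank k X) (hY : LowRank l Y) (hkl : k + l ≤ 20)
    (h : α • Q + X = β • Q + Y) : α = β ∧ X = Y := by
  have hαβ : α = β := by
    by_contra hne
    have h1 : (α - β) • Q = Y - X := by
      rw [sub_smul, sub_eq_sub_iff_add_eq_add, h, add_comm]
    exact hQ (LowRank.of_smul (sub_ne_zero.2 hne) (h1 ▸ (hY.sub hX).mono (by omega)))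
  subst hαβ
  exact ⟨rfl, add_left_cancel h⟩

end Extension

section RadicalFamily

variable {n : ℕ} {ι : Type*} [Fintype ι] [DecidableEq ι] {F : ι → MvPolynomial (Fin n) ℂ}

/-- A finite family of pairwise independent quadratics such that for any two of them the product
of the others lies in the radical of the ideal they generate. -/
structure IsRadicalFamily (F : ι → MvPolynomial (Fin n) ℂ) : Prop where
  mem : ∀ k, F k ∈ linForms n * linForms n
  indep : ∀ i j, i ≠ j → LinearIndependent ℂ ![F i, F j]
  prod_mem : ∀ i j, i ≠ j →
    ∏ k ∈ (Finset.univ.erase i).erase j, F k ∈ (Ideal.span {F i, F j}).radical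

namespace IsRadicalFamily

theorem eq_of_smul_eq (hF : IsRadicalFamily F) {i j : ι} {α : ℂ} (h : F i = α • F j) : i = j := by
  by_contra hij
  have := LinearIndependent.pair_iff.1 (hF.indep i j hij) 1 (-α) (by rw [h]; module)
  simp at this

theorem exists_combination (hF : IsRadicalFamily F) {i j : ι} (hij : i ≠ j)
    (hi : ¬ LowRank 2 (F i)) (hj : ¬ LowRank 1 (F j)) :
    ∃ α β : ℂ, α ≠ 0 ∧ β ≠ 0 ∧ (LowRank 1 (α • F i + β • F j) ∨
      ∃ k, k ≠ i ∧ k ≠ j ∧ F k = α • F i + β • F j) := by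
  by_cases hAB : ∀ α β : ℂ, ¬(α = 0 ∧ β = 0) → ¬ LowRank 1 (α • F i + β • F j)
  · obtain ⟨k, hk, α, β, h⟩ := exists_eq_smul_add_smul_of_prod_mem_radical (hF.mem i) hi
      (hF.mem j) hAB (fun k _ => hF.mem k) (hF.prod_mem i j hij)
    simp only [Finset.mem_erase, Finset.mem_univ, and_true] at hk
    refine ⟨α, β, ?_, ?_, Or.inr ⟨k, hk.2, hk.1, h⟩⟩
    · rintro rfl
      exact hk.1 (hF.eq_of_smul_eq (α := β) (by rw [h, zero_smul, zero_add]))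
    · rintro rfl
      exact hk.2 (hF.eq_of_smul_eq (α := α) (by rw [h, zero_smul, add_zero]))
  · push Not at hAB
    obtain ⟨α, β, h0, h1⟩ := hAB
    refine ⟨α, β, ?_, ?_, Or.inl h1⟩
    · rintro rfl
      refine hj (LowRank.of_smul (c := β) (h0 rfl) ?_)
      rwa [zero_smul, zero_add] at h1
    · rintro rfl
      refine hi (LowRank.of_smul (c := α) (fun h => h0 h rfl) ?_)
      rw [zero_smul, add_zero] at h1
      exact h1.mono (by norm_num)

end IsRadicalFamily

end RadicalFamily

section ThirdPoint

variable {n : ℕ} {ι : Type*} {F : ι → MvPolynomial (Fin n) ℂ} {Q : MvPolynomial (Fin n) ℂ}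
  {V : Submodule ℂ (MvPolynomial (Fin n) ℂ)} {γ : ι → ℂ} {u : ι → MvPolynomial (Fin n) ℂ}

/-- `k` is a third point on the line through `i` and `j`. -/
def IsThird (F : ι → MvPolynomial (Fin n) ℂ) (Q : MvPolynomial (Fin n) ℂ)
    (V : Submodule ℂ (MvPolynomial (Fin n) ℂ)) (γ : ι → ℂ)
    (u : ι → MvPolynomial (Fin n) ℂ) (i j k : ι) : Prop :=
  u k ∈ supSpan (supSpan V (u i)) (u j) ∧
    F k - γ k • Q ∉ supSpan V (u i) * supSpan V (u i) ∧
    F k - γ k • Q ∉ supSpan V (u j) * supSpan V (u j)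

theorem IsThird.symm {i j k : ι} (hk : IsThird F Q V γ u i j k) : IsThird F Q V γ u j i k := by
  refine ⟨?_, hk.2.2, hk.2.1⟩
  have := hk.1
  rw [supSpan, supSpan, sup_right_comm] at this
  exact this

end ThirdPoint

section SimpleFamily

variable {n : ℕ} {ι : Type*} [Fintype ι] [DecidableEq ι] {F : ι → MvPolynomial (Fin n) ℂ}
  {Q : MvPolynomial (Fin n) ℂ} {V : Submodule ℂ (MvPolynomial (Fin n) ℂ)}
  {γ : ι → ℂ} {u : ι → MvPolynomial (Fin n) ℂ}

theorem mul_self_le_supSpan_mul_self (V : Submodule ℂ (MvPolynomial (Fin n) ℂ))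
    (u : MvPolynomial (Fin n) ℂ) : V * V ≤ supSpan V u * supSpan V u :=
  mul_le_mul' le_sup_left le_sup_left

/-- A radical family all of whose members have the form `γ k • Q + R k`, where `R k` is a
quadratic in the forms of `V` and a single further linear form `u k`. Members with `γ k = 0` are
either squares or share `R k` with a member for which `γ` does not vanish. -/
structure IsSimpleFamily (F : ι → MvPolynomial (Fin n) ℂ) (Q : MvPolynomial (Fin n) ℂ)
    (V : Submodule ℂ (MvPolynomial (Fin n) ℂ)) (γ : ι → ℂ)
    (u : ι → MvPolynomial (Fin n) ℂ) : Prop extends IsRadicalFamily F where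
  not_lowRank : ¬ LowRank 20 Q
  le_linForms : V ≤ linForms n
  finrank_le : Module.finrank ℂ V ≤ 4
  u_mem : ∀ k, u k ∈ linForms n
  rem_mem : ∀ k, F k - γ k • Q ∈ supSpan V (u k) * supSpan V (u k)
  trichotomy : ∀ k, γ k ≠ 0 ∨ (γ k = 0 ∧ F k = u k * u k) ∨
    (γ k = 0 ∧ ¬ LowRank 1 (F k) ∧
      ∃ k', γ k' ≠ 0 ∧ ∃ β : ℂ, β ≠ 0 ∧ F k' - γ k' • Q = β • F k)

namespace IsSimpleFamily

theorem supSpan_le_linForms (h : IsSimpleFamily F Q V γ u) (k : ι) : supSpan V (u k) ≤ linForms n :=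
  supSpan_le h.le_linForms (h.u_mem k)

theorem lowRank_sub (h : IsSimpleFamily F Q V γ u) (k : ι) : LowRank 5 (F k - γ k • Q) :=
  lowRank_of_mem_mul_self (h.supSpan_le_linForms k)
    (finrank_supSpan_le h.le_linForms h.finrank_le) (h.rem_mem k)

theorem eq_zero_of_lowRank (h : IsSimpleFamily F Q V γ u)
    {l : ℕ} (hl : l ≤ 15) {i : ι} (hi : LowRank l (F i)) : γ i = 0 := by
  refine (eq_and_eq_of_not_lowRank (k := 5) (l := l) h.not_lowRank (h.lowRank_sub i) hi (by omega)
    (β := 0) ?_).1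
  rw [zero_smul]
  abel

theorem not_lowRank_two (h : IsSimpleFamily F Q V γ u)
    {i : ι} (hi : γ i ≠ 0) : ¬ LowRank 2 (F i) := fun h2 =>
  hi (h.eq_zero_of_lowRank (by norm_num) h2)

theorem isSquare_of_lowRank_one (h : IsSimpleFamily F Q V γ u)
    {k : ι} (hk : LowRank 1 (F k)) : F k = u k * u k := by
  rcases h.trichotomy k with h1 | h1 | h1
  · exact absurd (h.eq_zero_of_lowRank (by norm_num) hk) h1
  · exact h1.2
  · exact absurd hk h1.2.1

theorem eq_smul_add (h : IsSimpleFamily F Q V γ u)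
    {i k : ι} {α : ℂ} {d v : MvPolynomial (Fin n) ℂ} (hd : d ∈ linForms n)
    (hv : v ∈ linForms n) (hk : F k = α • F i + d * v) :
    γ k = α * γ i ∧ F k - γ k • Q = α • (F i - γ i • Q) + d * v := by
  refine eq_and_eq_of_not_lowRank h.not_lowRank (h.lowRank_sub k)
    (((h.lowRank_sub i).smul α).add (LowRank.mul hd hv)) (by norm_num) ?_
  rw [add_sub_cancel, hk, smul_sub, smul_smul]
  abel

theorem exists_smul_of_eq_mul (h : IsSimpleFamily F Q V γ u)
    {k : ι} {d v : MvPolynomial (Fin n) ℂ} (hd : d ∈ linForms n)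
    (hv : v ∈ linForms n) (hk : F k = d * v) (h0 : F k ≠ 0) :
    F k = u k * u k ∧ ∃ c : ℂ, c ≠ 0 ∧ u k = c • d := by
  have hsq := h.isSquare_of_lowRank_one (hk ▸ LowRank.mul hd hv)
  refine ⟨hsq, ?_⟩
  have hd0 : d ≠ 0 := by rintro rfl; exact h0 (by rw [hk, zero_mul])
  have h1 : d ∣ u k * u k := by rw [← hsq, hk]; exact dvd_mul_right _ _
  have h2 : d ∣ u k := by
    rcases (prime_of_mem_linForms hd hd0).dvd_or_dvd h1 with h2 | h2 <;> exact h2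
  obtain ⟨c, hc⟩ := eq_smul_of_dvd_linForm hd (h.u_mem k) h2
  refine ⟨c, ?_, hc⟩
  rintro rfl
  exact h0 (by rw [hsq, hc, zero_smul, zero_mul])

theorem ne_zero_of_ne (h : IsSimpleFamily F Q V γ u)
    {i j : ι} (hij : i ≠ j) : F i ≠ 0 := (h.indep i j hij).ne_zero 0

theorem square_not_mem (h : IsSimpleFamily F Q V γ u)
    {k : ι} {W : Submodule ℂ (MvPolynomial (Fin n) ℂ)} (hW : W ≤ linForms n)
    (hk : F k = u k * u k) (huW : u k ∉ W) (h0 : F k ≠ 0) : F k - γ k • Q ∉ W * W := by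
  have hγ : γ k = 0 := h.eq_zero_of_lowRank (l := 1) (by norm_num)
    (hk ▸ LowRank.mul (h.u_mem k) (h.u_mem k))
  rw [hγ, zero_smul, sub_zero]
  intro hmem
  rw [hk] at hmem h0
  exact huW (mem_of_mul_mem hW (h.u_mem k) (h.u_mem k) hmem h0).1

theorem le_line (h : IsSimpleFamily F Q V γ u) {i j : ι} :
    V ≤ supSpan (supSpan V (u i)) (u j) ∧ supSpan V (u i) ≤ supSpan (supSpan V (u i)) (u j) ∧
      supSpan V (u j) ≤ supSpan (supSpan V (u i)) (u j) ∧
      supSpan (supSpan V (u i)) (u j) ≤ linForms n :=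
  ⟨le_sup_left.trans le_sup_left, le_sup_left, sup_le_sup_right le_sup_left _,
    supSpan_le (h.supSpan_le_linForms i) (h.u_mem j)⟩

/-- One of the two factors of a product `c * d` supported on a line avoids both given points. -/
theorem factor_not_mem (h : IsSimpleFamily F Q V γ u)
    {i j : ι} {c d : MvPolynomial (Fin n) ℂ} {α β : ℂ}
    (hi : F i - γ i • Q ∉ V * V) (hj : F j - γ j • Q ∉ V * V)
    (hij : u j ∉ supSpan V (u i)) (hji : u i ∉ supSpan V (u j)) (hα : α ≠ 0) (hβ : β ≠ 0)
    (hc : c ∈ linForms n) (hd : d ∈ linForms n)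
    (hcd : α • (F i - γ i • Q) + β • (F j - γ j • Q) = c * d) :
    (c ∉ supSpan V (u i) ∧ c ∉ supSpan V (u j)) ∨
      (d ∉ supSpan V (u i) ∧ d ∉ supSpan V (u j)) := by
  have key : ∀ (i j : ι) (α β : ℂ) (c d : MvPolynomial (Fin n) ℂ), β ≠ 0 →
      F j - γ j • Q ∉ V * V → u j ∉ supSpan V (u i) →
      α • (F i - γ i • Q) + β • (F j - γ j • Q) = c * d →
      c ∈ supSpan V (u i) → d ∉ supSpan V (u i) := by
    intro i j α β c d hβ hj hij hcd hc hd
    refine hij (mem_of_mul_self_mem h.le_linForms (h.u_mem j) (h.supSpan_le_linForms i)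
      le_sup_left (h.rem_mem j) hj ?_)
    refine (Submodule.smul_mem_iff _ hβ).1 ?_
    rw [eq_sub_of_add_eq' hcd]
    exact sub_mem (Submodule.mul_mem_mul hc hd) (Submodule.smul_mem _ _ (h.rem_mem i))
  have mixed : ∀ (c d : MvPolynomial (Fin n) ℂ), c ∈ linForms n → d ∈ linForms n →
      α • (F i - γ i • Q) + β • (F j - γ j • Q) = c * d →
      c ∈ supSpan V (u i) → d ∉ supSpan V (u j) := by
    intro c d hc hd hcd hci hdj
    have hdi := key i j α β c d hβ hj hij hcd hci
    have hcj : c ∉ supSpan V (u j) := fun hcj =>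
      key j i β α c d hα hi hji (by rw [add_comm]; exact hcd) hcj hdj
    obtain ⟨φ, hφ, hφc⟩ := exists_eval_eq_one (h.supSpan_le_linForms j) hc hcj
    have h1 := congrArg (dirDeriv φ) hcd
    rw [map_add, Derivation.map_smul, Derivation.map_smul,
      dirDeriv_eq_zero (h.supSpan_le_linForms j) hφ (h.rem_mem j), dirDeriv_mul φ hc hd, hφc,
      hφ d hdj, smul_zero, add_zero, zero_smul, zero_add, one_smul] at h1
    exact hdi (h1 ▸ Submodule.smul_mem _ _ (dirDeriv_mem (h.supSpan_le_linForms i) φ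
      (h.rem_mem i)))
  by_contra! hcon
  by_cases hci : c ∈ supSpan V (u i)
  · by_cases hdi : d ∈ supSpan V (u i)
    · exact key i j α β c d hβ hj hij hcd hci hdi
    · exact mixed c d hc hd hcd hci (hcon.2 hdi)
  · have hcj := hcon.1 hci
    by_cases hdi : d ∈ supSpan V (u i)
    · exact mixed d c hd hc (by rw [hcd, mul_comm]) hdi hcj
    · exact key j i β α c d hα hi hji (by rw [add_comm]; exact hcd) hcj (hcon.2 hdi)

/-- The case of two members whose difference is `c * d`, with `d` avoiding both points. -/
theorem exists_isThird_of_combination_eq_mul (h : IsSimpleFamily F Q V γ u)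
    {i j : ι} {c d : MvPolynomial (Fin n) ℂ} {α β : ℂ}
    (hne : i ≠ j) (hγi : γ i ≠ 0) (hα : α ≠ 0) (hβ : β ≠ 0)
    (hc : c ∈ linForms n) (hd : d ∈ linForms n) (hcd : α • F i + β • F j = c * d)
    (hdi : d ∉ supSpan V (u i)) (hdj : d ∉ supSpan V (u j))
    (hdA : d ∈ supSpan (supSpan V (u i)) (u j)) : ∃ k, IsThird F Q V γ u i j k := by
  obtain ⟨hVA, hiA, hjA, hA⟩ := h.le_line (i := i) (j := j)
  have hFj : F j = (-(α / β)) • F i + d * (β⁻¹ • c) := by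
    rw [mul_smul_comm, mul_comm d c, ← hcd, smul_add, smul_smul, smul_smul, inv_mul_cancel₀ hβ,
      ← add_assoc, ← add_smul]
    rw [show -(α / β) + β⁻¹ * α = 0 by field_simp; ring, zero_smul, zero_add, one_smul]
  have hrad := h.prod_mem i j hne
  obtain ⟨k, hk, α', v, hv, hkv⟩ := exists_eq_smul_add_mul_of_prod_mem_radical (h.mem i)
    (h.not_lowRank_two hγi) hd (fun k _ => h.mem k) (α₁ := 1) (v₁ := 0)
    (α₂ := -(α / β)) (v₂ := β⁻¹ • c)
    (by rw [← hFj, one_smul, mul_zero, add_zero]; exact hrad)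
  simp only [Finset.mem_erase, Finset.mem_univ, and_true] at hk
  obtain ⟨hkj, hki⟩ := hk
  have hk0 : F k ≠ 0 := h.ne_zero_of_ne hki
  refine ⟨k, ?_⟩
  rcases eq_or_ne α' 0 with rfl | hα'
  · rw [zero_smul, zero_add] at hkv
    obtain ⟨hsq, t, ht, htd⟩ := h.exists_smul_of_eq_mul hd hv hkv hk0
    refine ⟨htd ▸ Submodule.smul_mem _ _ hdA,
      h.square_not_mem (h.supSpan_le_linForms i) hsq ?_ hk0,
      h.square_not_mem (h.supSpan_le_linForms j) hsq ?_ hk0⟩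
    · rw [htd, Submodule.smul_mem_iff _ ht]; exact hdi
    · rw [htd, Submodule.smul_mem_iff _ ht]; exact hdj
  · obtain ⟨-, hR⟩ := h.eq_smul_add hd hv hkv
    have hnot : F k - γ k • Q ∉ supSpan V (u i) * supSpan V (u i) := by
      intro hmem
      rw [hR, Submodule.add_mem_iff_right _ (Submodule.smul_mem _ _ (h.rem_mem i))] at hmem
      have hv0 := eq_zero_of_mul_mem (h.supSpan_le_linForms i) hd hv hmem hdi
      exact hki (h.eq_of_smul_eq (α := α') (by rw [hkv, hv0, mul_zero, add_zero]))
    refine ⟨?_, hnot, ?_⟩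
    · exact mem_of_eq_smul_add_mul h.le_linForms (h.u_mem k) hA hVA (h.rem_mem k)
        (fun hm => hnot (mul_self_le_supSpan_mul_self V (u i) hm)) (mul_le_mul' hiA hiA (h.rem_mem i)) hdA
        (fun hm => hdi (Submodule.mem_sup_left hm)) hv hR
    · have hFi : F k = (-(α' * β / α)) • F j + d * (v + (α' / α) • c) := by
        have : d * ((α' / α) • c) = α' • F i + (α' * β / α) • F j := by
          rw [mul_smul_comm, mul_comm d c, ← hcd, smul_add, smul_smul, smul_smul,
            div_mul_cancel₀ _ hα, div_mul_eq_mul_div]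
        rw [mul_add, this, hkv, neg_smul]
        abel
      have hv' : v + (α' / α) • c ∈ linForms n := add_mem hv (Submodule.smul_mem _ _ hc)
      obtain ⟨-, hR'⟩ := h.eq_smul_add hd hv' hFi
      intro hmem
      rw [hR', Submodule.add_mem_iff_right _ (Submodule.smul_mem _ _ (h.rem_mem j))] at hmem
      have hv0 := eq_zero_of_mul_mem (h.supSpan_le_linForms j) hd hv' hmem hdj
      exact hkj (h.eq_of_smul_eq (α := -(α' * β / α)) (by rw [hFi, hv0, mul_zero, add_zero]))

theorem eq_smul_add_smul (h : IsSimpleFamily F Q V γ u)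
    {i j k : ι} {α β : ℂ} (hk : F k = α • F i + β • F j) :
    F k - γ k • Q = α • (F i - γ i • Q) + β • (F j - γ j • Q) := by
  refine (eq_and_eq_of_not_lowRank (α := γ k) (β := α * γ i + β * γ j) h.not_lowRank
    (h.lowRank_sub k) (((h.lowRank_sub i).smul α).add ((h.lowRank_sub j).smul β))
    (by norm_num) ?_).2
  rw [add_sub_cancel, hk]
  module

theorem exists_isThird_of_ne_zero (h : IsSimpleFamily F Q V γ u)
    {i j : ι} (hi : F i - γ i • Q ∉ V * V)
    (hj : F j - γ j • Q ∉ V * V) (hij : u j ∉ supSpan V (u i)) (hji : u i ∉ supSpan V (u j))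
    (hγi : γ i ≠ 0) (hγj : γ j ≠ 0) : ∃ k, IsThird F Q V γ u i j k := by
  have hne : i ≠ j := by rintro rfl; exact hij self_mem_supSpan
  obtain ⟨hVA, hiA, hjA, hA⟩ := h.le_line (i := i) (j := j)
  have hRi := mul_le_mul' hiA hiA (h.rem_mem i)
  have hRj := mul_le_mul' hjA hjA (h.rem_mem j)
  obtain ⟨α, β, hα, hβ, hlow | ⟨k, -, -, hk⟩⟩ := h.exists_combination hne
    (h.not_lowRank_two hγi) (fun hl => h.not_lowRank_two hγj (hl.mono (by norm_num)))
  · obtain ⟨c, hc, d, hd, hcd⟩ := hlow.exists_eq_mul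
    have hR : α • (F i - γ i • Q) + β • (F j - γ j • Q) = c * d := by
      refine (eq_and_eq_of_not_lowRank (α := α * γ i + β * γ j) (β := 0) h.not_lowRank
        (((h.lowRank_sub i).smul α).add ((h.lowRank_sub j).smul β)) (LowRank.mul hc hd)
        (by norm_num) ?_).2
      rw [← hcd]
      module
    have hcd0 : c * d ≠ 0 := by
      rw [← hcd]
      intro h0
      exact hα (LinearIndependent.pair_iff.1 (h.indep i j hne) α β h0).1
    have hmem : c * d ∈ supSpan (supSpan V (u i)) (u j) * supSpan (supSpan V (u i)) (u j) := by
      rw [← hR]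
      exact add_mem (Submodule.smul_mem _ _ hRi) (Submodule.smul_mem _ _ hRj)
    obtain ⟨hcA, hdA⟩ := mem_of_mul_mem hA hc hd hmem hcd0
    rcases h.factor_not_mem hi hj hij hji hα hβ hc hd hR with ⟨h1, h2⟩ | ⟨h1, h2⟩
    · exact h.exists_isThird_of_combination_eq_mul hne hγi hα hβ hd hc
        (by rw [hcd, mul_comm]) h1 h2 hcA
    · exact h.exists_isThird_of_combination_eq_mul hne hγi hα hβ hc hd hcd h1 h2 hdA
  · have hR := h.eq_smul_add_smul hk
    have hnot : F k - γ k • Q ∉ supSpan V (u i) * supSpan V (u i) := by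
      intro hmem
      rw [hR, Submodule.add_mem_iff_right _ (Submodule.smul_mem _ _ (h.rem_mem i)),
        Submodule.smul_mem_iff _ hβ] at hmem
      exact hij (mem_of_mul_self_mem h.le_linForms (h.u_mem j) (h.supSpan_le_linForms i)
        le_sup_left (h.rem_mem j) hj hmem)
    refine ⟨k, ?_, hnot, ?_⟩
    · refine mem_of_mul_self_mem h.le_linForms (h.u_mem k) hA hVA (h.rem_mem k)
        (fun hm => hnot (mul_self_le_supSpan_mul_self V (u i) hm)) ?_
      rw [hR]
      exact add_mem (Submodule.smul_mem _ _ hRi) (Submodule.smul_mem _ _ hRj)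
    · intro hmem
      rw [hR, Submodule.add_mem_iff_left _ (Submodule.smul_mem _ _ (h.rem_mem j)),
        Submodule.smul_mem_iff _ hα] at hmem
      exact hji (mem_of_mul_self_mem h.le_linForms (h.u_mem i) (h.supSpan_le_linForms j)
        le_sup_left (h.rem_mem i) hi hmem)

theorem exists_isThird_of_square (h : IsSimpleFamily F Q V γ u)
    {i j : ι} (hj : F j - γ j • Q ∉ V * V)
    (hij : u j ∉ supSpan V (u i)) (hji : u i ∉ supSpan V (u j))
    (hsq : F i = u i * u i) (hγj : γ j ≠ 0) : ∃ k, IsThird F Q V γ u i j k := by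
  have hne : i ≠ j := by rintro rfl; exact hij self_mem_supSpan
  obtain ⟨hVA, hiA, hjA, hA⟩ := h.le_line (i := i) (j := j)
  have hui := h.u_mem i
  obtain ⟨k, hk, α, v, hv, hkv⟩ := exists_eq_smul_add_mul_of_prod_mem_radical (h.mem j)
    (h.not_lowRank_two hγj) hui (fun k _ => h.mem k) (α₁ := 0) (v₁ := u i) (α₂ := 1) (v₂ := 0)
    (by rw [← hsq, zero_smul, zero_add, one_smul, mul_zero, add_zero]; exact h.prod_mem i j hne)
  simp only [Finset.mem_erase, Finset.mem_univ, and_true] at hk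
  obtain ⟨hkj, hki⟩ := hk
  have hα : α ≠ 0 := by
    rintro rfl
    rw [zero_smul, zero_add] at hkv
    obtain ⟨hk2, t, -, ht⟩ := h.exists_smul_of_eq_mul hui hv hkv (h.ne_zero_of_ne hki)
    refine hki (h.eq_of_smul_eq (α := t * t) ?_)
    rw [hk2, ht, hsq, smul_mul_smul_comm]
  obtain ⟨-, hR⟩ := h.eq_smul_add hui hv hkv
  have hnot : F k - γ k • Q ∉ supSpan V (u j) * supSpan V (u j) := by
    intro hmem
    rw [hR, Submodule.add_mem_iff_right _ (Submodule.smul_mem _ _ (h.rem_mem j))] at hmem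
    have hv0 := eq_zero_of_mul_mem (h.supSpan_le_linForms j) hui hv hmem hji
    exact hkj (h.eq_of_smul_eq (α := α) (by rw [hkv, hv0, mul_zero, add_zero]))
  refine ⟨k, ?_, ?_, hnot⟩
  · exact mem_of_eq_smul_add_mul h.le_linForms (h.u_mem k) hA hVA (h.rem_mem k)
      (fun hm => hnot (mul_self_le_supSpan_mul_self V (u j) hm)) (mul_le_mul' hjA hjA (h.rem_mem j))
      (hiA self_mem_supSpan) (fun hm => hji (Submodule.mem_sup_left hm)) hv hR
  · intro hmem
    by_cases hvi : v ∈ supSpan V (u i)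
    · rw [hR, Submodule.add_mem_iff_left _ (Submodule.mul_mem_mul self_mem_supSpan hvi),
        Submodule.smul_mem_iff _ hα] at hmem
      exact hij (mem_of_mul_self_mem h.le_linForms (h.u_mem j) (h.supSpan_le_linForms i)
        le_sup_left (h.rem_mem j) hj hmem)
    · obtain ⟨φ, hφ, hφv⟩ := exists_eval_eq_one (h.supSpan_le_linForms i) hv hvi
      have h1 := dirDeriv_eq_zero (h.supSpan_le_linForms i) hφ hmem
      rw [hR, map_add, Derivation.map_smul, dirDeriv_mul φ hui hv, hφv,
        hφ _ self_mem_supSpan, zero_smul, add_zero, one_smul] at h1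
      refine hji ?_
      rw [eq_neg_of_add_eq_zero_right h1]
      exact neg_mem (Submodule.smul_mem _ _ (dirDeriv_mem (h.supSpan_le_linForms j) φ
        (h.rem_mem j)))

theorem exists_isThird_of_square_of_square (h : IsSimpleFamily F Q V γ u) {i j : ι}
    (hij : u j ∉ supSpan V (u i)) (hji : u i ∉ supSpan V (u j))
    (hi : F i = u i * u i) (hj : F j = u j * u j) : ∃ k, IsThird F Q V γ u i j k := by
  have hne : i ≠ j := by rintro rfl; exact hij self_mem_supSpan
  have hui := h.u_mem i
  have huj := h.u_mem j
  obtain ⟨k, hk, hkm⟩ := exists_mem_span_mul_of_prod_mem_radical hui huj (fun k _ => h.mem k)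
    (by rw [sq, sq, ← hi, ← hj]; exact h.prod_mem i j hne)
  simp only [Finset.mem_erase, Finset.mem_univ, and_true] at hk
  obtain ⟨hkj, hki⟩ := hk
  have hk0 : F k ≠ 0 := h.ne_zero_of_ne hki
  have hU : Submodule.span ℂ {u i, u j} ≤ linForms n := by
    rw [Submodule.span_le]
    rintro x (rfl | rfl)
    exacts [hui, huj]
  have hγk : γ k = 0 := h.eq_zero_of_lowRank (l := 2) (by norm_num)
    (lowRank_of_mem_mul hU (finrank_span_pair_le _ _) hkm)
  rcases h.trichotomy k with h1 | h1 | h1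
  · exact absurd hγk h1
  · obtain ⟨-, hsq⟩ := h1
    have huk : u k ∈ Submodule.span ℂ {u i, u j} := by
      obtain ⟨κ, hκ⟩ := exists_isKill hU
      refine hκ.mem_of_eq_zero (h.u_mem k) ?_
      have := hκ.eq_zero_of_mem_mul hkm
      rwa [hsq, map_mul, mul_self_eq_zero] at this
    obtain ⟨x, y, hxy⟩ := Submodule.mem_span_pair.1 huk
    refine ⟨k, ?_, h.square_not_mem (h.supSpan_le_linForms i) hsq ?_ hk0,
      h.square_not_mem (h.supSpan_le_linForms j) hsq ?_ hk0⟩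
    · rw [← hxy]
      exact add_mem (Submodule.smul_mem _ _ (Submodule.mem_sup_left self_mem_supSpan))
        (Submodule.smul_mem _ _ self_mem_supSpan)
    · intro hmem
      rw [← hxy, Submodule.add_mem_iff_right _ (Submodule.smul_mem _ _ self_mem_supSpan)] at hmem
      rcases eq_or_ne y 0 with rfl | hy
      · refine hki (h.eq_of_smul_eq (α := x * x) ?_)
        rw [hsq, hi, ← hxy, zero_smul, add_zero, smul_mul_smul_comm]
      · exact hij ((Submodule.smul_mem_iff _ hy).1 hmem)
    · intro hmem
      rw [← hxy, Submodule.add_mem_iff_left _ (Submodule.smul_mem _ _ self_mem_supSpan)] at hmem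
      rcases eq_or_ne x 0 with rfl | hx
      · refine hkj (h.eq_of_smul_eq (α := y * y) ?_)
        rw [hsq, hj, ← hxy, zero_smul, zero_add, smul_mul_smul_comm]
      · exact hji ((Submodule.smul_mem_iff _ hx).1 hmem)
  · exfalso
    obtain ⟨-, hirr, -⟩ := h1
    rw [Submodule.span_insert, Submodule.sup_mul, Submodule.mem_sup] at hkm
    obtain ⟨f, hf, g, hg, hfg⟩ := hkm
    rw [Submodule.mem_span_singleton_mul] at hf hg
    obtain ⟨s, hs, rfl⟩ := hf
    obtain ⟨t, ht, rfl⟩ := hg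
    have hmem := h.rem_mem k
    rw [hγk, zero_smul, sub_zero, ← hfg] at hmem
    rcases mem_or_lowRank_of_mul_add_mul_mem (h.supSpan_le_linForms k) hui hs huj ht hmem with
      ⟨h1, -, h2, -⟩ | hlow
    · have h3 := mem_supSpan_exchange h1 (fun hm => hji (Submodule.mem_sup_left hm))
      exact hij (supSpan_le le_sup_left h3 h2)
    · exact hirr (hfg ▸ hlow)

theorem exists_isThird_of_square_or_ne_zero (h : IsSimpleFamily F Q V γ u)
    {i j : ι} (hi : F i - γ i • Q ∉ V * V)
    (hj : F j - γ j • Q ∉ V * V) (hij : u j ∉ supSpan V (u i)) (hji : u i ∉ supSpan V (u j))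
    (hi' : γ i ≠ 0 ∨ F i = u i * u i) (hj' : γ j ≠ 0 ∨ F j = u j * u j) :
    ∃ k, IsThird F Q V γ u i j k := by
  rcases hi' with hi' | hi' <;> rcases hj' with hj' | hj'
  · exact h.exists_isThird_of_ne_zero hi hj hij hji hi' hj'
  · obtain ⟨k, hk⟩ := h.exists_isThird_of_square hi hji hij hj' hi'
    exact ⟨k, hk.symm⟩
  · exact h.exists_isThird_of_square hj hij hji hi' hj'
  · exact h.exists_isThird_of_square_of_square hij hji hi' hj'

theorem exists_representative (h : IsSimpleFamily F Q V γ u) {i : ι} (hi : F i - γ i • Q ∉ V * V) :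
    ∃ i', (γ i' ≠ 0 ∨ F i' = u i' * u i') ∧ F i' - γ i' • Q ∉ V * V ∧
      supSpan V (u i') = supSpan V (u i) := by
  rcases h.trichotomy i with h1 | h1 | ⟨h0, -, i', hi', β, hβ, hR⟩
  · exact ⟨i, Or.inl h1, hi, rfl⟩
  · exact ⟨i, Or.inr h1.2, hi, rfl⟩
  · have hR' : F i' - γ i' • Q = β • (F i - γ i • Q) := by rw [hR, h0, zero_smul, sub_zero]
    have hnot : F i' - γ i' • Q ∉ V * V := by rwa [hR', Submodule.smul_mem_iff _ hβ]
    refine ⟨i', Or.inl hi', hnot, le_antisymm (supSpan_le le_sup_left ?_)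
      (supSpan_le le_sup_left ?_)⟩
    · refine mem_of_mul_self_mem h.le_linForms (h.u_mem i') (h.supSpan_le_linForms i)
        le_sup_left (h.rem_mem i') hnot ?_
      rw [hR']
      exact Submodule.smul_mem _ _ (h.rem_mem i)
    · refine mem_of_mul_self_mem h.le_linForms (h.u_mem i) (h.supSpan_le_linForms i')
        le_sup_left (h.rem_mem i) hi ?_
      rw [← Submodule.smul_mem_iff _ hβ, ← hR']
      exact h.rem_mem i'

theorem exists_isThird (h : IsSimpleFamily F Q V γ u) {i j : ι} (hi : F i - γ i • Q ∉ V * V)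
    (hj : F j - γ j • Q ∉ V * V) (hij : u j ∉ supSpan V (u i)) (hji : u i ∉ supSpan V (u j)) :
    ∃ k, IsThird F Q V γ u i j k := by
  obtain ⟨i', hi1, hi2, hi3⟩ := h.exists_representative hi
  obtain ⟨j', hj1, hj2, hj3⟩ := h.exists_representative hj
  have key : ∀ {x y z : ι}, supSpan V (u x) = supSpan V (u y) →
      u y ∉ supSpan V (u z) → u x ∉ supSpan V (u z) := fun {x y z} he hy hx =>
    hy (supSpan_le le_sup_left hx (he ▸ self_mem_supSpan))
  obtain ⟨k, hk1, hk2, hk3⟩ := h.exists_isThird_of_square_or_ne_zero hi2 hj2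
    (by rw [hi3]; exact key hj3 hij) (by rw [hj3]; exact key hi3 hji) hi1 hj1
  refine ⟨k, ?_, hi3 ▸ hk2, hj3 ▸ hk3⟩
  rw [hi3] at hk1
  refine supSpan_le le_sup_left ?_ hk1
  exact (h.le_line (i := i) (j := j)).2.2.1 (hj3 ▸ self_mem_supSpan)

end IsSimpleFamily

end SimpleFamily

section Dimension

variable {n : ℕ}

theorem finrank_le_add_finrank_map_mkQ {E : Type*} [AddCommGroup E] [Module ℂ E]
    (V W : Submodule ℂ E) [FiniteDimensional ℂ V] [FiniteDimensional ℂ W] :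
    Module.finrank ℂ W ≤ Module.finrank ℂ V + Module.finrank ℂ (W.map V.mkQ) := by
  have h := LinearMap.finrank_range_add_finrank_ker (V.mkQ.domRestrict W)
  rw [LinearMap.range_domRestrict] at h
  have hker : Module.finrank ℂ (V.mkQ.domRestrict W).ker ≤ Module.finrank ℂ V := by
    refine LinearMap.finrank_le_finrank_of_injective
      (f := (W.subtype.comp (V.mkQ.domRestrict W).ker.subtype).codRestrict V fun x => ?_) ?_
    · have := x.2
      rw [LinearMap.mem_ker, LinearMap.domRestrict_apply, Submodule.mkQ_apply,
        Submodule.Quotient.mk_eq_zero] at this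
      exact this
    · intro x y hxy
      have h1 : ((x : W) : E) = ((y : W) : E) := congrArg V.subtype hxy
      exact Subtype.ext (Subtype.ext h1)
  omega

theorem finrank_mul_self_le (W : Submodule ℂ (MvPolynomial (Fin n) ℂ)) [FiniteDimensional ℂ W] :
    FiniteDimensional ℂ ↥(W * W) ∧
      Module.finrank ℂ ↥(W * W) ≤ Module.finrank ℂ W * Module.finrank ℂ W := by
  set b := Module.finBasis ℂ W
  set g : Fin (Module.finrank ℂ W) × Fin (Module.finrank ℂ W) → MvPolynomial (Fin n) ℂ :=
    fun p => b p.1 * b p.2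
  have hW : W = Submodule.span ℂ (Set.range fun i => (b i : MvPolynomial (Fin n) ℂ)) := by
    have := congrArg (Submodule.map W.subtype) b.span_eq
    rw [Submodule.map_span, Submodule.map_top, Submodule.range_subtype, ← Set.range_comp] at this
    exact this.symm
  have hle : W * W = Submodule.span ℂ (Set.range g) := by
    conv_lhs => rw [hW]
    rw [Submodule.span_mul_span, ← Set.image2_mul, Set.image2_range]
  rw [hle]
  refine ⟨FiniteDimensional.span_of_finite ℂ (Set.finite_range g), ?_⟩
  refine (finrank_range_le_card g).trans ?_
  simp

theorem mkQ_mem_span_singleton_iff {V : Submodule ℂ (MvPolynomial (Fin n) ℂ)}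
    {x u : MvPolynomial (Fin n) ℂ} :
    V.mkQ x ∈ Submodule.span ℂ {V.mkQ u} ↔ x ∈ supSpan V u := by
  rw [supSpan, ← Submodule.comap_map_mkQ, Submodule.mem_comap, Submodule.map_span,
    Set.image_singleton]

theorem IsSimpleFamily.finrank_span_le {ι : Type*} [Fintype ι] [DecidableEq ι]
    {F : ι → MvPolynomial (Fin n) ℂ} {Q : MvPolynomial (Fin n) ℂ}
    {V : Submodule ℂ (MvPolynomial (Fin n) ℂ)} {γ : ι → ℂ} {u : ι → MvPolynomial (Fin n) ℂ}
    (h : IsSimpleFamily F Q V γ u) :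
    Module.finrank ℂ (Submodule.span ℂ (Set.range F)) ≤ 50 := by
  let K := {k // F k - γ k • Q ∉ V * V}
  let w : K → MvPolynomial (Fin n) ℂ ⧸ V := fun k => V.mkQ (u k.1)
  have hSG : ∀ i j, LinearIndependent ℂ ![w i, w j] → ∃ k, w k ∈ Submodule.span ℂ {w i, w j} ∧
      w k ∉ Submodule.span ℂ {w i} ∧ w k ∉ Submodule.span ℂ {w j} := by
    intro i j hij
    have h1 : u j.1 ∉ supSpan V (u i.1) := by
      rw [← mkQ_mem_span_singleton_iff, Submodule.mem_span_singleton]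
      rintro ⟨c, hc⟩
      have := (LinearIndependent.pair_iff.1 hij c (-1) (by simp only [w, ← hc]; module)).2
      norm_num at this
    have h2 : u i.1 ∉ supSpan V (u j.1) := by
      rw [← mkQ_mem_span_singleton_iff, Submodule.mem_span_singleton]
      rintro ⟨c, hc⟩
      have := (LinearIndependent.pair_iff.1 hij (-1) c (by simp only [w, ← hc]; module)).1
      norm_num at this
    obtain ⟨k, hk1, hk2, hk3⟩ := h.exists_isThird i.2 j.2 h1 h2
    have hkK : F k - γ k • Q ∉ V * V := fun hm =>
      hk2 (mul_self_le_supSpan_mul_self V (u i.1) hm)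
    have key : ∀ l : K, F k - γ k • Q ∉ supSpan V (u l.1) * supSpan V (u l.1) →
        w ⟨k, hkK⟩ ∉ Submodule.span ℂ {w l} := by
      intro l hl hm
      rw [mkQ_mem_span_singleton_iff] at hm
      have hle := supSpan_le le_sup_left hm
      exact hl (mul_le_mul' hle hle (h.rem_mem k))
    refine ⟨⟨k, hkK⟩, ?_, key i hk2, key j hk3⟩
    have : u k ∈ V ⊔ Submodule.span ℂ {u i.1, u j.1} := by
      rw [Submodule.span_insert, ← sup_assoc]
      exact hk1
    rw [← Submodule.comap_map_mkQ, Submodule.mem_comap, Submodule.map_span,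
      Set.image_pair] at this
    exact this
  have hw := finrank_span_range_le_three w hSG
  set W := V ⊔ Submodule.span ℂ (Set.range fun k : K => u k.1) with hWdef
  have hWH : W ≤ linForms n := by
    refine sup_le h.le_linForms (Submodule.span_le.2 ?_)
    rintro _ ⟨k, rfl⟩
    exact h.u_mem k.1
  have := finiteDimensional_of_le_linForms hWH
  have := finiteDimensional_of_le_linForms h.le_linForms
  have hmap : W.map V.mkQ = Submodule.span ℂ (Set.range w) := by
    rw [hWdef, Submodule.map_sup, Submodule.mkQ_map_self, bot_sup_eq, Submodule.map_span,
      ← Set.range_comp]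
    rfl
  have hW7 : Module.finrank ℂ W ≤ 7 := by
    have h1 := finrank_le_add_finrank_map_mkQ V W
    rw [hmap] at h1
    have := h.finrank_le
    omega
  obtain ⟨hfd, hWW⟩ := finrank_mul_self_le W
  have hle : Submodule.span ℂ (Set.range F) ≤ Submodule.span ℂ {Q} ⊔ W * W := by
    rw [Submodule.span_le]
    rintro _ ⟨k, rfl⟩
    have hR : F k - γ k • Q ∈ W * W := by
      by_cases hk : F k - γ k • Q ∈ V * V
      · have hS : V ≤ W := le_sup_left
        exact mul_le_mul' hS hS hk
      · have hS : supSpan V (u k) ≤ W := supSpan_le le_sup_left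
          (Submodule.mem_sup_right (Submodule.subset_span ⟨⟨k, hk⟩, rfl⟩))
        exact mul_le_mul' hS hS (h.rem_mem k)
    have := Submodule.add_mem_sup (Submodule.smul_mem _ (γ k)
      (Submodule.mem_span_singleton_self Q)) hR
    rwa [add_sub_cancel] at this
  have h49 : Module.finrank ℂ W * Module.finrank ℂ W ≤ 7 * 7 := Nat.mul_le_mul hW7 hW7
  have h1 := Submodule.finrank_mono hle
  have h2 := Submodule.finrank_add_le_finrank_add_finrank (Submodule.span ℂ {Q}) (W * W)
  have h3 := finrank_span_singleton_le Q
  omega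

end Dimension

section Simple

variable {n : ℕ} {Q G G' T : MvPolynomial (Fin n) ℂ} {V : Submodule ℂ (MvPolynomial (Fin n) ℂ)}

/-- Modulo multiples of `Q`, the quadratic `G` only involves forms of `V` and one further form. -/
def IsSimple (Q : MvPolynomial (Fin n) ℂ) (V : Submodule ℂ (MvPolynomial (Fin n) ℂ))
    (G : MvPolynomial (Fin n) ℂ) : Prop :=
  ∃ γ : ℂ, ∃ u ∈ linForms n, G - γ • Q ∈ supSpan V u * supSpan V u

theorem IsSimple.of_smul_eq {β δ : ℂ} (hβ : β ≠ 0) (hG : IsSimple Q V G) (hT : T ∈ V * V)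
    (h : β • G' = G + δ • Q + T) : IsSimple Q V G' := by
  obtain ⟨γ, u, hu, hR⟩ := hG
  refine ⟨β⁻¹ * (γ + δ), u, hu, (Submodule.smul_mem_iff _ hβ).1 ?_⟩
  rw [smul_sub, h, smul_smul, mul_inv_cancel_left₀ hβ,
    show G + δ • Q + T - (γ + δ) • Q = (G - γ • Q) + T by module]
  exact add_mem hR (mul_self_le_supSpan_mul_self V u hT)

theorem isSimple_zero : IsSimple Q V 0 :=
  ⟨0, 0, zero_mem _, by rw [zero_smul, sub_zero]; exact zero_mem _⟩

theorem isSimple_of_eq_smul_add {γ : ℂ} (hT : T ∈ V * V) (h : G = γ • Q + T) : IsSimple Q V G :=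
  IsSimple.of_smul_eq one_ne_zero isSimple_zero hT (by rw [one_smul, zero_add, h])

theorem isSimple_square {l : MvPolynomial (Fin n) ℂ} (hl : l ∈ linForms n) :
    IsSimple Q V (l ^ 2) :=
  ⟨0, l, hl, by
    rw [zero_smul, sub_zero, sq]
    exact Submodule.mul_mem_mul self_mem_supSpan self_mem_supSpan⟩

/-- If `γ • Q + T + c * d` is not simple, then `c` and `d` are independent modulo `V`. -/
theorem not_mem_of_not_isSimple {γ : ℂ} {c d : MvPolynomial (Fin n) ℂ} (hc : c ∈ linForms n)
    (hd : d ∈ linForms n) (hT : T ∈ V * V) (h : G = γ • Q + T + c * d) (hG : ¬ IsSimple Q V G) :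
    c ∉ supSpan V d ∧ d ∉ supSpan V c := by
  have hR : G - γ • Q = T + c * d := by rw [h]; abel
  constructor
  · refine fun hm => hG ⟨γ, d, hd, ?_⟩
    rw [hR]
    exact add_mem (mul_self_le_supSpan_mul_self V d hT) (Submodule.mul_mem_mul hm self_mem_supSpan)
  · refine fun hm => hG ⟨γ, c, hc, ?_⟩
    rw [hR]
    exact add_mem (mul_self_le_supSpan_mul_self V c hT) (Submodule.mul_mem_mul self_mem_supSpan hm)

end Simple

section QoSet

variable {n m₁ m₂ r : ℕ} {Qo : MvPolynomial (Fin n) ℂ} {Qs a b : Fin m₁ → MvPolynomial (Fin n) ℂ}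
  {Ps : Fin m₂ → MvPolynomial (Fin n) ℂ} {ls : Fin r → MvPolynomial (Fin n) ℂ}
  {V : Submodule ℂ (MvPolynomial (Fin n) ℂ)}

/-- The properties of a `(Q_o,m₁,m₂)`-set of high rank, with chosen `Q_j = Q_o + a_j * b_j`. -/
structure IsQoData (Qo : MvPolynomial (Fin n) ℂ) (Qs a b : Fin m₁ → MvPolynomial (Fin n) ℂ)
    (Ps : Fin m₂ → MvPolynomial (Fin n) ℂ) (ls : Fin r → MvPolynomial (Fin n) ℂ) : Prop
    extends IsRadicalFamily (QoFam Qo Qs Ps ls) where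
  not_lowRank : ¬ LowRank 20 Qo
  Ps_not_lowRank : ∀ i, ¬ LowRank 1 (Ps i)
  ls_mem : ∀ t, ls t ∈ linForms n
  card_lt : 5 * m₂ + 2 < m₁
  a_mem : ∀ j, a j ∈ linForms n
  b_mem : ∀ j, b j ∈ linForms n
  Qs_eq : ∀ j, Qs j = Qo + a j * b j
  combination_not_lowRank : ∀ i, ∀ α β : ℂ, ¬(α = 0 ∧ β = 0) → ¬ LowRank 1 (α • Ps i + β • Qo)

namespace IsQoData

theorem Qs_not_lowRank_two (h : IsQoData Qo Qs a b Ps ls) (j : Fin m₁) : ¬ LowRank 2 (Qs j) := by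
  intro hl
  refine h.not_lowRank ?_
  have := hl.sub (LowRank.mul (h.a_mem j) (h.b_mem j))
  rw [h.Qs_eq j, add_sub_cancel_right] at this
  exact this.mono (by norm_num)

theorem Qs_not_lowRank (h : IsQoData Qo Qs a b Ps ls) (j : Fin m₁) : ¬ LowRank 1 (Qs j) := fun hl =>
  h.Qs_not_lowRank_two j (hl.mono (by norm_num))

theorem Qs_injective (h : IsQoData Qo Qs a b Ps ls)
    {j j' : Fin m₁} {α : ℂ} (hj : Qs j = α • Qs j') : j = j' := by
  have : (Sum.inr (Sum.inl j) : Unit ⊕ Fin m₁ ⊕ Fin m₂ ⊕ Fin r) = Sum.inr (Sum.inl j') :=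
    h.eq_of_smul_eq (α := α) hj
  simpa using this

theorem mul_ne_zero (h : IsQoData Qo Qs a b Ps ls) (j : Fin m₁) : a j * b j ≠ 0 := by
  intro h0
  have : (Sum.inr (Sum.inl j) : Unit ⊕ Fin m₁ ⊕ Fin m₂ ⊕ Fin r) = Sum.inl () :=
    h.eq_of_smul_eq (α := 1) (by
      change Qs j = (1 : ℂ) • Qo
      rw [h.Qs_eq j, h0, add_zero, one_smul])
  simp at this

/-- Every member other than the `P_i` is a multiple of `Q_o` plus a product of linear forms. -/
theorem eq_smul_add_mul_or (h : IsQoData Qo Qs a b Ps ls) (k : Unit ⊕ Fin m₁ ⊕ Fin m₂ ⊕ Fin r) :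
    (∃ ε : ℂ, ∃ c ∈ linForms n, ∃ d ∈ linForms n, QoFam Qo Qs Ps ls k = ε • Qo + c * d) ∨
      ∃ i, k = Sum.inr (Sum.inr (Sum.inl i)) := by
  rcases k with ⟨⟩ | j | i | t
  · exact Or.inl ⟨1, 0, zero_mem _, 0, zero_mem _, by
      change Qo = _
      rw [one_smul, zero_mul, add_zero]⟩
  · exact Or.inl ⟨1, a j, h.a_mem j, b j, h.b_mem j, by rw [one_smul]; exact h.Qs_eq j⟩
  · exact Or.inr ⟨i, rfl⟩
  · exact Or.inl ⟨0, ls t, h.ls_mem t, ls t, h.ls_mem t, by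
      change ls t ^ 2 = _
      rw [zero_smul, zero_add, sq]⟩

theorem exists_combination_Qs (h : IsQoData Qo Qs a b Ps ls)
    (j : Fin m₁) {x : Unit ⊕ Fin m₁ ⊕ Fin m₂ ⊕ Fin r}
    (hx : x ≠ Sum.inr (Sum.inl j)) (hlow : ¬ LowRank 1 (QoFam Qo Qs Ps ls x)) :
    ∃ α β : ℂ, α ≠ 0 ∧ β ≠ 0 ∧
      ((∃ ε : ℂ, ∃ c ∈ linForms n, ∃ d ∈ linForms n,
          α • Qs j + β • QoFam Qo Qs Ps ls x = ε • Qo + c * d) ∨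
        ∃ i, Ps i = α • Qs j + β • QoFam Qo Qs Ps ls x) := by
  obtain ⟨α, β, hα, hβ, hr | ⟨k, -, -, hk⟩⟩ :=
    h.exists_combination (i := Sum.inr (Sum.inl j)) hx.symm (h.Qs_not_lowRank_two j) hlow
  · obtain ⟨c, hc, d, hd, hcd⟩ := hr.exists_eq_mul
    exact ⟨α, β, hα, hβ, Or.inl ⟨0, c, hc, d, hd, by rw [zero_smul, zero_add]; exact hcd⟩⟩
  · refine ⟨α, β, hα, hβ, ?_⟩
    rcases h.eq_smul_add_mul_or k with ⟨ε, c, hc, d, hd, hcd⟩ | ⟨i, rfl⟩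
    · exact Or.inl ⟨ε, c, hc, d, hd, by rw [← hcd, hk]; rfl⟩
    · exact Or.inr ⟨i, hk⟩

theorem exists_isSimple_of_isEmpty (h : IsQoData Qo Qs a b Ps ls) (hm : m₂ = 0) :
    ∃ V ≤ linForms n, Module.finrank ℂ V ≤ 4 ∧ (∀ j, IsSimple Qo V (Qs j)) ∧
      ∀ i, IsSimple Qo V (Ps i) := by
  subst hm
  have hm₁ := h.card_lt
  let j₀ : Fin m₁ := ⟨0, by omega⟩
  have hV : Submodule.span ℂ {a j₀, b j₀} ≤ linForms n := by
    rw [Submodule.span_le]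
    rintro x (rfl | rfl)
    exacts [h.a_mem j₀, h.b_mem j₀]
  set V := Submodule.span ℂ {a j₀, b j₀}
  have hab : a j₀ * b j₀ ∈ V * V :=
    Submodule.mul_mem_mul (Submodule.subset_span (by simp)) (Submodule.subset_span (by simp))
  refine ⟨V, hV, (finrank_span_pair_le _ _).trans (by norm_num), fun e => ?_, fun i => i.elim0⟩
  by_contra hs
  have he : e ≠ j₀ := by
    rintro rfl
    exact hs (isSimple_of_eq_smul_add hab (by rw [one_smul]; exact h.Qs_eq _))
  obtain ⟨h1, h2⟩ := not_mem_of_not_isSimple (γ := 1) (h.a_mem e) (h.b_mem e)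
    (zero_mem (V * V)) (by rw [one_smul, add_zero]; exact h.Qs_eq e) hs
  obtain ⟨α, β, hα, hβ, ⟨ε, c, hc, d, hd, hcd⟩ | ⟨i, -⟩⟩ :=
    h.exists_combination_Qs j₀ (x := Sum.inr (Sum.inl e)) (by simpa using he) (h.Qs_not_lowRank e)
  swap
  · exact i.elim0
  change α • Qs j₀ + β • Qs e = _ at hcd
  have hR : α • (a j₀ * b j₀) + β • (a e * b e) = c * d := by
    refine (eq_and_eq_of_not_lowRank (α := α + β) (β := ε) h.not_lowRank
      (((LowRank.mul (h.a_mem j₀) (h.b_mem j₀)).smul α).add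
        ((LowRank.mul (h.a_mem e) (h.b_mem e)).smul β)) (LowRank.mul hc hd) (by norm_num) ?_).2
    rw [← hcd, h.Qs_eq j₀, h.Qs_eq e]
    module
  have hR' : a e * b e - (β⁻¹ • c) * d = -(β⁻¹ * α) • (a j₀ * b j₀) := by
    rw [smul_mul_assoc, ← hR, smul_add, smul_smul, smul_smul, inv_mul_cancel₀ hβ]
    module
  have heq := mul_eq_mul_of_sub_mem hV (h.a_mem e) (h.b_mem e) (Submodule.smul_mem _ _ hc) hd
    (by rw [hR']; exact Submodule.smul_mem _ _ hab) h1 h2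
  rw [heq, sub_self] at hR'
  rcases smul_eq_zero.1 hR'.symm with h3 | h3
  · exact _root_.mul_ne_zero (inv_ne_zero hβ) hα (neg_eq_zero.1 h3)
  · exact h.mul_ne_zero j₀ h3

/-- If `a_j, b_j ∈ V` for all `j` outside a set of size at most `m₂`, then every `Q_j` and every
`P_i` is simple with respect to `V`. -/
theorem isSimple_of_card_le (h : IsQoData Qo Qs a b Ps ls)
    (hV : V ≤ linForms n) (bad : Finset (Fin m₁)) (hbad : bad.card ≤ m₂)
    (hgood : ∀ j ∉ bad, a j * b j ∈ V * V) {x : Unit ⊕ Fin m₁ ⊕ Fin m₂ ⊕ Fin r}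
    (hlow : ¬ LowRank 1 (QoFam Qo Qs Ps ls x)) : IsSimple Qo V (QoFam Qo Qs Ps ls x) := by
  classical
  by_contra hs
  set F := QoFam Qo Qs Ps ls with hF
  have hQsimple : ∀ j ∉ bad, IsSimple Qo V (Qs j) := fun j hj =>
    isSimple_of_eq_smul_add (hgood j hj) (by rw [one_smul]; exact h.Qs_eq j)
  set N : Finset (Unit ⊕ Fin m₁ ⊕ Fin m₂ ⊕ Fin r) :=
    Finset.univ.filter fun k => ¬ IsSimple Qo V (F k) with hN
  have hNcard : N.card ≤ m₂ + m₂ := by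
    have hsub : N ⊆ (bad.image fun j => Sum.inr (Sum.inl j)) ∪
        (Finset.univ.image fun i : Fin m₂ => Sum.inr (Sum.inr (Sum.inl i))) := by
      intro k hk
      have hk' := (Finset.mem_filter.1 hk).2
      rcases k with ⟨⟩ | j | i | t
      · exact absurd (isSimple_of_eq_smul_add (γ := 1) (zero_mem (V * V))
          (by rw [one_smul, add_zero]; rfl)) hk'
      · have : j ∈ bad := by_contra fun hj => hk' (hQsimple j hj)
        simp [this]
      · simp
      · exact absurd (isSimple_square (h.ls_mem t)) hk'
    refine (Finset.card_le_card hsub).trans ((Finset.card_union_le _ _).trans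
      (add_le_add (Finset.card_image_le.trans hbad) (Finset.card_image_le.trans ?_)))
    simp
  let E : Fin m₁ → Prop := fun j =>
    ∃ δ : ℂ, ∃ c ∈ linForms n, ∃ d ∈ linForms n, F x = δ • Qs j + c * d
  have hE : ((badᶜ).filter E).card ≤ 1 := by
    rw [Finset.card_le_one]
    intro j hj j' hj'
    rw [Finset.mem_filter, Finset.mem_compl] at hj hj'
    obtain ⟨hj, δ, c, hc, d, hd, hcd⟩ := hj
    obtain ⟨hj', δ', c', hc', d', hd', hcd'⟩ := hj'
    obtain ⟨hδ, hR⟩ := eq_and_eq_of_not_lowRank (α := δ) (β := δ') h.not_lowRank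
      (((LowRank.mul (h.a_mem j) (h.b_mem j)).smul δ).add (LowRank.mul hc hd))
      (((LowRank.mul (h.a_mem j') (h.b_mem j')).smul δ').add (LowRank.mul hc' hd'))
      (by norm_num) (by
        rw [← add_assoc, ← smul_add, ← h.Qs_eq j, ← hcd, hcd', h.Qs_eq j', smul_add, add_assoc])
    subst hδ
    obtain ⟨h1, h2⟩ := not_mem_of_not_isSimple (γ := δ) hc hd
      (Submodule.smul_mem _ δ (hgood j hj)) (by rw [hcd, h.Qs_eq j, smul_add]) hs
    have hsub : c * d - c' * d' = δ • (a j' * b j') - δ • (a j * b j) := by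
      linear_combination hR
    have heq := mul_eq_mul_of_sub_mem hV hc hd hc' hd' (by
      rw [hsub]
      exact sub_mem (Submodule.smul_mem _ _ (hgood j' hj')) (Submodule.smul_mem _ _ (hgood j hj)))
      h1 h2
    have hδ0 : δ ≠ 0 := by
      rintro rfl
      rw [zero_smul, zero_add] at hcd
      exact hlow (hcd ▸ LowRank.mul hc hd)
    rw [hcd, heq] at hcd'
    have hQ := smul_right_injective _ hδ0 (add_right_cancel hcd')
    exact h.Qs_injective (α := 1) (by rw [one_smul]; exact hQ)
  have hthird : ∀ j ∈ (badᶜ).filter (fun j => ¬ E j), ∃ k ∈ N, ∃ α β : ℂ, α ≠ 0 ∧ β ≠ 0 ∧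
      F k = α • Qs j + β • F x := by
    intro j hj
    rw [Finset.mem_filter, Finset.mem_compl] at hj
    obtain ⟨hj, hEj⟩ := hj
    have hne : Sum.inr (Sum.inl j) ≠ x := by
      rintro rfl
      exact hs (hQsimple j hj)
    obtain ⟨α, β, hα, hβ, hr | ⟨k, -, -, hk⟩⟩ :=
      h.exists_combination hne (h.Qs_not_lowRank_two j) hlow
    · obtain ⟨c, hc, d, hd, hcd⟩ := hr.exists_eq_mul
      refine absurd ⟨-(β⁻¹ * α), β⁻¹ • c, Submodule.smul_mem _ _ hc, d, hd, ?_⟩ hEj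
      rw [smul_mul_assoc, ← hcd, smul_add, smul_smul, smul_smul, inv_mul_cancel₀ hβ, one_smul,
        neg_smul]
      change F x = -((β⁻¹ * α) • Qs j) + ((β⁻¹ * α) • Qs j + F x)
      abel
    · refine ⟨k, Finset.mem_filter.2 ⟨Finset.mem_univ _, fun hks => hs ?_⟩, α, β, hα, hβ, hk⟩
      refine hks.of_smul_eq (δ := -α) (T := -(α • (a j * b j))) hβ
        (neg_mem (Submodule.smul_mem _ _ (hgood j hj))) ?_
      change F k = α • Qs j + β • F x at hk
      rw [hk, h.Qs_eq j]
      module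
  choose! y hyN α β hα hβ hy using hthird
  have hE' : ((badᶜ).filter fun j => ¬ E j).card ≤ N.card := by
    refine Finset.card_le_card_of_injOn y hyN fun j hj j' hj' hyy => ?_
    have e1 := hy j hj
    have e2 := hy j' hj'
    rw [hyy, e2] at e1
    have hjb := Finset.mem_compl.1 (Finset.mem_filter.1 hj).1
    have hjb' := Finset.mem_compl.1 (Finset.mem_filter.1 hj').1
    rcases eq_or_ne (β j) (β j') with hββ | hββ
    · rw [hββ] at e1
      have e3 := add_right_cancel e1
      refine h.Qs_injective (α := (α j)⁻¹ * α j') ?_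
      rw [mul_smul, e3, smul_smul, inv_mul_cancel₀ (hα j hj), one_smul]
    · refine absurd (isSimple_zero.of_smul_eq (sub_ne_zero.2 hββ) (δ := α j' - α j)
        (T := α j' • (a j' * b j') - α j • (a j * b j))
        (sub_mem (Submodule.smul_mem _ _ (hgood j' hjb')) (Submodule.smul_mem _ _ (hgood j hjb)))
        ?_) hs
      rw [h.Qs_eq j, h.Qs_eq j'] at e1
      simp only [smul_eq_C_mul, map_sub] at e1 ⊢
      linear_combination -e1
  have hsum := Finset.card_filter_add_card_filter_not (s := badᶜ) E
  rw [Finset.card_compl, Fintype.card_fin] at hsum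
  have := h.card_lt
  omega

theorem exists_isSimple_of_pos (h : IsQoData Qo Qs a b Ps ls) (hm : 0 < m₂) :
    ∃ V ≤ linForms n, Module.finrank ℂ V ≤ 4 ∧ (∀ j, IsSimple Qo V (Qs j)) ∧
      ∀ i, IsSimple Qo V (Ps i) := by
  classical
  let i₀ : Fin m₂ := ⟨0, hm⟩
  let Good : Fin m₁ → Prop := fun j => ∃ γ α : ℂ, ∃ c ∈ linForms n, ∃ d ∈ linForms n, α ≠ 0 ∧
    Ps i₀ = γ • Qo + α • (a j * b j) + c * d
  let bad := Finset.univ.filter fun j => ¬ Good j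
  have hthird : ∀ j ∈ bad, ∃ i, ∃ α β : ℂ, α ≠ 0 ∧ Ps i = α • Qs j + β • Ps i₀ := by
    intro j hj
    obtain ⟨α, β, hα, hβ, ⟨ε, c, hc, d, hd, hcd⟩ | ⟨i, hi⟩⟩ := h.exists_combination_Qs j
      (x := Sum.inr (Sum.inr (Sum.inl i₀))) (by simp) (h.Ps_not_lowRank i₀)
    · refine absurd ⟨β⁻¹ * (ε - α), -(β⁻¹ * α), β⁻¹ • c, Submodule.smul_mem _ _ hc, d, hd,
        neg_ne_zero.2 (_root_.mul_ne_zero (inv_ne_zero hβ) hα), ?_⟩ (Finset.mem_filter.1 hj).2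
      change α • Qs j + β • Ps i₀ = _ at hcd
      refine smul_right_injective _ hβ ?_
      change β • Ps i₀ = β • _
      rw [eq_sub_of_add_eq' hcd, smul_mul_assoc, mul_smul, ← mul_neg, mul_smul, ← smul_add,
        ← smul_add, smul_smul, mul_inv_cancel₀ hβ, one_smul, h.Qs_eq j]
      module
    · exact ⟨i, α, β, hα, hi⟩
  have : Nonempty (Fin m₂) := ⟨i₀⟩
  choose! y α β hα hy using hthird
  have hbad : bad.card ≤ m₂ := by
    refine (Finset.card_le_card_of_injOn y (t := Finset.univ) (fun _ _ => Finset.mem_univ _)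
      fun j hj j' hj' hyy => ?_).trans (by simp)
    have e1 := hy j hj
    have e2 := hy j' hj'
    rw [hyy, e2] at e1
    rcases eq_or_ne (β j') (β j) with hββ | hββ
    · rw [hββ] at e1
      have e3 := add_right_cancel e1
      refine h.Qs_injective (α := (α j)⁻¹ * α j') ?_
      rw [mul_smul, e3, smul_smul, inv_mul_cancel₀ (hα j hj), one_smul]
    · have hβ0 := sub_ne_zero.2 hββ
      set t := β j' - β j
      refine absurd ⟨t⁻¹ * (α j - α j'), t⁻¹ * α j, -((t⁻¹ * α j') • a j'),
        neg_mem (Submodule.smul_mem _ _ (h.a_mem j')), b j', h.b_mem j',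
        _root_.mul_ne_zero (inv_ne_zero hβ0) (hα j hj), ?_⟩ (Finset.mem_filter.1 hj).2
      refine smul_right_injective _ hβ0 ?_
      change t • Ps i₀ = t • _
      rw [neg_mul, smul_mul_assoc, mul_smul, mul_smul, mul_smul, ← smul_neg, ← smul_add,
        ← smul_add, smul_smul, mul_inv_cancel₀ hβ0, one_smul]
      rw [h.Qs_eq j, h.Qs_eq j'] at e1
      simp only [t, smul_eq_C_mul, map_sub] at e1 ⊢
      linear_combination e1
  obtain ⟨j₀, hj₀⟩ : ∃ j, Good j := by
    by_contra! hcon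
    have : bad = Finset.univ := Finset.filter_true_of_mem fun j _ => hcon j
    rw [this, Finset.card_univ, Fintype.card_fin] at hbad
    have := h.card_lt
    omega
  obtain ⟨γ₀, α₀, c₀, hc₀, d₀, hd₀, hα₀, hP₀⟩ := hj₀
  set V := Submodule.span ℂ {a j₀, b j₀} ⊔ Submodule.span ℂ {c₀, d₀} with hVdef
  have hV : V ≤ linForms n := by
    refine sup_le (Submodule.span_le.2 ?_) (Submodule.span_le.2 ?_)
    · rintro x (rfl | rfl)
      exacts [h.a_mem j₀, h.b_mem j₀]
    · rintro x (rfl | rfl)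
      exacts [hc₀, hd₀]
  have := FiniteDimensional.span_of_finite ℂ (Set.toFinite {a j₀, b j₀})
  have := FiniteDimensional.span_of_finite ℂ (Set.toFinite {c₀, d₀})
  have hV4 : Module.finrank ℂ V ≤ 4 :=
    (Submodule.finrank_add_le_finrank_add_finrank _ _).trans
      (add_le_add (finrank_span_pair_le _ _) (finrank_span_pair_le _ _))
  have hR₀ : α₀ • (a j₀ * b j₀) + c₀ * d₀ ∈ V * V :=
    add_mem (Submodule.smul_mem _ _ (Submodule.mul_mem_mul
        (Submodule.mem_sup_left (Submodule.subset_span (by simp)))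
        (Submodule.mem_sup_left (Submodule.subset_span (by simp)))))
      (Submodule.mul_mem_mul (Submodule.mem_sup_right (Submodule.subset_span (by simp)))
        (Submodule.mem_sup_right (Submodule.subset_span (by simp))))
  have hgood : ∀ j ∉ bad, a j * b j ∈ V * V := by
    intro j hj
    have hGj : Good j := by
      by_contra hn
      exact hj (Finset.mem_filter.2 ⟨Finset.mem_univ _, hn⟩)
    obtain ⟨γ, α, c, hc, d, hd, hα, hP⟩ := hGj
    obtain ⟨-, hR⟩ := eq_and_eq_of_not_lowRank (α := γ) (β := γ₀) h.not_lowRank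
      (((LowRank.mul (h.a_mem j) (h.b_mem j)).smul α).add (LowRank.mul hc hd))
      (((LowRank.mul (h.a_mem j₀) (h.b_mem j₀)).smul α₀).add (LowRank.mul hc₀ hd₀))
      (by norm_num) (by rw [← add_assoc, ← add_assoc, ← hP, ← hP₀])
    rw [← hR, ← smul_mul_assoc] at hR₀
    rcases mem_or_lowRank_of_mul_add_mul_mem hV (Submodule.smul_mem _ α (h.a_mem j)) (h.b_mem j)
      hc hd hR₀ with ⟨h1, h2, -⟩ | hl
    · exact Submodule.mul_mem_mul ((Submodule.smul_mem_iff _ hα).1 h1) h2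
    · refine absurd ?_ (h.combination_not_lowRank i₀ 1 (-γ) (by simp))
      rw [hP, show (1 : ℂ) • (γ • Qo + α • (a j * b j) + c * d) + -γ • Qo
        = α • (a j * b j) + c * d by module, ← smul_mul_assoc]
      exact hl
  exact ⟨V, hV, hV4,
    fun j => h.isSimple_of_card_le hV bad hbad hgood (x := Sum.inr (Sum.inl j))
      (h.Qs_not_lowRank j),
    fun i => h.isSimple_of_card_le hV bad hbad hgood (x := Sum.inr (Sum.inr (Sum.inl i)))
      (h.Ps_not_lowRank i)⟩

theorem exists_isSimple (h : IsQoData Qo Qs a b Ps ls) :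
    ∃ V ≤ linForms n, Module.finrank ℂ V ≤ 4 ∧ (∀ j, IsSimple Qo V (Qs j)) ∧
      ∀ i, IsSimple Qo V (Ps i) := by
  rcases Nat.eq_zero_or_pos m₂ with hm | hm
  · exact h.exists_isSimple_of_isEmpty hm
  · exact h.exists_isSimple_of_pos hm

/-- For each `P_i` some `P_k` is a combination of `Q_o` and `P_i` with nonzero coefficients. -/
theorem exists_Ps_eq (h : IsQoData Qo Qs a b Ps ls) (i : Fin m₂) :
    ∃ k, ∃ α β : ℂ, α ≠ 0 ∧ β ≠ 0 ∧ Ps k = α • Qo + β • Ps i := by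
  have key : ∀ (ε α β : ℂ) (c d : MvPolynomial (Fin n) ℂ), β ≠ 0 → c ∈ linForms n →
      d ∈ linForms n → α • Qo + β • Ps i ≠ ε • Qo + c * d := by
    intro ε α β c d hβ hc hd hcd
    refine h.combination_not_lowRank i β (α - ε) (fun h0 => hβ h0.1) ?_
    rw [show β • Ps i + (α - ε) • Qo = c * d by
      rw [sub_smul, ← add_sub_assoc, add_comm, hcd, add_sub_cancel_left]]
    exact LowRank.mul hc hd
  have hQ2 : ¬ LowRank 2 Qo := fun hl => h.not_lowRank (hl.mono (by norm_num))
  obtain ⟨α, β, hα, hβ, hr | ⟨k, -, -, hk⟩⟩ :=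
    h.exists_combination (i := Sum.inl ()) (j := Sum.inr (Sum.inr (Sum.inl i))) (by simp)
      hQ2 (h.Ps_not_lowRank i)
  · obtain ⟨c, hc, d, hd, hcd⟩ := hr.exists_eq_mul
    exact absurd (by rw [zero_smul, zero_add]; exact hcd) (key 0 α β c d hβ hc hd)
  · rcases h.eq_smul_add_mul_or k with ⟨ε, c, hc, d, hd, hcd⟩ | ⟨k, rfl⟩
    · exact absurd (hk.symm.trans hcd) (key ε α β c d hβ hc hd)
    · exact ⟨k, α, β, hα, hβ, hk⟩

theorem finrank_span_le (h : IsQoData Qo Qs a b Ps ls) :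
    Module.finrank ℂ (Submodule.span ℂ (Set.range (QoFam Qo Qs Ps ls))) ≤ 50 := by
  obtain ⟨V, hV, hV4, hQs, hPs⟩ := h.exists_isSimple
  choose γQ uQ huQ hRQ using hQs
  choose γP uP huP hRP using hPs
  have hlow : ∀ {G u : MvPolynomial (Fin n) ℂ} {γ : ℂ}, u ∈ linForms n →
      G - γ • Qo ∈ supSpan V u * supSpan V u → LowRank 5 (G - γ • Qo) := fun hu hR =>
    lowRank_of_mem_mul_self (supSpan_le hV hu) (finrank_supSpan_le hV hV4) hR
  refine IsSimpleFamily.finrank_span_le (Q := Qo) (V := V)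
    (γ := Sum.elim (fun _ => 1) (Sum.elim γQ (Sum.elim γP fun _ => 0)))
    (u := Sum.elim (fun _ => 0) (Sum.elim uQ (Sum.elim uP ls)))
    { toIsRadicalFamily := h.toIsRadicalFamily
      not_lowRank := h.not_lowRank
      le_linForms := hV
      finrank_le := hV4
      u_mem := ?_
      rem_mem := ?_
      trichotomy := ?_ }
  · rintro (⟨⟩ | j | i | t)
    exacts [zero_mem _, huQ j, huP i, h.ls_mem t]
  · rintro (⟨⟩ | j | i | t)
    · change Qo - (1 : ℂ) • Qo ∈ _
      rw [one_smul, sub_self]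
      exact zero_mem _
    · exact hRQ j
    · exact hRP i
    · change ls t ^ 2 - (0 : ℂ) • Qo ∈ _
      rw [zero_smul, sub_zero, sq]
      exact Submodule.mul_mem_mul self_mem_supSpan self_mem_supSpan
  · rintro (⟨⟩ | j | i | t)
    · exact Or.inl one_ne_zero
    · refine Or.inl ?_
      change γQ j ≠ 0
      rw [(eq_and_eq_of_not_lowRank (α := γQ j) (β := 1) h.not_lowRank (hlow (huQ j) (hRQ j))
        (LowRank.mul (h.a_mem j) (h.b_mem j)) (by norm_num)
        (by rw [add_sub_cancel, one_smul]; exact h.Qs_eq j)).1]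
      exact one_ne_zero
    · rcases eq_or_ne (γP i) 0 with h0 | h0
      · refine Or.inr (Or.inr ⟨h0, h.Ps_not_lowRank i, ?_⟩)
        obtain ⟨k, α, β, hα, hβ, hk⟩ := h.exists_Ps_eq i
        have hPi := hlow (huP i) (hRP i)
        rw [h0, zero_smul, sub_zero] at hPi
        obtain ⟨hγ, hR⟩ := eq_and_eq_of_not_lowRank (α := γP k) (β := α) h.not_lowRank
          (hlow (huP k) (hRP k)) (hPi.smul β) (by norm_num) (by rw [add_sub_cancel]; exact hk)
        exact ⟨Sum.inr (Sum.inr (Sum.inl k)), show γP k ≠ 0 by rw [hγ]; exact hα, β, hβ, hR⟩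
      · exact Or.inl h0
    · exact Or.inr (Or.inl ⟨rfl, sq (ls t)⟩)

end IsQoData

theorem IsQoSet.exists_isQoData (h : IsQoSet m₁ m₂ r Qo Qs Ps ls) (hr : 100 ≤ rankS Qo) :
    ∃ a b, IsQoData Qo Qs a b Ps ls := by
  obtain ⟨hQo, hQs, hPs, hls, hind, hrad, hm, hab, hP, -⟩ := h
  choose a b ha hb hQ using hab
  refine ⟨a, b, {
    mem := ?_
    indep := hind
    prod_mem := hrad
    not_lowRank := LowRank.not_of_rankS (by omega)
    Ps_not_lowRank := fun i => not_lowRank_of_irreducible (hPs i).2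
    ls_mem := hls
    card_lt := hm
    a_mem := ha
    b_mem := hb
    Qs_eq := hQ
    combination_not_lowRank := fun i α β h0 => LowRank.not_of_rankS (hP i α β h0) }⟩
  rintro (⟨⟩ | j | i | t)
  · exact mem_linForms_mul_linForms hQo.1
  · exact mem_linForms_mul_linForms (hQs j).1
  · exact mem_linForms_mul_linForms (hPs i).1
  · exact mem_linForms_mul_linForms ((hls t).pow 2)

end QoSet

/-- Claim 5.1 of the paper, high-rank case. There is a universal
constant `c` bounding the dimension of the span of every `(Q_o,m₁,m₂)`-set with
`rank_s(Q_o) ≥ 100`. -/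
theorem statement13 :
    ∃ c : ℕ, ∀ (n m₁ m₂ r : ℕ) (Qo : MvPolynomial (Fin n) ℂ)
      (Qs : Fin m₁ → MvPolynomial (Fin n) ℂ) (Ps : Fin m₂ → MvPolynomial (Fin n) ℂ)
      (ls : Fin r → MvPolynomial (Fin n) ℂ),
      IsQoSet m₁ m₂ r Qo Qs Ps ls → 100 ≤ rankS Qo →
      Module.finrank ℂ (Submodule.span ℂ (Set.range (QoFam Qo Qs Ps ls))) ≤ c := by
  refine ⟨50, fun n m₁ m₂ r Qo Qs Ps ls h hr => ?_⟩
  obtain ⟨a, b, hd⟩ := h.exists_isQoData hr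
  exact hd.finrank_span_le
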